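/- arXiv:1212.0649 — 2 statements merged into one kernel-verified Lean document; each statement's English description precedes it below -/
import Mathlib

section
/- The optimal 6-point arrangement on the square flat torus is unique up to isometry: if p, q : Fin 6 → ℝ × ℝ are two configurations such that for all i ≠ j and all integers m, n one has ‖p i − p j + (m, n)‖ ≥ d6 and ‖q i − q j + (m, n)‖ ≥ d6, where d6 = √3/2 − (√2·√(3√3 + 2))/6 + 1/6, then there exist a 2×2 orthogonal matrix Q with integer entries, a vector t ∈ ℝ², and a permutation σ of Fin 6 such that p i − (Q·(q (σ i)) + t) ∈ ℤ² for every i. -/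
/-- The Euclidean norm on `ℝ × ℝ`. -/
noncomputable def e2norm (v : ℝ × ℝ) : ℝ := Real.sqrt (v.1 ^ 2 + v.2 ^ 2)

/-- The optimal minimal toroidal distance for 6 points on the square flat torus. -/
noncomputable def d6 : ℝ :=
  Real.sqrt 3 / 2 - Real.sqrt 2 * Real.sqrt (3 * Real.sqrt 3 + 2) / 6 + 1 / 6

/-- Application of a `2 × 2` real matrix to a vector of `ℝ × ℝ`. -/
noncomputable def mulVec2 (Q : Matrix (Fin 2) (Fin 2) ℝ) (v : ℝ × ℝ) : ℝ × ℝ :=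
  (Q 0 0 * v.1 + Q 0 1 * v.2, Q 1 0 * v.1 + Q 1 1 * v.2)

namespace SixPoints

/-- Packed table: the `k`-th 14-bit block is `⌊2 ^ 14 * √(0.400405² - (k / 512)²)⌋`. -/
def table : Nat :=
  49746547438177196160864313156448384141036773708693178748515030947275907145606569049855362615634503422354389272997114381043866915060779885258160596535033299284195748244440641667249745728215153500598731998869981188675920700876218377946441197068224842354167274458740508682762867677792453505981092669929493963908006150993967050186971183046629720548321182802785010167825070954441407157720401891498394709869411940898143728324354821074475826993315927890518081096515387053455131639321901085707156763623789238242092439842501416192110643513948932863554995809425674910878727809502231546297415719130188899884068254096035450412903267932112590666565529311739696361926617303026614640847502426017178626353759313554222055422733861844890877424807186934250565519683538586580129045561556595954222094535149054456337415304116665649576325983572700192412338961369431388291747446160112490912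

/-- Branch-free maximum. -/
def mx (a b : Nat) : Nat := Nat.add a (Nat.sub b a)

/-- Branch-free minimum. -/
def mn (a b : Nat) : Nat := Nat.sub a (Nat.sub a b)

/-- Largest distance to `512 * ℤ` of a point of `[l, l + r]`. -/
def dst (l r : Nat) : Nat :=
  cond (Nat.ble l 256) (mn (Nat.add l r) 256)
    (mx (Nat.sub 512 l) (mn (Nat.sub (Nat.add l r) 512) 256))

/-- Evaluate `x` before passing it on. -/
def force (x : Nat) (k : Nat → Bool) : Bool :=
  Nat.rec (k 0) (fun n _ ↦ k (Nat.succ n)) x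

/-- Lower bound for the horizontal distance of two points whose vertical distance is at most
`k / 512`, in units of `2 ^ (-14)`. -/
def wt (k : Nat) : Nat := Nat.mod (Nat.div table (Nat.pow 2 (Nat.mul 14 k))) 16384

/-- Largest distance modulo 512 between points of `[a, a + s]` and `[b, b + t]`. -/
def ds (a s b t : Nat) : Nat :=
  dst (Nat.mod (Nat.sub (Nat.add 1024 b) (Nat.add a s)) 512) (Nat.add s t)

/-- One step of the longest path recursion. -/
def st (a b c v w x : Nat) : Nat :=
  mx (Nat.add c x) (mx (Nat.add b w) (Nat.add a v))

/-- Longest paths from the first vertex around the 6-cycle, twice. -/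
def chain (w01 w02 w03 w04 w05 w12 w13 w14 w15 w23 w24 w25 w34 w35 w45 : Nat)
    (k : Nat → Nat → Nat → Nat → Nat → Nat → Nat → Nat → Nat → Nat → Nat → Nat → Bool) : Bool :=
  let e1 := w01
  let e2 := mx w02 (Nat.add e1 w12)
  let e3 := st 0 e1 e2 w03 w13 w23
  let e4 := st e1 e2 e3 w14 w24 w34
  let e5 := st e2 e3 e4 w25 w35 w45
  let e6 := st e3 e4 e5 w03 w04 w05
  let e7 := st e4 e5 e6 w14 w15 w01
  let e8 := st e5 e6 e7 w25 w02 w12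
  let e9 := st e6 e7 e8 w03 w13 w23
  let e10 := st e7 e8 e9 w14 w24 w34
  let e11 := st e8 e9 e10 w25 w35 w45
  let e12 := st e9 e10 e11 w03 w04 w05
  k e1 e2 e3 e4 e5 e6 e7 e8 e9 e10 e11 e12

/-- The pairwise lower bounds for a box. -/
def weights (a1 s1 a2 s2 a3 s3 a4 s4 a5 s5 : Nat)
    (k : Nat → Nat → Nat → Nat → Nat → Nat → Nat → Nat →
      Nat → Nat → Nat → Nat → Nat → Nat → Nat → Bool) : Bool :=
  k (wt (ds 64 0 a1 s1))
    (wt (ds 64 0 a2 s2))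
    (wt (ds 64 0 a3 s3))
    (wt (ds 64 0 a4 s4))
    (wt (ds 64 0 a5 s5))
    (wt (ds a1 s1 a2 s2))
    (wt (ds a1 s1 a3 s3))
    (wt (ds a1 s1 a4 s4))
    (wt (ds a1 s1 a5 s5))
    (wt (ds a2 s2 a3 s3))
    (wt (ds a2 s2 a4 s4))
    (wt (ds a2 s2 a5 s5))
    (wt (ds a3 s3 a4 s4))
    (wt (ds a3 s3 a5 s5))
    (wt (ds a4 s4 a5 s5))

/-- The box violates the normalisation of the first vertical gap. -/
def gap (a1 s1 a2 s2 a3 s3 a4 s4 a5 s5 : Nat) : Bool :=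
  or (Nat.blt (Nat.add (ds a1 s1 a2 s2) 64) a1) <|
  or (Nat.blt (Nat.add (ds a2 s2 a3 s3) 64) a1) <|
  or (Nat.blt (Nat.add (ds a3 s3 a4 s4) 64) a1) <|
  or (Nat.blt (Nat.add (ds a4 s4 a5 s5) 64) a1) <|
  Nat.blt (Nat.add (ds 64 0 a5 s5) 64) a1

/-- The box contains no admissible configuration. -/
def infeasible (a1 s1 a2 s2 a3 s3 a4 s4 a5 s5 : Nat) : Bool :=
  or (gap a1 s1 a2 s2 a3 s3 a4 s4 a5 s5) <|
  weights a1 s1 a2 s2 a3 s3 a4 s4 a5 s5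
    fun w01 w02 w03 w04 w05 w12 w13 w14 w15 w23 w24 w25 w34 w35 w45 ↦
    chain w01 w02 w03 w04 w05 w12 w13 w14 w15 w23 w24 w25 w34 w35 w45
      fun _ _ _ _ _ _ _ _ _ _ _ d ↦ Nat.ble 32769 d

/-- One vertex of the box lies in the given rectangle. -/
def inRect (yl yh xl xh a s p p' q q' : Nat) : Bool :=
  and (Nat.ble yl a) <| and (Nat.ble (Nat.add a s) yh) <|
  and (Nat.ble xl (mx p (Nat.sub p' 16384))) <|
  Nat.ble (mn (Nat.sub 32768 q) (Nat.sub 16384 q')) xh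

/-- A box of smallest size is empty or lies in one of five clusters. -/
def leaf (a1 s1 a2 s2 a3 s3 a4 s4 a5 s5 : Nat) : Bool :=
  or (infeasible a1 s1 a2 s2 a3 s3 a4 s4 a5 s5) <|
  weights a1 s1 a2 s2 a3 s3 a4 s4 a5 s5
    fun w01 w02 w03 w04 w05 w12 w13 w14 w15 w23 w24 w25 w34 w35 w45 ↦
    chain w01 w02 w03 w04 w05 w12 w13 w14 w15 w23 w24 w25 w34 w35 w45
      fun d1 d2 d3 d4 d5 _ d7 d8 d9 d10 d11 _ ↦
    chain w05 w04 w03 w02 w01 w45 w35 w25 w15 w34 w24 w14 w23 w13 w12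
      fun f1 f2 f3 f4 f5 _ f7 f8 f9 f10 f11 _ ↦
      or (and (inRect 239 244 3159 3457 a1 s1 d1 d7 f11 f5) <|
        and (inRect 61 66 6559 6662 a2 s2 d2 d8 f10 f4) <|
        and (inRect 375 380 8077 8337 a3 s3 d3 d9 f9 f3) <|
        and (inRect 198 202 11410 11513 a4 s4 d4 d10 f8 f2) <|
        (inRect 374 379 14655 14904 a5 s5 d5 d11 f7 f1)) <|
      or (and (inRect 240 243 3197 3410 a1 s1 d1 d7 f11 f5) <|
        and (inRect 438 442 4880 4945 a2 s2 d2 d8 f10 f4) <|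
        and (inRect 103 109 8077 8337 a3 s3 d3 d9 f9 f3) <|
        and (inRect 438 442 11439 11504 a4 s4 d4 d10 f8 f2) <|
        (inRect 240 244 12974 13225 a5 s5 d5 d11 f7 f1)) <|
      or (and (inRect 216 219 4293 4371 a1 s1 d1 d7 f11 f5) <|
        and (inRect 421 424 4330 4388 a2 s2 d2 d8 f10 f4) <|
        and (inRect 162 170 10618 10731 a3 s3 d3 d9 f9 f3) <|
        and (inRect 470 476 10675 10750 a4 s4 d4 d10 f8 f2) <|
        (inRect 315 323 14951 15100 a5 s5 d5 d11 f7 f1)) <|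
      or (and (inRect 113 118 6328 6382 a1 s1 d1 d7 f11 f5) <|
        and (inRect 318 324 6328 6402 a2 s2 d2 d8 f10 f4) <|
        and (inRect 471 477 10658 10731 a3 s3 d3 d9 f9 f3) <|
        and (inRect 216 219 11998 12054 a4 s4 d4 d10 f8 f2) <|
        (inRect 368 372 16320 16384 a5 s5 d5 d11 f7 f1)) <|
      and (inRect 216 220 4284 4378 a1 s1 d1 d7 f11 f5) <|
        and (inRect 471 477 5643 5726 a2 s2 d2 d8 f10 f4) <|
        and (inRect 318 322 9965 10031 a3 s3 d3 d9 f9 f3) <|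
        and (inRect 112 118 9983 10056 a4 s4 d4 d10 f8 f2) <|
        (inRect 368 372 16310 16384 a5 s5 d5 d11 f7 f1)

/-- Halve the first side of a box that is not known to be infeasible and continue with `S`. -/
def split1 (S : Nat → Nat → Nat → Nat → Nat → Nat → Nat → Nat → Nat → Nat → Bool)
    (a1 s1 a2 s2 a3 s3 a4 s4 a5 s5 : Nat) : Bool :=
  or (infeasible a1 s1 a2 s2 a3 s3 a4 s4 a5 s5) <|
  force (Nat.div s1 2) fun s ↦ and (S a1 s a2 s2 a3 s3 a4 s4 a5 s5)
    (force (Nat.add a1 s) fun a ↦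
      S a (Nat.sub s1 s) a2 s2 a3 s3 a4 s4 a5 s5)

/-- Halve the second side of a box that is not known to be infeasible and continue with `S`. -/
def split2 (S : Nat → Nat → Nat → Nat → Nat → Nat → Nat → Nat → Nat → Nat → Bool)
    (a1 s1 a2 s2 a3 s3 a4 s4 a5 s5 : Nat) : Bool :=
  or (infeasible a1 s1 a2 s2 a3 s3 a4 s4 a5 s5) <|
  force (Nat.div s2 2) fun s ↦ and (S a1 s1 a2 s a3 s3 a4 s4 a5 s5)
    (force (Nat.add a2 s) fun a ↦
      S a1 s1 a (Nat.sub s2 s) a3 s3 a4 s4 a5 s5)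

/-- Halve the third side of a box that is not known to be infeasible and continue with `S`. -/
def split3 (S : Nat → Nat → Nat → Nat → Nat → Nat → Nat → Nat → Nat → Nat → Bool)
    (a1 s1 a2 s2 a3 s3 a4 s4 a5 s5 : Nat) : Bool :=
  or (infeasible a1 s1 a2 s2 a3 s3 a4 s4 a5 s5) <|
  force (Nat.div s3 2) fun s ↦ and (S a1 s1 a2 s2 a3 s a4 s4 a5 s5)
    (force (Nat.add a3 s) fun a ↦
      S a1 s1 a2 s2 a (Nat.sub s3 s) a4 s4 a5 s5)

/-- Halve the fourth side of a box that is not known to be infeasible and continue with `S`. -/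
def split4 (S : Nat → Nat → Nat → Nat → Nat → Nat → Nat → Nat → Nat → Nat → Bool)
    (a1 s1 a2 s2 a3 s3 a4 s4 a5 s5 : Nat) : Bool :=
  or (infeasible a1 s1 a2 s2 a3 s3 a4 s4 a5 s5) <|
  force (Nat.div s4 2) fun s ↦ and (S a1 s1 a2 s2 a3 s3 a4 s a5 s5)
    (force (Nat.add a4 s) fun a ↦
      S a1 s1 a2 s2 a3 s3 a (Nat.sub s4 s) a5 s5)

/-- Halve the fifth side of a box that is not known to be infeasible and continue with `S`. -/
def split5 (S : Nat → Nat → Nat → Nat → Nat → Nat → Nat → Nat → Nat → Nat → Bool)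
    (a1 s1 a2 s2 a3 s3 a4 s4 a5 s5 : Nat) : Bool :=
  or (infeasible a1 s1 a2 s2 a3 s3 a4 s4 a5 s5) <|
  force (Nat.div s5 2) fun s ↦ and (S a1 s1 a2 s2 a3 s3 a4 s4 a5 s)
    (force (Nat.add a5 s) fun a ↦
      S a1 s1 a2 s2 a3 s3 a4 s4 a (Nat.sub s5 s))

/-- Bisection search, cycling through the five sides of a box. -/
def search : Nat → Nat → Nat → Nat → Nat → Nat → Nat → Nat → Nat → Nat → Nat → Bool
  | 0 => leaf
  | n + 1 => split1 (split2 (split3 (split4 (split5 (search n)))))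

theorem search_eq_true :
    split2 (split3 (split4 (split5 (search 8)))) 64 256 0 512 0 512 0 512 0 512 = true := by
  decide +kernel

theorem wt_spec : ∀ k : Fin 257, wt k = 0 ∨
    wt k ^ 2 * 512 ^ 2 * 10 ^ 12 + k ^ 2 * 16384 ^ 2 * 10 ^ 12 ≤ 400405 ^ 2 * (16384 * 512) ^ 2 :=
        by
  decide +kernel

theorem force_eq (x : Nat) (k : Nat → Bool) : force x k = k x := by
  cases x <;> rfl

theorem mx_eq (a b : ℕ) : mx a b = max a b := by
  simp only [mx, Nat.add_eq, Nat.sub_eq]; omega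

theorem mn_eq (a b : ℕ) : mn a b = min a b := by
  simp only [mn, Nat.sub_eq]; omega

/-- Normalised configurations: `z` are the horizontal and `u` the vertical coordinates, in units of
`2 ^ (-14)` and `2 ^ (-9)`. -/
structure Admissible (u z : Fin 6 → ℝ) : Prop where
  u_zero : u 0 = 64
  z_zero : z 0 = 0
  mono : ∀ i j, i < j → z i ≤ z j ∧ z j ≤ z i + 16384
  sep : ∀ i j, i < j → ∀ m n : ℤ, ((400405 : ℝ) / 10 ^ 6) ^ 2 ≤
    ((z j - z i) / 16384 + m) ^ 2 + ((u j - u i) / 512 + n) ^ 2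
  min_gap : ∀ i, ∀ n : ℤ, u 1 - 64 ≤ |u (i + 1) - u i + 512 * n|

/-- The real number `u` lies in `[a, a + s]`. -/
def Mem (a s : ℕ) (u : ℝ) : Prop := (a : ℝ) ≤ u ∧ u ≤ a + s

theorem exists_abs_le (x : ℝ) : ∃ m : ℤ, |x + 512 * m| ≤ 256 := by
  refine ⟨-round (x / 512), ?_⟩
  have h := abs_sub_round (x / 512)
  rw [abs_le] at h ⊢
  push_cast
  constructor <;> linarith [h.1, h.2]

theorem dst_le (l r : ℕ) : dst l r ≤ 256 := by
  rcases h : Nat.ble l 256 with _ | _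
  · have : 256 < l := by
      rw [Bool.eq_false_iff, Ne, Nat.ble_eq] at h; omega
    simp only [dst, h, cond_false, mx_eq, mn_eq, Nat.sub_eq, Nat.add_eq]; omega
  · simp only [dst, h, cond_true, mn_eq]; omega

theorem dst_spec {l r : ℕ} (hl : l < 512) {x : ℝ} (hx : Mem l r x) :
    ∃ m : ℤ, |x + 512 * m| ≤ dst l r := by
  obtain ⟨h1, h2⟩ := hx
  rcases h : Nat.ble l 256 with _ | _
  · have h256 : 256 < l := by
      rw [Bool.eq_false_iff, Ne, Nat.ble_eq] at h; omega
    have e : dst l r = max (512 - l) (min (l + r - 512) 256) := by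
      simp only [dst, h, cond_false, mx_eq, mn_eq, Nat.sub_eq, Nat.add_eq]
    have hl' : (l : ℝ) < 512 := by exact_mod_cast hl
    rcases le_or_gt 256 (l + r - 512) with h3 | h3
    · have : 256 ≤ dst l r := by omega
      obtain ⟨m, hm⟩ := exists_abs_le x
      exact ⟨m, hm.trans (by exact_mod_cast this)⟩
    · refine ⟨-1, ?_⟩
      have e1 : (512 : ℝ) ≤ dst l r + l := by
        have : 512 ≤ dst l r + l := by omega
        exact_mod_cast this
      have e2 : (l + r : ℝ) ≤ dst l r + 512 := by
        have : l + r ≤ dst l r + 512 := by omega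
        exact_mod_cast this
      rw [abs_le]; push_cast; constructor <;> linarith
  · have e : dst l r = min (l + r) 256 := by
      simp only [dst, h, cond_true, mn_eq, Nat.add_eq]
    rcases le_or_gt 256 (l + r) with h3 | h3
    · have : 256 ≤ dst l r := by omega
      obtain ⟨m, hm⟩ := exists_abs_le x
      exact ⟨m, hm.trans (by exact_mod_cast this)⟩
    · refine ⟨0, ?_⟩
      have e1 : (l + r : ℝ) = dst l r := by
        have : l + r = dst l r := by omega
        exact_mod_cast this
      have hl0 : (0 : ℝ) ≤ l := Nat.cast_nonneg l
      rw [abs_le]; push_cast; constructor <;> linarith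

theorem ds_spec {a s b t : ℕ} (h : a + s ≤ 512) {u v : ℝ} (hu : Mem a s u) (hv : Mem b t v) :
    ∃ m : ℤ, |v - u + 512 * m| ≤ ds a s b t := by
  have hmod := Nat.mod_add_div (1024 + b - (a + s)) 512
  have hx : Mem ((1024 + b - (a + s)) % 512) (s + t)
      (v - u + 1024 - 512 * ((1024 + b - (a + s)) / 512 : ℕ)) := by
    have h3 : (((1024 + b - (a + s)) % 512 : ℕ) : ℝ) + 512 * ((1024 + b - (a + s)) / 512 : ℕ)
        + (a + s) = 1024 + b := by
      have : (1024 + b - (a + s)) % 512 + 512 * ((1024 + b - (a + s)) / 512) + (a + s)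
        = 1024 + b := by omega
      exact_mod_cast this
    obtain ⟨h4, h5⟩ := hu
    obtain ⟨h6, h7⟩ := hv
    constructor
    · linarith
    · push_cast at h3 ⊢; linarith
  obtain ⟨m, hm⟩ := dst_spec (Nat.mod_lt _ (by norm_num)) hx
  refine ⟨m + 2 - ((1024 + b - (a + s)) / 512 : ℕ), ?_⟩
  have e : v - u + 512 * ((m + 2 - ((1024 + b - (a + s)) / 512 : ℕ) : ℤ) : ℝ) =
      v - u + 1024 - 512 * ((1024 + b - (a + s)) / 512 : ℕ) + 512 * m := by
    rw [Int.cast_sub, Int.cast_natCast]; push_cast; ring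
  rw [e]; exact hm

/-- The number `w` is a lower bound for the distance of `x` to both ends of `[0, 2 ^ 14]`. -/
def Bound (w : ℕ) (x : ℝ) : Prop := (w : ℝ) ≤ x ∧ (w : ℝ) ≤ 16384 - x

theorem wt_bound {k : ℕ} (hk : k ≤ 256) {x y : ℝ} (h0 : 0 ≤ x) (h1 : x ≤ 16384)
    (hy : |y| * 512 ≤ k)
    (hd : ∀ m : ℤ, ((400405 : ℝ) / 10 ^ 6) ^ 2 ≤ (x / 16384 + m) ^ 2 + y ^ 2) :
    Bound (wt k) x := by
  have key : ∀ t : ℝ, 0 ≤ t → ((400405 : ℝ) / 10 ^ 6) ^ 2 ≤ (t / 16384) ^ 2 + y ^ 2 →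
      (wt k : ℝ) ≤ t := by
    intro t ht h
    rcases wt_spec ⟨k, by omega⟩ with hw | hw
    · simp only at hw; rw [hw]; simpa using ht
    · simp only at hw
      have hw' : ((wt k : ℝ)) ^ 2 * 512 ^ 2 * 10 ^ 12 + (k : ℝ) ^ 2 * 16384 ^ 2 * 10 ^ 12 ≤
        400405 ^ 2 * (16384 * 512) ^ 2 := by exact_mod_cast hw
      have hyy : (y * 512) ^ 2 ≤ (k : ℝ) ^ 2 := by
        rw [← sq_abs (y * 512), abs_mul, abs_of_pos (by norm_num : (0 : ℝ) < 512)]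
        exact pow_le_pow_left₀ (by positivity) hy 2
      refine le_of_sq_le_sq ?_ ht
      nlinarith
  refine ⟨key x h0 (by simpa using hd 0), key (16384 - x) (by linarith) ?_⟩
  have := hd (-1)
  have e : (x / 16384 + ((-1 : ℤ) : ℝ)) ^ 2 = ((16384 - x) / 16384) ^ 2 := by push_cast; ring
  rwa [e] at this

theorem Admissible.bound {u z : Fin 6 → ℝ} (H : Admissible u z) {i j : Fin 6} (hij : i < j)
    {a s b t : ℕ} (h : a + s ≤ 512) (hu : Mem a s (u i)) (hv : Mem b t (u j)) :
    Bound (wt (ds a s b t)) (z j - z i) := by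
  obtain ⟨m, hm⟩ := ds_spec h hu hv
  obtain ⟨h1, h2⟩ := H.mono i j hij
  refine wt_bound (y := (u j - u i) / 512 + m) (dst_le _ _) (by linarith) (by linarith) ?_
    fun n ↦ H.sep i j hij n m
  have e : (u j - u i) / 512 + m = (u j - u i + 512 * m) / 512 := by ring
  rw [e, abs_div, abs_of_pos (by norm_num : (0 : ℝ) < 512), div_mul_cancel₀ _ (by norm_num)]
  exact hm

theorem not_blt {u : Fin 6 → ℝ} {a s : ℕ}
    (h1 : Mem a s (u 1)) {k : ℕ} {y : ℝ} (hk : ∃ n : ℤ, |y + 512 * n| ≤ k)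
    (hy : ∀ n : ℤ, u 1 - 64 ≤ |y + 512 * n|) : Nat.blt (Nat.add k 64) a = false := by
  obtain ⟨n, hn⟩ := hk
  have h := (hy n).trans hn
  have : (a : ℝ) ≤ k + 64 := by linarith [h1.1]
  have : a ≤ k + 64 := by exact_mod_cast this
  rw [Bool.eq_false_iff]
  simp only [Nat.add_eq, Nat.blt_eq, ne_eq]
  omega

theorem Admissible.mem_zero {u z : Fin 6 → ℝ} (H : Admissible u z) : Mem 64 0 (u 0) := by
  rw [H.u_zero]; constructor <;> norm_num

theorem Admissible.gap_eq {u z : Fin 6 → ℝ} (H : Admissible u z) {a1 s1 a2 s2 a3 s3 a4 s4 a5 s5 : ℕ}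
    (e1 : a1 + s1 ≤ 512) (e2 : a2 + s2 ≤ 512) (e3 : a3 + s3 ≤ 512) (e4 : a4 + s4 ≤ 512)
    (h1 : Mem a1 s1 (u 1)) (h2 : Mem a2 s2 (u 2)) (h3 : Mem a3 s3 (u 3)) (h4 : Mem a4 s4 (u 4))
        (h5 : Mem a5 s5 (u 5)) :
    gap a1 s1 a2 s2 a3 s3 a4 s4 a5 s5 = false := by
  have g5 : ∀ n : ℤ, u 1 - 64 ≤ |u 5 - u 0 + 512 * n| := fun n ↦ by
    have := H.min_gap 5 (-n)
    have e : u 5 - u 0 + 512 * n = -(u (5 + 1) - u 5 + 512 * ((-n : ℤ) : ℝ)) := by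
      have e0 : (5 + 1 : Fin 6) = 0 := rfl
      rw [e0]; push_cast; ring
    rwa [e, abs_neg]
  simp only [gap, Bool.or_eq_false_iff]
  exact ⟨not_blt h1 (ds_spec e1 h1 h2) (H.min_gap 1), not_blt h1 (ds_spec e2 h2 h3) (H.min_gap 2),
    not_blt h1 (ds_spec e3 h3 h4) (H.min_gap 3), not_blt h1 (ds_spec e4 h4 h5) (H.min_gap 4),
    not_blt h1 (ds_spec (by norm_num) H.mem_zero h5) g5⟩

theorem cast_mx_le {a b : ℕ} {x : ℝ} (ha : (a : ℝ) ≤ x) (hb : (b : ℝ) ≤ x) : (mx a b : ℝ) ≤ x := by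
  rw [mx_eq]; push_cast; exact max_le ha hb

theorem cast_st_le {a b c v w x : ℕ} {y : ℝ} (h1 : (a + v : ℝ) ≤ y) (h2 : (b + w : ℝ) ≤ y)
    (h3 : (c + x : ℝ) ≤ y) : (st a b c v w x : ℝ) ≤ y := by
  refine cast_mx_le ?_ (cast_mx_le ?_ ?_) <;> (simp only [Nat.add_eq]; push_cast; assumption)

theorem chain_spec {w01 w02 w03 w04 w05 w12 w13 w14 w15 w23 w24 w25 w34 w35 w45 : ℕ} {z1 z2 z3 z4
    z5 : ℝ}
    (b01 : Bound w01 (z1)) (b02 : Bound w02 (z2)) (b03 : Bound w03 (z3))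
    (b04 : Bound w04 (z4)) (b05 : Bound w05 (z5)) (b12 : Bound w12 (z2 - z1))
    (b13 : Bound w13 (z3 - z1)) (b14 : Bound w14 (z4 - z1)) (b15 : Bound w15 (z5 - z1))
    (b23 : Bound w23 (z3 - z2)) (b24 : Bound w24 (z4 - z2)) (b25 : Bound w25 (z5 - z2))
    (b34 : Bound w34 (z4 - z3)) (b35 : Bound w35 (z5 - z3)) (b45 : Bound w45 (z5 - z4))
    {k : ℕ → ℕ → ℕ → ℕ → ℕ → ℕ → ℕ → ℕ → ℕ → ℕ → ℕ → ℕ → Bool}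
    (h : chain w01 w02 w03 w04 w05 w12 w13 w14 w15 w23 w24 w25 w34 w35 w45 k = true) :
    ∃ d1 d2 d3 d4 d5 d6 d7 d8 d9 d10 d11 d12 : ℕ, k d1 d2 d3 d4 d5 d6 d7 d8 d9 d10 d11 d12 = true ∧
      ((d1 : ℝ) ≤ z1 ∧ (d2 : ℝ) ≤ z2 ∧ (d3 : ℝ) ≤ z3 ∧ (d4 : ℝ) ≤ z4 ∧ (d5 : ℝ) ≤ z5 ∧ (d6 : ℝ)
          ≤ 16384) ∧
      (d7 : ℝ) ≤ z1 + 16384 ∧ (d8 : ℝ) ≤ z2 + 16384 ∧ (d9 : ℝ) ≤ z3 + 16384 ∧ (d10 : ℝ) ≤ z4 +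
          16384 ∧ (d11 : ℝ) ≤ z5 + 16384 ∧ (d12 : ℝ) ≤ 32768 := by
  simp only [Bound] at b01 b02 b03 b04 b05 b12 b13 b14 b15 b23 b24 b25 b34 b35 b45
  unfold chain at h
  extract_lets d1 d2 d3 d4 d5 d6 d7 d8 d9 d10 d11 d12 at h
  have l1 : (d1 : ℝ) ≤ z1 := b01.1
  have l2 : (d2 : ℝ) ≤ z2 := cast_mx_le b02.1 (by simp only [Nat.add_eq]; push_cast; linarith
      [b12.1])
  have l3 : (d3 : ℝ) ≤ z3 := cast_st_le (by simp only [Nat.cast_zero]; linarith [b03.1])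
      (by linarith [l1, b13.1])
    (by linarith [l2, b23.1])
  have l4 : (d4 : ℝ) ≤ z4 := cast_st_le (by linarith [l1, b14.1]) (by linarith [l2, b24.1])
    (by linarith [l3, b34.1])
  have l5 : (d5 : ℝ) ≤ z5 := cast_st_le (by linarith [l2, b25.1]) (by linarith [l3, b35.1])
    (by linarith [l4, b45.1])
  have l6 : (d6 : ℝ) ≤ 16384 := cast_st_le (by linarith [l3, b03.2]) (by linarith [l4, b04.2])
    (by linarith [l5, b05.2])
  have l7 : (d7 : ℝ) ≤ z1 + 16384 := cast_st_le (by linarith [l4, b14.2]) (by linarith [l5, b15.2])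
    (by linarith [l6, b01.1])
  have l8 : (d8 : ℝ) ≤ z2 + 16384 := cast_st_le (by linarith [l5, b25.2]) (by linarith [l6, b02.1])
    (by linarith [l7, b12.1])
  have l9 : (d9 : ℝ) ≤ z3 + 16384 := cast_st_le (by linarith [l6, b03.1]) (by linarith [l7, b13.1])
    (by linarith [l8, b23.1])
  have l10 : (d10 : ℝ) ≤ z4 + 16384 := cast_st_le (by linarith [l7, b14.1]) (by linarith [l8,
      b24.1])
    (by linarith [l9, b34.1])
  have l11 : (d11 : ℝ) ≤ z5 + 16384 := cast_st_le (by linarith [l8, b25.1]) (by linarith [l9,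
      b35.1])
    (by linarith [l10, b45.1])
  have l12 : (d12 : ℝ) ≤ 32768 := cast_st_le (by linarith [l9, b03.2]) (by linarith [l10, b04.2])
    (by linarith [l11, b05.2])
  exact ⟨d1, d2, d3, d4, d5, d6, d7, d8, d9, d10, d11, d12, h, ⟨l1, l2, l3, l4, l5, l6⟩,
    l7, l8, l9, l10, l11, l12⟩

theorem Bound.reflect {w : ℕ} {x y : ℝ} (h : Bound w x) (e : y = 16384 - x) : Bound w y := by
  subst e; exact ⟨h.2, by linarith [h.1]⟩

theorem Bound.congr {w : ℕ} {x y : ℝ} (h : Bound w x) (e : y = x) : Bound w y := e ▸ h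

theorem Admissible.weights_spec {u z : Fin 6 → ℝ} (H : Admissible u z)
    {a1 s1 a2 s2 a3 s3 a4 s4 a5 s5 : ℕ}
    (e1 : a1 + s1 ≤ 512) (e2 : a2 + s2 ≤ 512) (e3 : a3 + s3 ≤ 512) (e4 : a4 + s4 ≤ 512)
    (h1 : Mem a1 s1 (u 1)) (h2 : Mem a2 s2 (u 2)) (h3 : Mem a3 s3 (u 3)) (h4 : Mem a4 s4 (u 4))
        (h5 : Mem a5 s5 (u 5))
    {k : ℕ → ℕ → ℕ → ℕ → ℕ → ℕ → ℕ → ℕ → ℕ → ℕ → ℕ → ℕ → ℕ → ℕ → ℕ → Bool}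
    (h : weights a1 s1 a2 s2 a3 s3 a4 s4 a5 s5 k = true) :
    ∃ w01 w02 w03 w04 w05 w12 w13 w14 w15 w23 w24 w25 w34 w35 w45 : ℕ,
      k w01 w02 w03 w04 w05 w12 w13 w14 w15 w23 w24 w25 w34 w35 w45 = true ∧
      (Bound w01 (z 1) ∧ Bound w02 (z 2) ∧ Bound w03 (z 3) ∧ Bound w04 (z 4) ∧ Bound w05 (z 5)) ∧
      (Bound w12 (z 2 - z 1) ∧ Bound w13 (z 3 - z 1) ∧ Bound w14 (z 4 - z 1) ∧ Bound w15 (z 5 - z 1)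
          ∧ Bound w23 (z 3 - z 2)) ∧
      Bound w24 (z 4 - z 2) ∧ Bound w25 (z 5 - z 2) ∧ Bound w34 (z 4 - z 3) ∧ Bound w35 (z 5 - z 3)
          ∧ Bound w45 (z 5 - z 4) := by
  have z0 : ∀ x, x = x - z 0 := by simp [H.z_zero]
  exact ⟨_, _, _, _, _, _, _, _, _, _, _, _, _, _, _, h,
    ⟨(H.bound (i := 0) (by decide) (by norm_num) H.mem_zero h1).congr (z0 _), (H.bound (i := 0)
        (by decide) (by norm_num) H.mem_zero h2).congr (z0 _), (H.bound (i := 0) (by decide)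
        (by norm_num) H.mem_zero h3).congr (z0 _), (H.bound (i := 0) (by decide) (by norm_num)
        H.mem_zero h4).congr (z0 _), (H.bound (i := 0) (by decide) (by norm_num)
        H.mem_zero h5).congr (z0 _)⟩,
    ⟨H.bound (by decide) e1 h1 h2, H.bound (by decide) e1 h1 h3, H.bound (by decide) e1 h1 h4,
        H.bound (by decide) e1 h1 h5, H.bound (by decide) e2 h2 h3⟩,
    H.bound (by decide) e2 h2 h4, H.bound (by decide) e2 h2 h5, H.bound (by decide) e3 h3 h4,
        H.bound (by decide) e3 h3 h5, H.bound (by decide) e4 h4 h5⟩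

theorem Admissible.infeasible_eq {u z : Fin 6 → ℝ} (H : Admissible u z)
    {a1 s1 a2 s2 a3 s3 a4 s4 a5 s5 : ℕ}
    (e1 : a1 + s1 ≤ 512) (e2 : a2 + s2 ≤ 512) (e3 : a3 + s3 ≤ 512) (e4 : a4 + s4 ≤ 512)
    (h1 : Mem a1 s1 (u 1)) (h2 : Mem a2 s2 (u 2)) (h3 : Mem a3 s3 (u 3)) (h4 : Mem a4 s4 (u 4))
        (h5 : Mem a5 s5 (u 5)) :
    infeasible a1 s1 a2 s2 a3 s3 a4 s4 a5 s5 = false := by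
  rw [Bool.eq_false_iff]
  intro h
  simp only [infeasible, Bool.or_eq_true, H.gap_eq e1 e2 e3 e4 h1 h2 h3 h4 h5, Bool.false_eq_true,
    false_or] at h
  obtain ⟨w01, w02, w03, w04, w05, w12, w13, w14, w15, w23, w24, w25, w34, w35, w45, h, ⟨b01, b02,
      b03, b04, b05⟩, ⟨b12, b13, b14, b15, b23⟩,
    b24, b25, b34, b35, b45⟩ := H.weights_spec e1 e2 e3 e4 h1 h2 h3 h4 h5 h
  obtain ⟨-, -, -, -, -, -, -, -, -, -, -, d, h, -, -, -, -, -, -, hd⟩ :=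
    chain_spec b01 b02 b03 b04 b05 b12 b13 b14 b15 b23 b24 b25 b34 b35 b45 h
  have h' : 32769 ≤ d := by simpa using h
  have : (32769 : ℝ) ≤ d := by exact_mod_cast h'
  linarith

/-- The point `(x, y)` lies in the given rectangle. -/
def Rect (yl yh xl xh : ℕ) (y x : ℝ) : Prop :=
  ((yl : ℝ) ≤ y ∧ y ≤ yh) ∧ (xl : ℝ) ≤ x ∧ x ≤ xh

theorem rect_of_inRect {yl yh xl xh a s p p' q q' : ℕ} {y x : ℝ} (hy : Mem a s y) (hx : 0 ≤ x)
    (hp : (p : ℝ) ≤ x) (hp' : (p' : ℝ) ≤ x + 16384) (hq : (q : ℝ) ≤ 16384 - x + 16384)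
    (hq' : (q' : ℝ) ≤ 16384 - x) (h : inRect yl yh xl xh a s p p' q q' = true) :
    Rect yl yh xl xh y x := by
  simp only [inRect, Bool.and_eq_true, Nat.ble_eq, mx_eq, mn_eq, Nat.add_eq, Nat.sub_eq] at h
  obtain ⟨h1, h2, h3, h4⟩ := h
  have h1' : (yl : ℝ) ≤ a := by exact_mod_cast h1
  have h2' : (a + s : ℝ) ≤ yh := by exact_mod_cast h2
  refine ⟨⟨by linarith [hy.1], by linarith [hy.2]⟩, ?_, ?_⟩
  · rcases le_max_iff.1 h3 with h5 | h5
    · exact le_trans (by exact_mod_cast h5) hp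
    · rcases le_or_gt p' 16384 with h6 | h6
      · have : xl = 0 := by omega
        rw [this]; simpa using hx
      · have : xl + 16384 ≤ p' := by omega
        have : (xl + 16384 : ℝ) ≤ p' := by exact_mod_cast this
        linarith
  · rcases min_le_iff.1 h4 with h5 | h5
    · have : 32768 ≤ xh + q := by omega
      have : (32768 : ℝ) ≤ xh + q := by exact_mod_cast this
      linarith
    · have : 16384 ≤ xh + q' := by omega
      have : (16384 : ℝ) ≤ xh + q' := by exact_mod_cast this
      linarith

/-- The configuration lies in one of five clusters. -/
def InCluster (u z : Fin 6 → ℝ) : Prop :=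
  (Rect 239 244 3159 3457 (u 1) (z 1) ∧ Rect 61 66 6559 6662 (u 2) (z 2) ∧
    Rect 375 380 8077 8337 (u 3) (z 3) ∧ Rect 198 202 11410 11513 (u 4) (z 4) ∧
    Rect 374 379 14655 14904 (u 5) (z 5)) ∨
  (Rect 240 243 3197 3410 (u 1) (z 1) ∧ Rect 438 442 4880 4945 (u 2) (z 2) ∧
    Rect 103 109 8077 8337 (u 3) (z 3) ∧ Rect 438 442 11439 11504 (u 4) (z 4) ∧
    Rect 240 244 12974 13225 (u 5) (z 5)) ∨
  (Rect 216 219 4293 4371 (u 1) (z 1) ∧ Rect 421 424 4330 4388 (u 2) (z 2) ∧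
    Rect 162 170 10618 10731 (u 3) (z 3) ∧ Rect 470 476 10675 10750 (u 4) (z 4) ∧
    Rect 315 323 14951 15100 (u 5) (z 5)) ∨
  (Rect 113 118 6328 6382 (u 1) (z 1) ∧ Rect 318 324 6328 6402 (u 2) (z 2) ∧
    Rect 471 477 10658 10731 (u 3) (z 3) ∧ Rect 216 219 11998 12054 (u 4) (z 4) ∧
    Rect 368 372 16320 16384 (u 5) (z 5)) ∨
  (Rect 216 220 4284 4378 (u 1) (z 1) ∧ Rect 471 477 5643 5726 (u 2) (z 2) ∧
    Rect 318 322 9965 10031 (u 3) (z 3) ∧ Rect 112 118 9983 10056 (u 4) (z 4) ∧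
    Rect 368 372 16310 16384 (u 5) (z 5))

theorem Admissible.leaf_spec {u z : Fin 6 → ℝ} (H : Admissible u z)
    {a1 s1 a2 s2 a3 s3 a4 s4 a5 s5 : ℕ}
    (e1 : a1 + s1 ≤ 512) (e2 : a2 + s2 ≤ 512) (e3 : a3 + s3 ≤ 512) (e4 : a4 + s4 ≤ 512)
    (h1 : Mem a1 s1 (u 1)) (h2 : Mem a2 s2 (u 2)) (h3 : Mem a3 s3 (u 3)) (h4 : Mem a4 s4 (u 4))
        (h5 : Mem a5 s5 (u 5))
    (h : leaf a1 s1 a2 s2 a3 s3 a4 s4 a5 s5 = true) : InCluster u z := by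
  simp only [leaf, Bool.or_eq_true, H.infeasible_eq e1 e2 e3 e4 h1 h2 h3 h4 h5,
    Bool.false_eq_true, false_or] at h
  obtain ⟨w01, w02, w03, w04, w05, w12, w13, w14, w15, w23, w24, w25, w34, w35, w45, h, ⟨b01, b02,
      b03, b04, b05⟩, ⟨b12, b13, b14, b15, b23⟩,
    b24, b25, b34, b35, b45⟩ := H.weights_spec e1 e2 e3 e4 h1 h2 h3 h4 h5 h
  obtain ⟨d1, d2, d3, d4, d5, d6, d7, d8, d9, d10, d11, d12, h, ⟨l1, l2, l3, l4, l5, l6⟩, l7, l8,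
      l9, l10, l11, l12⟩ :=
    chain_spec b01 b02 b03 b04 b05 b12 b13 b14 b15 b23 b24 b25 b34 b35 b45 h
  obtain ⟨f1, f2, f3, f4, f5, f6, f7, f8, f9, f10, f11, f12, h, ⟨m1, m2, m3, m4, m5, m6⟩, m7, m8,
      m9, m10, m11, m12⟩ :=
    chain_spec (z1 := 16384 - z 5) (z2 := 16384 - z 4) (z3 := 16384 - z 3) (z4 := 16384 - z 2)
      (z5 := 16384 - z 1) (b05.reflect rfl) (b04.reflect rfl) (b03.reflect rfl) (b02.reflect rfl)
          (b01.reflect rfl) (b45.congr (by ring)) (b35.congr (by ring)) (b25.congr (by ring))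
          (b15.congr (by ring)) (b34.congr (by ring)) (b24.congr (by ring))
          (b14.congr (by ring)) (b23.congr (by ring)) (b13.congr (by ring))
          (b12.congr (by ring)) h
  have p : ∀ k : Fin 6, 0 < k → 0 ≤ z k := fun k hk ↦ by
    have := (H.mono 0 k hk).1
    rwa [H.z_zero] at this
  simp only [Bool.or_eq_true, Bool.and_eq_true] at h
  rcases h with h | h | h | h | h
  · exact Or.inl ⟨rect_of_inRect h1 (p 1 (by decide)) l1 l7 m11 m5 h.1,
        rect_of_inRect h2 (p 2 (by decide)) l2 l8 m10 m4 h.2.1, rect_of_inRect h3 (p 3 (by decide))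
        l3 l9 m9 m3 h.2.2.1, rect_of_inRect h4 (p 4 (by decide)) l4 l10 m8 m2 h.2.2.2.1,
        rect_of_inRect h5 (p 5 (by decide)) l5 l11 m7 m1 h.2.2.2.2⟩
  · exact Or.inr <| Or.inl ⟨rect_of_inRect h1 (p 1 (by decide)) l1 l7 m11 m5 h.1,
        rect_of_inRect h2 (p 2 (by decide)) l2 l8 m10 m4 h.2.1, rect_of_inRect h3 (p 3 (by decide))
        l3 l9 m9 m3 h.2.2.1, rect_of_inRect h4 (p 4 (by decide)) l4 l10 m8 m2 h.2.2.2.1,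
        rect_of_inRect h5 (p 5 (by decide)) l5 l11 m7 m1 h.2.2.2.2⟩
  · exact Or.inr <| Or.inr <| Or.inl ⟨rect_of_inRect h1 (p 1 (by decide)) l1 l7 m11 m5 h.1,
        rect_of_inRect h2 (p 2 (by decide)) l2 l8 m10 m4 h.2.1, rect_of_inRect h3 (p 3 (by decide))
        l3 l9 m9 m3 h.2.2.1, rect_of_inRect h4 (p 4 (by decide)) l4 l10 m8 m2 h.2.2.2.1,
        rect_of_inRect h5 (p 5 (by decide)) l5 l11 m7 m1 h.2.2.2.2⟩
  · exact Or.inr <| Or.inr <| Or.inr <| Or.inl ⟨rect_of_inRect h1 (p 1 (by decide))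
        l1 l7 m11 m5 h.1, rect_of_inRect h2 (p 2 (by decide)) l2 l8 m10 m4 h.2.1,
        rect_of_inRect h3 (p 3 (by decide)) l3 l9 m9 m3 h.2.2.1,
        rect_of_inRect h4 (p 4 (by decide)) l4 l10 m8 m2 h.2.2.2.1,
        rect_of_inRect h5 (p 5 (by decide)) l5 l11 m7 m1 h.2.2.2.2⟩
  · exact Or.inr <| Or.inr <| Or.inr <| Or.inr <| ⟨rect_of_inRect h1 (p 1 (by decide))
        l1 l7 m11 m5 h.1, rect_of_inRect h2 (p 2 (by decide)) l2 l8 m10 m4 h.2.1,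
        rect_of_inRect h3 (p 3 (by decide)) l3 l9 m9 m3 h.2.2.1,
        rect_of_inRect h4 (p 4 (by decide)) l4 l10 m8 m2 h.2.2.2.1,
        rect_of_inRect h5 (p 5 (by decide)) l5 l11 m7 m1 h.2.2.2.2⟩

/-- Boolean tests of boxes that hold only if all admissible configurations in the box belong to
one of the clusters. -/
def Sound (S : ℕ → ℕ → ℕ → ℕ → ℕ → ℕ → ℕ → ℕ → ℕ → ℕ → Bool) : Prop :=
  ∀ a1 s1 a2 s2 a3 s3 a4 s4 a5 s5 : ℕ, a1 + s1 ≤ 512 → a2 + s2 ≤ 512 → a3 + s3 ≤ 512 → a4 +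
      s4 ≤ 512 → a5 + s5 ≤ 512 →
    S a1 s1 a2 s2 a3 s3 a4 s4 a5 s5 = true → ∀ u z : Fin 6 → ℝ, Admissible u z →
    Mem a1 s1 (u 1) → Mem a2 s2 (u 2) → Mem a3 s3 (u 3) → Mem a4 s4 (u 4) → Mem a5 s5 (u 5) →
    InCluster u z

theorem mem_split {a s : ℕ} {u : ℝ} (h : Mem a s u) :
    Mem a (s / 2) u ∨ Mem (a + s / 2) (s - s / 2) u := by
  obtain ⟨h1, h2⟩ := h
  rcases le_total u (a + (s / 2 : ℕ)) with h3 | h3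
  · exact .inl ⟨h1, h3⟩
  · refine .inr ⟨by push_cast; exact h3, ?_⟩
    have : ((s - s / 2 : ℕ) : ℝ) + (s / 2 : ℕ) = s := by
      rw [← Nat.cast_add]; congr 1; omega
    push_cast at this ⊢; linarith

theorem sound_leaf : Sound leaf :=
  fun _ _ _ _ _ _ _ _ _ _ e1 e2 e3 e4 _ h _ _ H h1 h2 h3 h4 h5 ↦
    H.leaf_spec e1 e2 e3 e4 h1 h2 h3 h4 h5 h

theorem Sound.split1 {S : ℕ → ℕ → ℕ → ℕ → ℕ → ℕ → ℕ → ℕ → ℕ → ℕ → Bool} (hS : Sound S)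
    : Sound (split1 S) := by
  intro a1 s1 a2 s2 a3 s3 a4 s4 a5 s5 e1 e2 e3 e4 e5 h u z H h1 h2 h3 h4 h5
  simp only [SixPoints.split1, H.infeasible_eq e1 e2 e3 e4 h1 h2 h3 h4 h5, Bool.false_or, force_eq,
    Bool.and_eq_true, Nat.add_eq, Nat.sub_eq, show ∀ x y,
        Nat.div x y = x / y from fun _ _ ↦ rfl] at h
  rcases mem_split h1 with hk | hk
  · exact hS _ _ _ _ _ _ _ _ _ _ (by omega) e2 e3 e4 e5 h.1 u z H hk h2 h3 h4 h5
  · exact hS _ _ _ _ _ _ _ _ _ _ (by omega) e2 e3 e4 e5 h.2 u z H hk h2 h3 h4 h5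

theorem Sound.split2 {S : ℕ → ℕ → ℕ → ℕ → ℕ → ℕ → ℕ → ℕ → ℕ → ℕ → Bool} (hS : Sound S)
    : Sound (split2 S) := by
  intro a1 s1 a2 s2 a3 s3 a4 s4 a5 s5 e1 e2 e3 e4 e5 h u z H h1 h2 h3 h4 h5
  simp only [SixPoints.split2, H.infeasible_eq e1 e2 e3 e4 h1 h2 h3 h4 h5, Bool.false_or, force_eq,
    Bool.and_eq_true, Nat.add_eq, Nat.sub_eq, show ∀ x y,
        Nat.div x y = x / y from fun _ _ ↦ rfl] at h
  rcases mem_split h2 with hk | hk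
  · exact hS _ _ _ _ _ _ _ _ _ _ e1 (by omega) e3 e4 e5 h.1 u z H h1 hk h3 h4 h5
  · exact hS _ _ _ _ _ _ _ _ _ _ e1 (by omega) e3 e4 e5 h.2 u z H h1 hk h3 h4 h5

theorem Sound.split3 {S : ℕ → ℕ → ℕ → ℕ → ℕ → ℕ → ℕ → ℕ → ℕ → ℕ → Bool} (hS : Sound S)
    : Sound (split3 S) := by
  intro a1 s1 a2 s2 a3 s3 a4 s4 a5 s5 e1 e2 e3 e4 e5 h u z H h1 h2 h3 h4 h5
  simp only [SixPoints.split3, H.infeasible_eq e1 e2 e3 e4 h1 h2 h3 h4 h5, Bool.false_or, force_eq,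
    Bool.and_eq_true, Nat.add_eq, Nat.sub_eq, show ∀ x y,
        Nat.div x y = x / y from fun _ _ ↦ rfl] at h
  rcases mem_split h3 with hk | hk
  · exact hS _ _ _ _ _ _ _ _ _ _ e1 e2 (by omega) e4 e5 h.1 u z H h1 h2 hk h4 h5
  · exact hS _ _ _ _ _ _ _ _ _ _ e1 e2 (by omega) e4 e5 h.2 u z H h1 h2 hk h4 h5

theorem Sound.split4 {S : ℕ → ℕ → ℕ → ℕ → ℕ → ℕ → ℕ → ℕ → ℕ → ℕ → Bool} (hS : Sound S)
    : Sound (split4 S) := by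
  intro a1 s1 a2 s2 a3 s3 a4 s4 a5 s5 e1 e2 e3 e4 e5 h u z H h1 h2 h3 h4 h5
  simp only [SixPoints.split4, H.infeasible_eq e1 e2 e3 e4 h1 h2 h3 h4 h5, Bool.false_or, force_eq,
    Bool.and_eq_true, Nat.add_eq, Nat.sub_eq, show ∀ x y,
        Nat.div x y = x / y from fun _ _ ↦ rfl] at h
  rcases mem_split h4 with hk | hk
  · exact hS _ _ _ _ _ _ _ _ _ _ e1 e2 e3 (by omega) e5 h.1 u z H h1 h2 h3 hk h5
  · exact hS _ _ _ _ _ _ _ _ _ _ e1 e2 e3 (by omega) e5 h.2 u z H h1 h2 h3 hk h5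

theorem Sound.split5 {S : ℕ → ℕ → ℕ → ℕ → ℕ → ℕ → ℕ → ℕ → ℕ → ℕ → Bool} (hS : Sound S)
    : Sound (split5 S) := by
  intro a1 s1 a2 s2 a3 s3 a4 s4 a5 s5 e1 e2 e3 e4 e5 h u z H h1 h2 h3 h4 h5
  simp only [SixPoints.split5, H.infeasible_eq e1 e2 e3 e4 h1 h2 h3 h4 h5, Bool.false_or, force_eq,
    Bool.and_eq_true, Nat.add_eq, Nat.sub_eq, show ∀ x y,
        Nat.div x y = x / y from fun _ _ ↦ rfl] at h
  rcases mem_split h5 with hk | hk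
  · exact hS _ _ _ _ _ _ _ _ _ _ e1 e2 e3 e4 (by omega) h.1 u z H h1 h2 h3 h4 hk
  · exact hS _ _ _ _ _ _ _ _ _ _ e1 e2 e3 e4 (by omega) h.2 u z H h1 h2 h3 h4 hk

theorem sound_search (n : ℕ) : Sound (search n) := by
  induction n with
  | zero => exact sound_leaf
  | succ n ih => exact ih.split5.split4.split3.split2.split1

theorem Admissible.inCluster {u z : Fin 6 → ℝ} (H : Admissible u z) (h1 : 64 ≤ u 1 ∧ u 1 ≤ 320)
    (h : ∀ k, 0 ≤ u k ∧ u k ≤ 512) : InCluster u z := by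
  refine (sound_search 8).split5.split4.split3.split2 64 256 0 512 0 512 0 512 0 512 (by norm_num)
    le_rfl le_rfl le_rfl le_rfl search_eq_true u z H ?_ ?_ ?_ ?_ ?_ <;>
  · constructor <;> norm_num [h, h1]

/-! ### The optimal configuration -/

theorem sqrt_three_sq : √3 ^ 2 = (3 : ℝ) := Real.sq_sqrt (by norm_num)

theorem sqrt_three_gt : 1.7320508 < √3 := Real.lt_sqrt_of_sq_lt (by norm_num)

theorem sqrt_three_lt : √3 < 1.7320509 := by
  rw [Real.sqrt_lt' (by norm_num)]; norm_num

theorem sq_sqrt_two_mul_sqrt : (√2 * √(3 * √3 + 2)) ^ 2 = 6 * √3 + 4 := by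
  rw [mul_pow, Real.sq_sqrt (by norm_num), Real.sq_sqrt (by positivity)]; ring

theorem d6_quadratic : 3 * d6 ^ 2 - (3 * √3 + 1) * d6 + 2 = 0 := by
  unfold d6
  linear_combination (1 / 12) * sq_sqrt_two_mul_sqrt - (3 / 4) * sqrt_three_sq

theorem d6_gt : 0.400405 < d6 := by
  have h : √2 * √(3 * √3 + 2) < 3.793720 :=
    lt_of_pow_lt_pow_left₀ 2 (by norm_num) (by
      rw [sq_sqrt_two_mul_sqrt]; linarith [sqrt_three_lt])
  unfold d6; linarith [sqrt_three_gt]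

theorem d6_lt : d6 < 0.400406 := by
  have h : 3.793719 < √2 * √(3 * √3 + 2) :=
    lt_of_pow_lt_pow_left₀ 2 (by positivity) (by
      rw [sq_sqrt_two_mul_sqrt]; linarith [sqrt_three_gt])
  unfold d6; linarith [sqrt_three_lt]

/-- Half of the height of an equilateral triangle with side `d6`. -/
noncomputable def hh : ℝ := √3 * d6 / 2

/-- A coordinate of the optimal configuration. -/
noncomputable def cc : ℝ := (√3 - 3 * d6) / 2

/-- A coordinate of the optimal configuration. -/
noncomputable def ee : ℝ := (1 - d6) / 2

/-- A coordinate of the optimal configuration. -/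
noncomputable def ff : ℝ := 1 - hh - cc

/-- A coordinate of the optimal configuration. -/
noncomputable def gg : ℝ := 1 / 2 - d6

/-- The optimal configuration. -/
noncomputable def base : Fin 6 → ℝ × ℝ :=
  ![(0, 0), (hh, d6 / 2), (hh, -d6 / 2), (hh - cc, 1 / 2), (-cc, ee), (-cc, -ee)]

theorem hh_sq : hh ^ 2 + (d6 / 2) ^ 2 = d6 ^ 2 := by
  unfold hh; linear_combination (d6 ^ 2 / 4) * sqrt_three_sq

theorem cc_sq : cc ^ 2 + ee ^ 2 = d6 ^ 2 := by
  unfold cc ee; linear_combination (1 / 4) * sqrt_three_sq + (1 / 2) * d6_quadratic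

theorem ff_sq : ff ^ 2 + gg ^ 2 = d6 ^ 2 := by
  unfold ff gg hh cc
  linear_combination (1 / 4 - d6 + d6 ^ 2 / 4) * sqrt_three_sq + (1 - √3 / 2) * d6_quadratic

theorem hh_bounds : 0.34676 < hh ∧ hh < 0.346763 := by
  unfold hh
  constructor <;> nlinarith [sqrt_three_gt, sqrt_three_lt, d6_gt, d6_lt]

theorem cc_bounds : 0.265416 < cc ∧ cc < 0.265419 := by
  unfold cc
  constructor <;> linarith [sqrt_three_gt, sqrt_three_lt, d6_gt, d6_lt]

/-- Points of the torus have pairwise distance at least `d6`. -/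
def Feasible (p : Fin 6 → ℝ × ℝ) : Prop :=
  ∀ i j : Fin 6, i ≠ j → ∀ m n : ℤ,
    d6 ^ 2 ≤ ((p i).1 - (p j).1 + m) ^ 2 + ((p i).2 - (p j).2 + n) ^ 2

/-- Second order estimate for the length of a perturbed contact vector. -/
theorem edge_estimate {vx vy ax ay X Y w C q : ℝ} (hv : vx ^ 2 + vy ^ 2 = d6 ^ 2)
    (hd : d6 ^ 2 ≤ (vx + X) ^ 2 + (vy + Y) ^ 2) (hX : |X| ≤ 0.022) (hY : |Y| ≤ 0.022)
    (hax : |vx - ax| ≤ 0.0005) (hay : |vy - ay| ≤ 0.0005) (hC : 0 ≤ C)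
    (hw : C * (0.022 * (|ax| + |ay| + 0.001)) ≤ w) (hq : w + 0.0006 * C + 0.05 ≤ q) :
    0.05 * (X ^ 2 + Y ^ 2) ≤ 2 * (w * (vx * X + vy * Y)) + q * (X ^ 2 + Y ^ 2)
      - 1.9 * C * (ax * X + ay * Y) ^ 2 := by
  set t := vx * X + vy * Y with ht
  set Q := X ^ 2 + Y ^ 2 with hQ
  have hQ0 : 0 ≤ Q := by positivity
  have h1 : 0 ≤ 2 * t + Q := by rw [ht, hQ]; nlinarith
  have hX2 : X ^ 2 ≤ 0.022 ^ 2 := sq_le_sq' (abs_le.1 hX).1 (abs_le.1 hX).2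
  have hY2 : Y ^ 2 ≤ 0.022 ^ 2 := sq_le_sq' (abs_le.1 hY).1 (abs_le.1 hY).2
  have hQ1 : Q ≤ 0.000968 := by rw [hQ]; linarith
  have hvx : |vx| ≤ |ax| + 0.0005 := by
    calc |vx| = |ax + (vx - ax)| := by congr 1; ring
      _ ≤ _ := (abs_add_le _ _).trans (by linarith)
  have hvy : |vy| ≤ |ay| + 0.0005 := by
    calc |vy| = |ay + (vy - ay)| := by congr 1; ring
      _ ≤ _ := (abs_add_le _ _).trans (by linarith)
  have ht1 : t ≤ 0.022 * (|ax| + |ay| + 0.001) := by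
    calc t ≤ |vx * X| + |vy * Y| := add_le_add (le_abs_self _) (le_abs_self _)
      _ = |vx| * |X| + |vy| * |Y| := by rw [abs_mul, abs_mul]
      _ ≤ (|ax| + 0.0005) * 0.022 + (|ay| + 0.0005) * 0.022 := by gcongr
      _ = _ := by ring
  have hwC : 0 ≤ w - C * t := by linarith [mul_le_mul_of_nonneg_left ht1 hC]
  have h2 : 0 ≤ (w - C * t) * (2 * t + Q) := mul_nonneg hwC h1
  have h3 : -(C * t * Q) ≤ C * 0.000484 * Q := by
    have : 0 ≤ C * Q * (t + Q / 2) := mul_nonneg (mul_nonneg hC hQ0) (by linarith)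
    have : 0 ≤ C * Q * (0.000968 - Q) := mul_nonneg (mul_nonneg hC hQ0) (by linarith)
    linarith
  have h4 : ((vx - ax) * X + (vy - ay) * Y) ^ 2 ≤ 0.0000005 * Q := by
    have e1 : (vx - ax) ^ 2 ≤ 0.0005 ^ 2 := sq_le_sq' (abs_le.1 hax).1 (abs_le.1 hax).2
    have e2 : (vy - ay) ^ 2 ≤ 0.0005 ^ 2 := sq_le_sq' (abs_le.1 hay).1 (abs_le.1 hay).2
    have e3 := mul_le_mul_of_nonneg_right (add_le_add e1 e2) hQ0
    have e4 := sq_nonneg ((vx - ax) * Y - (vy - ay) * X)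
    rw [hQ] at e3 ⊢
    linarith
  have h5 : 0.95 * (ax * X + ay * Y) ^ 2 ≤ t ^ 2 + 19 * (0.0000005 * Q) := by
    have e1 : ax * X + ay * Y = t - ((vx - ax) * X + (vy - ay) * Y) := by rw [ht]; ring
    rw [e1]
    nlinarith [sq_nonneg (t + 19 * ((vx - ax) * X + (vy - ay) * Y))]
  have h6 := mul_le_mul_of_nonneg_left h5 hC
  have h7 := mul_le_mul_of_nonneg_right hq hQ0
  have h8 : 0 ≤ C * Q := mul_nonneg hC hQ0
  linarith

/-- The sum of the second order terms over all contacts is a positive semidefinite quadratic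
form. -/
theorem stress_form_nonneg (a b : Fin 6 → ℝ) :
    (3.1 * ((a 1 - a 0) ^ 2 + (b 1 - b 0) ^ 2)
        - 1.9 * 220 * ((347 / 1000) * (a 1 - a 0) + (1 / 5) * (b 1 - b 0)) ^ 2) +
      (3.1 * ((a 2 - a 0) ^ 2 + (b 2 - b 0) ^ 2)
        - 1.9 * 220 * ((347 / 1000) * (a 2 - a 0) + (-1 / 5) * (b 2 - b 0)) ^ 2) +
      (3.1 * ((a 3 - a 4) ^ 2 + (b 3 - b 4) ^ 2)
        - 1.9 * 220 * ((347 / 1000) * (a 3 - a 4) + (1 / 5) * (b 3 - b 4)) ^ 2) +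
      (3.1 * ((a 3 - a 5) ^ 2 + (b 3 - b 5) ^ 2)
        - 1.9 * 220 * ((347 / 1000) * (a 3 - a 5) + (-1 / 5) * (b 3 - b 5)) ^ 2) +
      (2.9 * ((a 1 - a 2) ^ 2 + (b 1 - b 2) ^ 2)
        - 1.9 * 200 * ((0) * (a 1 - a 2) + (2 / 5) * (b 1 - b 2)) ^ 2) +
      (2.9 * ((a 5 - a 4) ^ 2 + (b 5 - b 4) ^ 2)
        - 1.9 * 200 * ((0) * (a 5 - a 4) + (2 / 5) * (b 5 - b 4)) ^ 2) +
      (4.1 * ((a 4 - a 0) ^ 2 + (b 4 - b 0) ^ 2)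
        - 1.9 * 300 * ((-53 / 200) * (a 4 - a 0) + (3 / 10) * (b 4 - b 0)) ^ 2) +
      (4.1 * ((a 5 - a 0) ^ 2 + (b 5 - b 0) ^ 2)
        - 1.9 * 300 * ((-53 / 200) * (a 5 - a 0) + (-3 / 10) * (b 5 - b 0)) ^ 2) +
      (4.1 * ((a 3 - a 1) ^ 2 + (b 3 - b 1) ^ 2)
        - 1.9 * 300 * ((-53 / 200) * (a 3 - a 1) + (3 / 10) * (b 3 - b 1)) ^ 2) +
      (4.1 * ((a 3 - a 2) ^ 2 + (b 3 - b 2) ^ 2)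
        - 1.9 * 300 * ((-53 / 200) * (a 3 - a 2) + (-3 / 10) * (b 3 - b 2)) ^ 2) +
      (5.6 * ((a 4 - a 1) ^ 2 + (b 4 - b 1) ^ 2)
        - 1.9 * 400 * ((97 / 250) * (a 4 - a 1) + (1 / 10) * (b 4 - b 1)) ^ 2) +
      (5.6 * ((a 5 - a 2) ^ 2 + (b 5 - b 2) ^ 2)
        - 1.9 * 400 * ((97 / 250) * (a 5 - a 2) + (-1 / 10) * (b 5 - b 2)) ^ 2) ≤ 0 := by
  have h : 0 ≤ (20789803 / 250000) * ((a 0 - a 3) + (-1412839 / 20789803) * (a 1 + a 2 - a 4 - a 5)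
      + (-9290525 / 20789803) * (b 1 - b 2 - b 4 + b 5)) ^ 2 +
    (311067288659057 / 4157960600000) * ((a 1 + a 2 - a 4 - a 5) + (1781812618850 / 16371962561003)
        * (b 1 - b 2 - b 4 + b 5)) ^ 2 +
    (9057595814620953 / 327439251220060) * ((b 1 - b 2 - b 4 + b 5)) ^ 2 +
    (3041 / 50) * ((b 0 - b 3) + (1679 / 6082) * (b 1 + b 2 - b 4 - b 5) + (-371621 / 608200)
        * (a 1 - a 2 - a 4 + a 5)) ^ 2 +
    (175921 / 15205) * ((b 1 + b 2 - b 4 - b 5) + (1339739 / 740720) * (a 1 - a 2 - a 4 + a 5))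
        ^ 2 +
    (97701161827 / 7407200000) * ((a 1 - a 2 - a 4 + a 5)) ^ 2 +
    (20789803 / 250000) * ((a 0 + a 3) + (-1 / 2) * (a 1 + a 2 + a 4 + a 5) + (2038225 / 20789803)
        * (b 1 - b 2 + b 4 - b 5)) ^ 2 +
    (72108504549 / 1663184240) * ((b 1 - b 2 + b 4 - b 5)) ^ 2 +
    (3041 / 50) * ((b 0 + b 3) + (-1 / 2) * (b 1 + b 2 + b 4 + b 5) + (81529 / 608200)
        * (a 1 - a 2 + a 4 - a 5)) ^ 2 +
    (22195540801 / 1216400000) * ((a 1 - a 2 + a 4 - a 5)) ^ 2 := by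
    positivity
  linarith only [h]

theorem base_zero : base 0 = (0, 0) := rfl

theorem base_one : base 1 = (hh, d6 / 2) := rfl

theorem base_two : base 2 = (hh, -d6 / 2) := rfl

theorem base_three : base 3 = (hh - cc, 1 / 2) := rfl

theorem base_four : base 4 = (-cc, ee) := rfl

theorem base_five : base 5 = (-cc, -ee) := rfl

theorem ff_bounds : 0.38781 < ff ∧ ff < 0.38783 := by
  have := hh_bounds
  have := cc_bounds
  unfold ff; constructor <;> linarith

theorem ee_bounds : 0.2997 < ee ∧ ee < 0.2998 := by
  unfold ee; constructor <;> linarith [d6_gt, d6_lt]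

theorem gg_bounds : 0.0995 < gg ∧ gg < 0.0996 := by
  unfold gg; constructor <;> linarith [d6_gt, d6_lt]

/-- A second order estimate along the edge from `i` to `j` for a deviation with coordinates `a`
and `b`. -/
def ContactEstimate (a b : Fin 6 → ℝ) (i j : Fin 6) (vx vy ax ay w C q : ℝ) : Prop :=
  0.05 * ((a j - a i) ^ 2 + (b j - b i) ^ 2) ≤
    2 * (w * (vx * (a j - a i) + vy * (b j - b i)))
    + (q * ((a j - a i) ^ 2 + (b j - b i) ^ 2)
      - 1.9 * C * (ax * (a j - a i) + ay * (b j - b i)) ^ 2)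

/-- The second order estimate for a contact of the optimal configuration. -/
theorem contact_estimate {a b : Fin 6 → ℝ}
    (H : Feasible fun v => ((base v).1 + a v, (base v).2 + b v))
    (ha : ∀ v, |a v| ≤ 11 / 1000) (hb : ∀ v, |b v| ≤ 11 / 1000) {i j : Fin 6} (hij : j ≠ i)
    (m n : ℤ) {vx vy ax ay w C q : ℝ} (hv : vx ^ 2 + vy ^ 2 = d6 ^ 2)
    (hx : vx = (base j).1 - (base i).1 + m) (hy : vy = (base j).2 - (base i).2 + n)
    (hax : |vx - ax| ≤ 0.0005) (hay : |vy - ay| ≤ 0.0005) (hC : 0 ≤ C)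
    (hw : C * (0.022 * (|ax| + |ay| + 0.001)) ≤ w) (hq : w + 0.0006 * C + 0.05 ≤ q) :
    ContactEstimate a b i j vx vy ax ay w C q := by
  unfold ContactEstimate
  have h := H j i hij m n
  have e : ∀ c : Fin 6 → ℝ, (∀ v, |c v| ≤ 11 / 1000) → |c j - c i| ≤ 0.022 := fun c hc =>
    (abs_sub _ _).trans (by linarith [hc i, hc j])
  have := edge_estimate (X := a j - a i) (Y := b j - b i) hv
    (by convert h using 1; simp only [hx, hy]; ring) (e a ha) (e b hb) hax hay hC hw hq
  linarith

/-- An equilibrium stress of the contact graph of the optimal configuration. -/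
theorem exists_stress : ∃ ω₁ ω₂ ω₃ ω₄ : ℝ, ω₁ * hh = 1 ∧ ω₃ * cc = 1 ∧ ω₄ * ff = 2 ∧
    ω₂ * d6 = -(d6 / 2) * ω₁ + ee * ω₃ + gg * ω₄ ∧ (2.88 < ω₁ ∧ ω₁ < 2.89) ∧
    (2.6 < ω₂ ∧ ω₂ < 2.7) ∧ (3.76 < ω₃ ∧ ω₃ < 3.77) ∧ 5.15 < ω₄ ∧ ω₄ < 5.16 := by
  obtain ⟨hh1, hh2⟩ := hh_bounds
  obtain ⟨cc1, cc2⟩ := cc_bounds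
  obtain ⟨ff1, ff2⟩ := ff_bounds
  obtain ⟨ee1, ee2⟩ := ee_bounds
  obtain ⟨gg1, gg2⟩ := gg_bounds
  have d1 := d6_gt
  have d2 := d6_lt
  obtain ⟨ω₁, hω₁⟩ : ∃ ω, ω * hh = 1 := ⟨hh⁻¹, inv_mul_cancel₀ (by linarith)⟩
  obtain ⟨ω₃, hω₃⟩ : ∃ ω, ω * cc = 1 := ⟨cc⁻¹, inv_mul_cancel₀ (by linarith)⟩
  obtain ⟨ω₄, hω₄⟩ : ∃ ω, ω * ff = 2 := ⟨2 * ff⁻¹, by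
    rw [mul_assoc, inv_mul_cancel₀ (by linarith), mul_one]⟩
  obtain ⟨ω₂, hω₂⟩ : ∃ ω, ω * d6 = -(d6 / 2) * ω₁ + ee * ω₃ + gg * ω₄ :=
    ⟨(-(d6 / 2) * ω₁ + ee * ω₃ + gg * ω₄) * d6⁻¹, by
      rw [mul_assoc, inv_mul_cancel₀ (by linarith), mul_one]⟩
  have w1 : 2.88 < ω₁ ∧ ω₁ < 2.89 := by constructor <;> nlinarith
  have w3 : 3.76 < ω₃ ∧ ω₃ < 3.77 := by constructor <;> nlinarith
  have w4 : 5.15 < ω₄ ∧ ω₄ < 5.16 := by constructor <;> nlinarith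
  have w2 : 2.6 < ω₂ ∧ ω₂ < 2.7 := by
    have : ω₂ * d6 < 1.073 ∧ 1.05 < ω₂ * d6 := by rw [hω₂]; constructor <;> nlinarith
    constructor <;> nlinarith
  exact ⟨ω₁, ω₂, ω₃, ω₄, hω₁, hω₃, hω₄, hω₂, w1, w2, w3, w4⟩

set_option maxHeartbeats 2000000 in
/-- The optimal configuration is locally unique up to translation. -/
theorem deviation_constant {a b : Fin 6 → ℝ}
    (H : Feasible fun v => ((base v).1 + a v, (base v).2 + b v))
    (ha : ∀ v, |a v| ≤ 11 / 1000) (hb : ∀ v, |b v| ≤ 11 / 1000) (v : Fin 6) :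
    a v = a 0 ∧ b v = b 0 := by
  obtain ⟨ω₁, ω₂, ω₃, ω₄, hω₁, hω₃, hω₄, hω₂, ⟨w1, w1'⟩, ⟨w2, w2'⟩, ⟨w3, w3'⟩, w4, w4'⟩ :=
    exists_stress
  obtain ⟨hh1, hh2⟩ := hh_bounds
  obtain ⟨cc1, cc2⟩ := cc_bounds
  obtain ⟨ff1, ff2⟩ := ff_bounds
  obtain ⟨ee1, ee2⟩ := ee_bounds
  obtain ⟨gg1, gg2⟩ := gg_bounds
  have d1 := d6_gt
  have d2 := d6_lt
  have h01 : ContactEstimate a b 0 1 (hh) (d6 / 2) (347 / 1000) (1 / 5) ω₁ 220 3.1 := by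
    refine contact_estimate H ha hb (i := 0) (j := 1) (by decide) (0) (0) ?_ ?_ ?_ ?_ ?_ ?_ ?_ ?_
    · linarith only [hh_sq]
    · simp only [base_zero, base_one]; push_cast; ring
    · simp only [base_zero, base_one]; push_cast; ring
    · rw [abs_le]; constructor <;> linarith only [hh1, hh2]
    · rw [abs_le]; constructor <;> linarith only [d1, d2]
    · norm_num
    · norm_num [abs_of_pos]; linarith only [w1]
    · linarith only [w1']
  have h02 : ContactEstimate a b 0 2 (hh) (-(d6 / 2)) (347 / 1000) (-1 / 5) ω₁ 220 3.1 := by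
    refine contact_estimate H ha hb (i := 0) (j := 2) (by decide) (0) (0) ?_ ?_ ?_ ?_ ?_ ?_ ?_ ?_
    · linarith only [hh_sq]
    · simp only [base_zero, base_two]; push_cast; ring
    · simp only [base_zero, base_two]; push_cast; ring
    · rw [abs_le]; constructor <;> linarith only [hh1, hh2]
    · rw [abs_le]; constructor <;> linarith only [d1, d2]
    · norm_num
    · norm_num [abs_of_pos]; linarith only [w1]
    · linarith only [w1']
  have h43 : ContactEstimate a b 4 3 (hh) (d6 / 2) (347 / 1000) (1 / 5) ω₁ 220 3.1 := by
    refine contact_estimate H ha hb (i := 4) (j := 3) (by decide) (0) (0) ?_ ?_ ?_ ?_ ?_ ?_ ?_ ?_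
    · linarith only [hh_sq]
    · simp only [base_four, base_three]; push_cast; ring
    · simp only [base_four, base_three, ee]; push_cast; ring
    · rw [abs_le]; constructor <;> linarith only [hh1, hh2]
    · rw [abs_le]; constructor <;> linarith only [d1, d2]
    · norm_num
    · norm_num [abs_of_pos]; linarith only [w1]
    · linarith only [w1']
  have h53 : ContactEstimate a b 5 3 (hh) (-(d6 / 2)) (347 / 1000) (-1 / 5) ω₁ 220 3.1 := by
    refine contact_estimate H ha hb (i := 5) (j := 3) (by decide) (0) (-1) ?_ ?_ ?_ ?_ ?_ ?_ ?_ ?_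
    · linarith only [hh_sq]
    · simp only [base_five, base_three]; push_cast; ring
    · simp only [base_five, base_three, ee]; push_cast; ring
    · rw [abs_le]; constructor <;> linarith only [hh1, hh2]
    · rw [abs_le]; constructor <;> linarith only [d1, d2]
    · norm_num
    · norm_num [abs_of_pos]; linarith only [w1]
    · linarith only [w1']
  have h21 : ContactEstimate a b 2 1 (0) (d6) (0) (2 / 5) ω₂ 200 2.9 := by
    refine contact_estimate H ha hb (i := 2) (j := 1) (by decide) (0) (0) ?_ ?_ ?_ ?_ ?_ ?_ ?_ ?_
    · norm_num
    · simp only [base_two, base_one]; push_cast; ring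
    · simp only [base_two, base_one]; push_cast; ring
    · rw [abs_le]; constructor <;> linarith only []
    · rw [abs_le]; constructor <;> linarith only [d1, d2]
    · norm_num
    · norm_num [abs_of_pos]; linarith only [w2]
    · linarith only [w2']
  have h45 : ContactEstimate a b 4 5 (0) (d6) (0) (2 / 5) ω₂ 200 2.9 := by
    refine contact_estimate H ha hb (i := 4) (j := 5) (by decide) (0) (1) ?_ ?_ ?_ ?_ ?_ ?_ ?_ ?_
    · norm_num
    · simp only [base_four, base_five]; push_cast; ring
    · simp only [base_four, base_five, ee]; push_cast; ring
    · rw [abs_le]; constructor <;> linarith only []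
    · rw [abs_le]; constructor <;> linarith only [d1, d2]
    · norm_num
    · norm_num [abs_of_pos]; linarith only [w2]
    · linarith only [w2']
  have h04 : ContactEstimate a b 0 4 (-cc) (ee) (-53 / 200) (3 / 10) ω₃ 300 4.1 := by
    refine contact_estimate H ha hb (i := 0) (j := 4) (by decide) (0) (0) ?_ ?_ ?_ ?_ ?_ ?_ ?_ ?_
    · linarith only [cc_sq]
    · simp only [base_zero, base_four]; push_cast; ring
    · simp only [base_zero, base_four]; push_cast; ring
    · rw [abs_le]; constructor <;> linarith only [cc1, cc2]
    · rw [abs_le]; constructor <;> linarith only [ee1, ee2]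
    · norm_num
    · norm_num [abs_of_pos]; linarith only [w3]
    · linarith only [w3']
  have h05 : ContactEstimate a b 0 5 (-cc) (-ee) (-53 / 200) (-3 / 10) ω₃ 300 4.1 := by
    refine contact_estimate H ha hb (i := 0) (j := 5) (by decide) (0) (0) ?_ ?_ ?_ ?_ ?_ ?_ ?_ ?_
    · linarith only [cc_sq]
    · simp only [base_zero, base_five]; push_cast; ring
    · simp only [base_zero, base_five]; push_cast; ring
    · rw [abs_le]; constructor <;> linarith only [cc1, cc2]
    · rw [abs_le]; constructor <;> linarith only [ee1, ee2]
    · norm_num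
    · norm_num [abs_of_pos]; linarith only [w3]
    · linarith only [w3']
  have h13 : ContactEstimate a b 1 3 (-cc) (ee) (-53 / 200) (3 / 10) ω₃ 300 4.1 := by
    refine contact_estimate H ha hb (i := 1) (j := 3) (by decide) (0) (0) ?_ ?_ ?_ ?_ ?_ ?_ ?_ ?_
    · linarith only [cc_sq]
    · simp only [base_one, base_three]; push_cast; ring
    · simp only [base_one, base_three, ee]; push_cast; ring
    · rw [abs_le]; constructor <;> linarith only [cc1, cc2]
    · rw [abs_le]; constructor <;> linarith only [ee1, ee2]
    · norm_num
    · norm_num [abs_of_pos]; linarith only [w3]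
    · linarith only [w3']
  have h23 : ContactEstimate a b 2 3 (-cc) (-ee) (-53 / 200) (-3 / 10) ω₃ 300 4.1 := by
    refine contact_estimate H ha hb (i := 2) (j := 3) (by decide) (0) (-1) ?_ ?_ ?_ ?_ ?_ ?_ ?_ ?_
    · linarith only [cc_sq]
    · simp only [base_two, base_three]; push_cast; ring
    · simp only [base_two, base_three, ee]; push_cast; ring
    · rw [abs_le]; constructor <;> linarith only [cc1, cc2]
    · rw [abs_le]; constructor <;> linarith only [ee1, ee2]
    · norm_num
    · norm_num [abs_of_pos]; linarith only [w3]
    · linarith only [w3']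
  have h14 : ContactEstimate a b 1 4 (ff) (gg) (97 / 250) (1 / 10) ω₄ 400 5.6 := by
    refine contact_estimate H ha hb (i := 1) (j := 4) (by decide) (1) (0) ?_ ?_ ?_ ?_ ?_ ?_ ?_ ?_
    · linarith only [ff_sq]
    · simp only [base_one, base_four, ff]; push_cast; ring
    · simp only [base_one, base_four, ee, gg]; push_cast; ring
    · rw [abs_le]; constructor <;> linarith only [ff1, ff2]
    · rw [abs_le]; constructor <;> linarith only [gg1, gg2]
    · norm_num
    · norm_num [abs_of_pos]; linarith only [w4]
    · linarith only [w4']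
  have h25 : ContactEstimate a b 2 5 (ff) (-gg) (97 / 250) (-1 / 10) ω₄ 400 5.6 := by
    refine contact_estimate H ha hb (i := 2) (j := 5) (by decide) (1) (0) ?_ ?_ ?_ ?_ ?_ ?_ ?_ ?_
    · linarith only [ff_sq]
    · simp only [base_two, base_five, ff]; push_cast; ring
    · simp only [base_two, base_five, ee, gg]; push_cast; ring
    · rw [abs_le]; constructor <;> linarith only [ff1, ff2]
    · rw [abs_le]; constructor <;> linarith only [gg1, gg2]
    · norm_num
    · norm_num [abs_of_pos]; linarith only [w4]
    · linarith only [w4']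
  unfold ContactEstimate at h01 h02 h43 h53 h21 h45 h04 h05 h13 h23 h14 h25
  have hS : ω₁ * (hh * (a 1 - a 0) + d6 / 2 * (b 1 - b 0)) +
      ω₁ * (hh * (a 2 - a 0) + -(d6 / 2) * (b 2 - b 0)) +
      ω₁ * (hh * (a 3 - a 4) + d6 / 2 * (b 3 - b 4)) +
      ω₁ * (hh * (a 3 - a 5) + -(d6 / 2) * (b 3 - b 5)) +
      ω₂ * (0 * (a 1 - a 2) + d6 * (b 1 - b 2)) +
      ω₂ * (0 * (a 5 - a 4) + d6 * (b 5 - b 4)) +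
      ω₃ * (-cc * (a 4 - a 0) + ee * (b 4 - b 0)) +
      ω₃ * (-cc * (a 5 - a 0) + -ee * (b 5 - b 0)) +
      ω₃ * (-cc * (a 3 - a 1) + ee * (b 3 - b 1)) +
      ω₃ * (-cc * (a 3 - a 2) + -ee * (b 3 - b 2)) +
      ω₄ * (ff * (a 4 - a 1) + gg * (b 4 - b 1)) +
      ω₄ * (ff * (a 5 - a 2) + -gg * (b 5 - b 2)) = 0 := by
    linear_combination (a 1 - a 0 + a 2 - a 0 + a 3 - a 4 + a 3 - a 5) * hω₁
      - (a 4 - a 0 + a 5 - a 0 + a 3 - a 1 + a 3 - a 2) * hω₃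
      + (a 4 - a 1 + a 5 - a 2) * hω₄ + (b 1 - b 2 - b 4 + b 5) * hω₂
  have hq := stress_form_nonneg a b
  generalize ω₁ * (hh * (a 1 - a 0) + d6 / 2 * (b 1 - b 0)) = t01 at h01 hS
  generalize 3.1 * ((a 1 - a 0) ^ 2 + (b 1 - b 0) ^ 2)
        - 1.9 * 220 * ((347 / 1000) * (a 1 - a 0) + (1 / 5) * (b 1 - b 0)) ^ 2 = g01 at h01 hq
  have s01 : 0 ≤ (a 1 - a 0) ^ 2 + (b 1 - b 0) ^ 2 := by positivity
  generalize hq01 : (a 1 - a 0) ^ 2 + (b 1 - b 0) ^ 2 = q01 at h01 s01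
  generalize ω₁ * (hh * (a 2 - a 0) + -(d6 / 2) * (b 2 - b 0)) = t02 at h02 hS
  generalize 3.1 * ((a 2 - a 0) ^ 2 + (b 2 - b 0) ^ 2)
        - 1.9 * 220 * ((347 / 1000) * (a 2 - a 0) + (-1 / 5) * (b 2 - b 0)) ^ 2 = g02 at h02 hq
  have s02 : 0 ≤ (a 2 - a 0) ^ 2 + (b 2 - b 0) ^ 2 := by positivity
  generalize hq02 : (a 2 - a 0) ^ 2 + (b 2 - b 0) ^ 2 = q02 at h02 s02
  generalize ω₁ * (hh * (a 3 - a 4) + d6 / 2 * (b 3 - b 4)) = t43 at h43 hS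
  generalize 3.1 * ((a 3 - a 4) ^ 2 + (b 3 - b 4) ^ 2)
        - 1.9 * 220 * ((347 / 1000) * (a 3 - a 4) + (1 / 5) * (b 3 - b 4)) ^ 2 = g43 at h43 hq
  have s43 : 0 ≤ (a 3 - a 4) ^ 2 + (b 3 - b 4) ^ 2 := by positivity
  generalize hq43 : (a 3 - a 4) ^ 2 + (b 3 - b 4) ^ 2 = q43 at h43 s43
  generalize ω₁ * (hh * (a 3 - a 5) + -(d6 / 2) * (b 3 - b 5)) = t53 at h53 hS
  generalize 3.1 * ((a 3 - a 5) ^ 2 + (b 3 - b 5) ^ 2)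
        - 1.9 * 220 * ((347 / 1000) * (a 3 - a 5) + (-1 / 5) * (b 3 - b 5)) ^ 2 = g53 at h53 hq
  have s53 : 0 ≤ (a 3 - a 5) ^ 2 + (b 3 - b 5) ^ 2 := by positivity
  generalize hq53 : (a 3 - a 5) ^ 2 + (b 3 - b 5) ^ 2 = q53 at h53 s53
  generalize ω₂ * (0 * (a 1 - a 2) + d6 * (b 1 - b 2)) = t21 at h21 hS
  generalize 2.9 * ((a 1 - a 2) ^ 2 + (b 1 - b 2) ^ 2)
        - 1.9 * 200 * ((0) * (a 1 - a 2) + (2 / 5) * (b 1 - b 2)) ^ 2 = g21 at h21 hq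
  have s21 : 0 ≤ (a 1 - a 2) ^ 2 + (b 1 - b 2) ^ 2 := by positivity
  generalize hq21 : (a 1 - a 2) ^ 2 + (b 1 - b 2) ^ 2 = q21 at h21 s21
  generalize ω₂ * (0 * (a 5 - a 4) + d6 * (b 5 - b 4)) = t45 at h45 hS
  generalize 2.9 * ((a 5 - a 4) ^ 2 + (b 5 - b 4) ^ 2)
        - 1.9 * 200 * ((0) * (a 5 - a 4) + (2 / 5) * (b 5 - b 4)) ^ 2 = g45 at h45 hq
  have s45 : 0 ≤ (a 5 - a 4) ^ 2 + (b 5 - b 4) ^ 2 := by positivity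
  generalize hq45 : (a 5 - a 4) ^ 2 + (b 5 - b 4) ^ 2 = q45 at h45 s45
  generalize ω₃ * (-cc * (a 4 - a 0) + ee * (b 4 - b 0)) = t04 at h04 hS
  generalize 4.1 * ((a 4 - a 0) ^ 2 + (b 4 - b 0) ^ 2)
        - 1.9 * 300 * ((-53 / 200) * (a 4 - a 0) + (3 / 10) * (b 4 - b 0)) ^ 2 = g04 at h04 hq
  have s04 : 0 ≤ (a 4 - a 0) ^ 2 + (b 4 - b 0) ^ 2 := by positivity
  generalize hq04 : (a 4 - a 0) ^ 2 + (b 4 - b 0) ^ 2 = q04 at h04 s04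
  generalize ω₃ * (-cc * (a 5 - a 0) + -ee * (b 5 - b 0)) = t05 at h05 hS
  generalize 4.1 * ((a 5 - a 0) ^ 2 + (b 5 - b 0) ^ 2)
        - 1.9 * 300 * ((-53 / 200) * (a 5 - a 0) + (-3 / 10) * (b 5 - b 0)) ^ 2 = g05 at h05 hq
  have s05 : 0 ≤ (a 5 - a 0) ^ 2 + (b 5 - b 0) ^ 2 := by positivity
  generalize hq05 : (a 5 - a 0) ^ 2 + (b 5 - b 0) ^ 2 = q05 at h05 s05
  generalize ω₃ * (-cc * (a 3 - a 1) + ee * (b 3 - b 1)) = t13 at h13 hS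
  generalize 4.1 * ((a 3 - a 1) ^ 2 + (b 3 - b 1) ^ 2)
        - 1.9 * 300 * ((-53 / 200) * (a 3 - a 1) + (3 / 10) * (b 3 - b 1)) ^ 2 = g13 at h13 hq
  have s13 : 0 ≤ (a 3 - a 1) ^ 2 + (b 3 - b 1) ^ 2 := by positivity
  generalize hq13 : (a 3 - a 1) ^ 2 + (b 3 - b 1) ^ 2 = q13 at h13 s13
  generalize ω₃ * (-cc * (a 3 - a 2) + -ee * (b 3 - b 2)) = t23 at h23 hS
  generalize 4.1 * ((a 3 - a 2) ^ 2 + (b 3 - b 2) ^ 2)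
        - 1.9 * 300 * ((-53 / 200) * (a 3 - a 2) + (-3 / 10) * (b 3 - b 2)) ^ 2 = g23 at h23 hq
  have s23 : 0 ≤ (a 3 - a 2) ^ 2 + (b 3 - b 2) ^ 2 := by positivity
  generalize hq23 : (a 3 - a 2) ^ 2 + (b 3 - b 2) ^ 2 = q23 at h23 s23
  generalize ω₄ * (ff * (a 4 - a 1) + gg * (b 4 - b 1)) = t14 at h14 hS
  generalize 5.6 * ((a 4 - a 1) ^ 2 + (b 4 - b 1) ^ 2)
        - 1.9 * 400 * ((97 / 250) * (a 4 - a 1) + (1 / 10) * (b 4 - b 1)) ^ 2 = g14 at h14 hq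
  have s14 : 0 ≤ (a 4 - a 1) ^ 2 + (b 4 - b 1) ^ 2 := by positivity
  generalize hq14 : (a 4 - a 1) ^ 2 + (b 4 - b 1) ^ 2 = q14 at h14 s14
  generalize ω₄ * (ff * (a 5 - a 2) + -gg * (b 5 - b 2)) = t25 at h25 hS
  generalize 5.6 * ((a 5 - a 2) ^ 2 + (b 5 - b 2) ^ 2)
        - 1.9 * 400 * ((97 / 250) * (a 5 - a 2) + (-1 / 10) * (b 5 - b 2)) ^ 2 = g25 at h25 hq
  have s25 : 0 ≤ (a 5 - a 2) ^ 2 + (b 5 - b 2) ^ 2 := by positivity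
  generalize hq25 : (a 5 - a 2) ^ 2 + (b 5 - b 2) ^ 2 = q25 at h25 s25
  have hz : ∀ x y : ℝ, x ^ 2 + y ^ 2 ≤ 0 → x = 0 ∧ y = 0 := fun x y h =>
    ⟨by clear * - h; nlinarith, by clear * - h; nlinarith⟩
  obtain ⟨x01, y01⟩ := hz _ _ (hq01.trans_le (by
    linarith only [hS, hq, h01, s01, h02, s02, h43, s43, h53, s53, h21, s21, h45, s45, h04, s04,
        h05, s05, h13, s13, h23, s23, h14, s14, h25, s25]))
  obtain ⟨x02, y02⟩ := hz _ _ (hq02.trans_le (by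
    linarith only [hS, hq, h01, s01, h02, s02, h43, s43, h53, s53, h21, s21, h45, s45, h04, s04,
        h05, s05, h13, s13, h23, s23, h14, s14, h25, s25]))
  obtain ⟨x13, y13⟩ := hz _ _ (hq13.trans_le (by
    linarith only [hS, hq, h01, s01, h02, s02, h43, s43, h53, s53, h21, s21, h45, s45, h04, s04,
        h05, s05, h13, s13, h23, s23, h14, s14, h25, s25]))
  obtain ⟨x04, y04⟩ := hz _ _ (hq04.trans_le (by
    linarith only [hS, hq, h01, s01, h02, s02, h43, s43, h53, s53, h21, s21, h45, s45, h04, s04,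
        h05, s05, h13, s13, h23, s23, h14, s14, h25, s25]))
  obtain ⟨x05, y05⟩ := hz _ _ (hq05.trans_le (by
    linarith only [hS, hq, h01, s01, h02, s02, h43, s43, h53, s53, h21, s21, h45, s45, h04, s04,
        h05, s05, h13, s13, h23, s23, h14, s14, h25, s25]))
  clear * - x01 x02 x13 x04 x05 y01 y02 y13 y04 y05
  fin_cases v <;> constructor <;> simp only [Fin.zero_eta, Fin.mk_one, Fin.reduceFinMk] <;>
    linarith

/-! ### Isometries of the torus -/

/-- Two configurations on the torus agree up to an isometry and a relabelling. -/
def Iso (p q : Fin 6 → ℝ × ℝ) : Prop :=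
  ∃ Q : Matrix (Fin 2) (Fin 2) ℝ,
    Q * Q.transpose = 1 ∧ (∀ a b : Fin 2, ∃ z : ℤ, Q a b = (z : ℝ)) ∧
    ∃ t : ℝ × ℝ, ∃ σ : Equiv.Perm (Fin 6),
      ∀ i : Fin 6, ∃ a b : ℤ, p i - (mulVec2 Q (q (σ i)) + t) = ((a : ℝ), (b : ℝ))

theorem orthogonal_entries {Q : Matrix (Fin 2) (Fin 2) ℝ} (h : Q * Q.transpose = 1) :
    Q 0 0 ^ 2 + Q 1 0 ^ 2 = 1 ∧ Q 0 0 * Q 0 1 + Q 1 0 * Q 1 1 = 0 ∧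
      Q 0 1 ^ 2 + Q 1 1 ^ 2 = 1 := by
  have h' := mul_eq_one_comm.1 h
  have h0 := congrFun (congrFun h' 0) 0
  have h1 := congrFun (congrFun h' 0) 1
  have h2 := congrFun (congrFun h' 1) 1
  simp [Matrix.mul_apply] at h0 h1 h2
  exact ⟨by linarith, h1, by linarith⟩

theorem Iso.symm {p q : Fin 6 → ℝ × ℝ} (h : Iso p q) : Iso q p := by
  obtain ⟨Q, hQ, hz, t, σ, h⟩ := h
  obtain ⟨h0, h1, h2⟩ := orthogonal_entries hQ
  refine ⟨Q.transpose, by rw [Matrix.transpose_transpose, mul_eq_one_comm, hQ],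
    fun a b => hz b a, -mulVec2 Q.transpose t, σ.symm, fun j => ?_⟩
  obtain ⟨a, b, hab⟩ := h (σ.symm j)
  choose z hz using hz
  rw [Equiv.apply_symm_apply] at hab
  refine ⟨-(z 0 0 * a + z 1 0 * b), -(z 0 1 * a + z 1 1 * b), ?_⟩
  simp only [Prod.ext_iff, Prod.fst_sub, Prod.snd_sub, Prod.fst_add, Prod.snd_add, Prod.fst_neg,
    Prod.snd_neg, mulVec2, Matrix.transpose_apply] at hab ⊢
  push_cast
  rw [← hz, ← hz, ← hz, ← hz]
  obtain ⟨e1, e2⟩ := hab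
  constructor
  · linear_combination -(q j).1 * h0 - (q j).2 * h1 - Q 0 0 * e1 - Q 1 0 * e2
  · linear_combination -(q j).1 * h1 - (q j).2 * h2 - Q 0 1 * e1 - Q 1 1 * e2

theorem Iso.trans {p q r : Fin 6 → ℝ × ℝ} (h : Iso p q) (h' : Iso q r) : Iso p r := by
  obtain ⟨Q, hQ, hz, t, σ, h⟩ := h
  obtain ⟨R, hR, hw, s, τ, h'⟩ := h'
  choose z hz using hz
  choose w hw using hw
  refine ⟨Q * R, ?_, fun a b => ⟨z a 0 * w 0 b + z a 1 * w 1 b, ?_⟩, mulVec2 Q s + t, σ.trans τ,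
    fun i => ?_⟩
  · rw [Matrix.transpose_mul, Matrix.mul_assoc, ← Matrix.mul_assoc R, hR, Matrix.one_mul, hQ]
  · simp [Matrix.mul_apply, hz, hw]
  · obtain ⟨a, b, hab⟩ := h i
    obtain ⟨c, d, hcd⟩ := h' (σ i)
    refine ⟨a + (z 0 0 * c + z 0 1 * d), b + (z 1 0 * c + z 1 1 * d), ?_⟩
    simp only [Prod.ext_iff, Prod.fst_sub, Prod.snd_sub, Prod.fst_add, Prod.snd_add, mulVec2,
      Matrix.mul_apply, Fin.sum_univ_two, Equiv.trans_apply] at hab hcd ⊢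
    push_cast
    rw [← hz, ← hz, ← hz, ← hz]
    obtain ⟨e1, e2⟩ := hab
    obtain ⟨f1, f2⟩ := hcd
    constructor
    · linear_combination e1 + Q 0 0 * f1 + Q 0 1 * f2
    · linear_combination e2 + Q 1 0 * f1 + Q 1 1 * f2

theorem Feasible.of_iso {p q : Fin 6 → ℝ × ℝ} (hq : Feasible q) (h : Iso p q) : Feasible p := by
  obtain ⟨Q, hQ, hz, t, σ, h⟩ := h
  obtain ⟨h0, h1, h2⟩ := orthogonal_entries hQ
  obtain ⟨h0', h1', h2'⟩ := orthogonal_entries (Q := Q.transpose)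
    (by rw [Matrix.transpose_transpose, mul_eq_one_comm, hQ])
  simp only [Matrix.transpose_apply] at h0' h1' h2'
  choose z hz using hz
  intro i j hij m n
  obtain ⟨a, b, hab⟩ := h i
  obtain ⟨c, d, hcd⟩ := h j
  have := hq (σ i) (σ j) (σ.injective.ne hij) (z 0 0 * (m + a - c) + z 1 0 * (n + b - d))
    (z 0 1 * (m + a - c) + z 1 1 * (n + b - d))
  simp only [Prod.ext_iff, Prod.fst_sub, Prod.snd_sub, Prod.fst_add, Prod.snd_add, mulVec2]
    at hab hcd
  push_cast at this
  rw [← hz, ← hz, ← hz, ← hz] at this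
  refine this.trans (le_of_eq ?_)
  have e1 : (p i).1 = Q 0 0 * (q (σ i)).1 + Q 0 1 * (q (σ i)).2 + t.1 + a := by
    linear_combination hab.1
  have e2 : (p i).2 = Q 1 0 * (q (σ i)).1 + Q 1 1 * (q (σ i)).2 + t.2 + b := by
    linear_combination hab.2
  have f1 : (p j).1 = Q 0 0 * (q (σ j)).1 + Q 0 1 * (q (σ j)).2 + t.1 + c := by
    linear_combination hcd.1
  have f2 : (p j).2 = Q 1 0 * (q (σ j)).1 + Q 1 1 * (q (σ j)).2 + t.2 + d := by
    linear_combination hcd.2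
  rw [e1, e2, f1, f2]
  generalize (q (σ i)).1 = x, (q (σ i)).2 = y, (q (σ j)).1 = x', (q (σ j)).2 = y'
  have k1 : (x - x' + (Q 0 0 * (m + a - c) + Q 1 0 * (n + b - d))) =
      Q 0 0 * (Q 0 0 * (x - x') + Q 0 1 * (y - y') + (m + a - c)) +
      Q 1 0 * (Q 1 0 * (x - x') + Q 1 1 * (y - y') + (n + b - d)) := by
    linear_combination -(x - x') * h0 - (y - y') * h1
  have k2 : (y - y' + (Q 0 1 * (m + a - c) + Q 1 1 * (n + b - d))) =
      Q 0 1 * (Q 0 0 * (x - x') + Q 0 1 * (y - y') + (m + a - c)) +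
      Q 1 1 * (Q 1 0 * (x - x') + Q 1 1 * (y - y') + (n + b - d)) := by
    linear_combination -(x - x') * h1 - (y - y') * h2
  rw [k1, k2]
  have l1 : Q 0 0 * x + Q 0 1 * y + t.1 + a - (Q 0 0 * x' + Q 0 1 * y' + t.1 + c) + m =
    Q 0 0 * (x - x') + Q 0 1 * (y - y') + (m + a - c) := by ring
  have l2 : Q 1 0 * x + Q 1 1 * y + t.2 + b - (Q 1 0 * x' + Q 1 1 * y' + t.2 + d) + n =
    Q 1 0 * (x - x') + Q 1 1 * (y - y') + (n + b - d) := by ring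
  rw [l1, l2]
  generalize Q 0 0 * (x - x') + Q 0 1 * (y - y') + (m + a - c) = X
  generalize Q 1 0 * (x - x') + Q 1 1 * (y - y') + (n + b - d) = Y
  linear_combination X ^ 2 * h0' + 2 * X * Y * h1' + Y ^ 2 * h2'

theorem iso_of_eq_add {p q : Fin 6 → ℝ × ℝ} (t : ℝ × ℝ) (h : ∀ i, p i = q i + t) : Iso p q := by
  refine ⟨1, by simp, fun a b => ⟨(1 : Matrix (Fin 2) (Fin 2) ℤ) a b, ?_⟩, t, 1, fun i =>
    ⟨0, 0, ?_⟩⟩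
  · by_cases hab : a = b <;> simp [Matrix.one_apply, hab]
  · rw [h i]; ext <;> simp [mulVec2]

/-- A configuration with an image close to the optimal one is isometric to it. -/
theorem Feasible.iso_base {c : Fin 6 → ℝ × ℝ} (hc : Feasible c) (Q : Matrix (Fin 2) (Fin 2) ℝ)
    (hQ : Q * Q.transpose = 1) (hz : ∀ a b : Fin 2, ∃ z : ℤ, Q a b = (z : ℝ)) (t : ℝ × ℝ)
    (σ : Equiv.Perm (Fin 6)) (m n : Fin 6 → ℤ)
    (h : ∀ v, |(mulVec2 Q (c (σ v))).1 + t.1 + m v - (base v).1| ≤ 11 / 1000 ∧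
      |(mulVec2 Q (c (σ v))).2 + t.2 + n v - (base v).2| ≤ 11 / 1000) : Iso c base := by
  set r : Fin 6 → ℝ × ℝ := fun v =>
    ((mulVec2 Q (c (σ v))).1 + t.1 + m v, (mulVec2 Q (c (σ v))).2 + t.2 + n v) with hr
  have hrc : Iso r c := ⟨Q, hQ, hz, t, σ, fun i => ⟨m i, n i, by ext <;> simp [hr]⟩⟩
  refine hrc.symm.trans (iso_of_eq_add (r 0 - base 0) fun v => ?_)
  have hF : Feasible fun v =>
      ((base v).1 + ((r v).1 - (base v).1), (base v).2 + ((r v).2 - (base v).2)) := by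
    simpa using hc.of_iso hrc
  obtain ⟨e1, e2⟩ := deviation_constant (a := fun v => (r v).1 - (base v).1)
    (b := fun v => (r v).2 - (base v).2) hF (fun v => (h v).1) (fun v => (h v).2) v
  ext
  · simp only [Prod.fst_add, Prod.fst_sub]; linarith
  · simp only [Prod.snd_add, Prod.snd_sub]; linarith

/-- Configurations in one of the five clusters are isometric to the optimal configuration. -/
theorem InCluster.iso_base {u z : Fin 6 → ℝ} (hu : u 0 = 64) (hz : z 0 = 0)
    (hc : Feasible fun i => (z i / 16384, u i / 512)) (h : InCluster u z) :
    Iso (fun i => (z i / 16384, u i / 512)) base := by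
  obtain ⟨hh1, hh2⟩ := hh_bounds
  obtain ⟨cc1, cc2⟩ := cc_bounds
  obtain ⟨ee1, ee2⟩ := ee_bounds
  have d1 := d6_gt
  have d2 := d6_lt
  have swap : !![(0 : ℝ), 1; 1, 0] * (!![(0 : ℝ), 1; 1, 0]).transpose = 1 := by
    ext i j; fin_cases i <;> fin_cases j <;> simp [Matrix.mul_apply]
  have swap_int : ∀ a b : Fin 2, ∃ z : ℤ, !![(0 : ℝ), 1; 1, 0] a b = (z : ℝ) := fun a b =>
    ⟨!![0, 1; 1, 0] a b, by fin_cases a <;> fin_cases b <;> simp⟩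
  have one_int : ∀ a b : Fin 2, ∃ z : ℤ, (1 : Matrix (Fin 2) (Fin 2) ℝ) a b = (z : ℝ) := fun a b =>
    ⟨(1 : Matrix (Fin 2) (Fin 2) ℤ) a b, by fin_cases a <;> fin_cases b <;> simp⟩
  simp only [InCluster, Rect] at h
  push_cast at h
  rcases h with ⟨⟨⟨y1, y1'⟩, x1, x1'⟩, ⟨⟨y2, y2'⟩, x2, x2'⟩, ⟨⟨y3, y3'⟩, x3, x3'⟩,
    ⟨⟨y4, y4'⟩, x4, x4'⟩, ⟨y5, y5'⟩, x5, x5'⟩ |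
    ⟨⟨⟨y1, y1'⟩, x1, x1'⟩, ⟨⟨y2, y2'⟩, x2, x2'⟩, ⟨⟨y3, y3'⟩, x3, x3'⟩,
    ⟨⟨y4, y4'⟩, x4, x4'⟩, ⟨y5, y5'⟩, x5, x5'⟩ |
    ⟨⟨⟨y1, y1'⟩, x1, x1'⟩, ⟨⟨y2, y2'⟩, x2, x2'⟩, ⟨⟨y3, y3'⟩, x3, x3'⟩,
    ⟨⟨y4, y4'⟩, x4, x4'⟩, ⟨y5, y5'⟩, x5, x5'⟩ |
    ⟨⟨⟨y1, y1'⟩, x1, x1'⟩, ⟨⟨y2, y2'⟩, x2, x2'⟩, ⟨⟨y3, y3'⟩, x3, x3'⟩,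
    ⟨⟨y4, y4'⟩, x4, x4'⟩, ⟨y5, y5'⟩, x5, x5'⟩ |
    ⟨⟨⟨y1, y1'⟩, x1, x1'⟩, ⟨⟨y2, y2'⟩, x2, x2'⟩, ⟨⟨y3, y3'⟩, x3, x3'⟩,
    ⟨⟨y4, y4'⟩, x4, x4'⟩, ⟨y5, y5'⟩, x5, x5'⟩
  · refine hc.iso_base !![(0 : ℝ), 1; 1, 0] swap swap_int ((-(1 / 8), 0) + base 4)
      ⟨![4, 5, 3, 1, 0, 2], ![4, 3, 5, 2, 0, 1], by decide, by decide⟩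
      ![0, 0, 0, 0, 0, 0] ![-1, -1, -1, 0, 0, -1] (fun v => ?_)
    fin_cases v <;> simp [mulVec2, base_zero, base_one, base_two, base_three, base_four, base_five,
        hu, hz] <;>
      simp only [abs_le] <;> and_intros <;> linarith
  · refine hc.iso_base !![(0 : ℝ), 1; 1, 0] swap swap_int ((-(1 / 8), 0) + base 0)
      ⟨![0, 1, 5, 3, 2, 4], ![0, 1, 4, 3, 5, 2], by decide, by decide⟩
      ![0, 0, 0, 0, -1, -1] ![0, 0, -1, 0, 0, -1] (fun v => ?_)
    fin_cases v <;> simp [mulVec2, base_zero, base_one, base_two, base_three, base_four, base_five,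
        hu, hz] <;>
      simp only [abs_le] <;> and_intros <;> linarith
  · refine hc.iso_base 1 (by simp) one_int ((0, -(1 / 8)) + base 3)
      ⟨![5, 2, 1, 0, 4, 3], ![3, 2, 1, 5, 4, 0], by decide, by decide⟩
      ![-1, 0, 0, 0, -1, -1] ![-1, -1, -1, 0, -1, -1] (fun v => ?_)
    fin_cases v <;> simp [mulVec2, base_zero, base_one, base_two, base_three, base_four, base_five,
        hu, hz] <;>
      simp only [abs_le] <;> and_intros <;> linarith
  · refine hc.iso_base 1 (by simp) one_int ((0, -(1 / 8)) + base 1)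
      ⟨![3, 0, 5, 4, 1, 2], ![1, 4, 5, 0, 3, 2], by decide, by decide⟩
      ![-1, 0, -1, -1, -1, -1] ![-1, 0, -1, 0, 0, -1] (fun v => ?_)
    fin_cases v <;> simp [mulVec2, base_zero, base_one, base_two, base_three, base_four, base_five,
        hu, hz] <;>
      simp only [abs_le] <;> and_intros <;> linarith
  · refine hc.iso_base 1 (by simp) one_int ((0, -(1 / 8)) + base 5)
      ⟨![1, 3, 4, 2, 5, 0], ![5, 0, 3, 1, 2, 4], by decide, by decide⟩
      ![0, 0, 0, 0, -1, 0] ![0, 0, 0, 0, 0, 0] (fun v => ?_)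
    fin_cases v <;> simp [mulVec2, base_zero, base_one, base_two, base_three, base_four, base_five,
        hu, hz] <;>
      simp only [abs_le] <;> and_intros <;> linarith

/-- Every configuration is isometric to one whose first coordinates are sorted in `[0, 1)`. -/
theorem exists_iso_sorted (p : Fin 6 → ℝ × ℝ) :
    ∃ q, Iso q p ∧ Monotone (fun i => (q i).1) ∧ ∀ i, 0 ≤ (q i).1 ∧ (q i).1 < 1 := by
  set f : Fin 6 → ℝ := fun i => Int.fract (p i).1 with hf
  refine ⟨fun i => (f (Tuple.sort f i), (p (Tuple.sort f i)).2), ?_, Tuple.monotone_sort f,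
    fun i => ⟨Int.fract_nonneg _, Int.fract_lt_one _⟩⟩
  refine ⟨1, by simp, fun a b => ⟨(1 : Matrix (Fin 2) (Fin 2) ℤ) a b, ?_⟩, 0, Tuple.sort f,
    fun i => ⟨-⌊(p (Tuple.sort f i)).1⌋, 0, ?_⟩⟩
  · by_cases hab : a = b <;> simp [Matrix.one_apply, hab]
  · ext
    · simp [mulVec2, hf]
    · simp [mulVec2]

/-- Cyclic relabelling and reflection bring a sorted configuration into a normalized position. -/
theorem exists_normalized {q : Fin 6 → ℝ × ℝ} (hm : Monotone fun i => (q i).1)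
    (h01 : ∀ i, 0 ≤ (q i).1 ∧ (q i).1 < 1) :
    ∃ x y : Fin 6 → ℝ, Iso (fun i => (x i, y i)) q ∧ x 0 = 0 ∧ y 0 = 1 / 8 ∧
      (∀ i j, i < j → x i ≤ x j ∧ x j ≤ x i + 1) ∧ (∀ i, 0 ≤ y i ∧ y i ≤ 1) ∧
      (1 / 8 ≤ y 1 ∧ y 1 ≤ 5 / 8) ∧
      ∀ i, ∀ n : ℤ, y 1 - 1 / 8 ≤ |y (i + 1) - y i + n| := by
  set w : Fin 6 → ℝ := fun i => (q (i + 1)).2 - (q i).2 with hw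
  obtain ⟨k, -, hk⟩ := Finset.exists_min_image Finset.univ (fun i => |w i - round (w i)|)
    ⟨0, Finset.mem_univ 0⟩
  obtain ⟨ε, hε, hδ⟩ : ∃ ε : ℤ, (ε = 1 ∨ ε = -1) ∧
      (ε : ℝ) * (w k - round (w k)) = |w k - round (w k)| := by
    rcases abs_cases (w k - round (w k)) with h | h
    · exact ⟨1, .inl rfl, by rw [h.1]; simp⟩
    · exact ⟨-1, .inr rfl, by rw [h.1]; simp⟩
  have hε2 : (ε : ℝ) * ε = 1 := by rcases hε with h | h <;> simp [h]
  have hδ2 := abs_sub_round (w k)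
  set x : Fin 6 → ℝ := fun i =>
    (q (i + k)).1 - (q k).1 + if 6 ≤ i.val + k.val then (1 : ℤ) else (0 : ℤ) with hx
  set y : Fin 6 → ℝ := fun i => Int.fract (ε * ((q (i + k)).2 - (q k).2) + 1 / 8) with hy
  have hy1 : y 1 = |w k - round (w k)| + 1 / 8 := by
    rw [hy]
    simp only
    rw [Int.fract_eq_iff]
    refine ⟨by positivity, by linarith, ε * round (w k), ?_⟩
    rw [← hδ, hw, add_comm 1 k]
    push_cast
    ring
  refine ⟨x, y, ?_, ?_, ?_, ?_, fun i => ⟨Int.fract_nonneg _, (Int.fract_lt_one _).le⟩, ?_, ?_⟩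
  · refine ⟨!![1, 0; 0, (ε : ℝ)], ?_, fun a b => ⟨!![1, 0; 0, ε] a b, ?_⟩,
      (-(q k).1, -ε * (q k).2 + 1 / 8), Equiv.addRight k, fun i =>
      ⟨if 6 ≤ i.val + k.val then 1 else 0, -⌊ε * ((q (i + k)).2 - (q k).2) + 1 / 8⌋, ?_⟩⟩
    · ext i j; fin_cases i <;> fin_cases j <;> simp [Matrix.mul_apply, hε2]
    · fin_cases a <;> fin_cases b <;> simp
    · ext
      · simp [mulVec2, hx]
        ring
      · have := Int.self_sub_fract (ε * ((q (i + k)).2 - (q k).2) + 1 / 8)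
        simp only [mulVec2, hy]
        push_cast
        simp [-Int.self_sub_fract]
        simp [-Int.self_sub_fract] at this
        linarith
  · simp [hx]
  · simp only [hy, zero_add, sub_self, mul_zero]
    rw [Int.fract_eq_self]; norm_num
  · intro i j hij
    have := i.isLt
    have := j.isLt
    have := k.isLt
    have hij' : i.val < j.val := hij
    have ei : (i + k).val = (i.val + k.val) % 6 := Fin.val_add i k
    have ej : (j + k).val = (j.val + k.val) % 6 := Fin.val_add j k
    have b1 := h01 (i + k)
    have b2 := h01 (j + k)
    have le : (i + k).val ≤ (j + k).val → (q (i + k)).1 ≤ (q (j + k)).1 := fun h => hm h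
    have ge : (j + k).val ≤ (i + k).val → (q (j + k)).1 ≤ (q (i + k)).1 := fun h => hm h
    simp only [hx]
    split_ifs with h1 h2 h2
    · have := le (by omega)
      constructor <;> push_cast <;> linarith
    · omega
    · have := ge (by omega)
      constructor <;> push_cast <;> linarith
    · have := le (by omega)
      constructor <;> push_cast <;> linarith
  · rw [hy1]
    exact ⟨by linarith [abs_nonneg (w k - round (w k))], by linarith⟩
  · intro i n
    rw [hy1, add_sub_cancel_right]
    refine (hk (i + k) (Finset.mem_univ _)).trans ?_
    set N : ℤ := ε * (⌊ε * ((q (i + 1 + k)).2 - (q k).2) + 1 / 8⌋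
      - ⌊ε * ((q (i + k)).2 - (q k).2) + 1 / 8⌋ - n) with hN
    refine (round_le (w (i + k)) N).trans (le_of_eq ?_)
    have e : w (i + k) - N = ε * (y (i + 1) - y i + n) := by
      simp only [hw, hy, hN, Int.fract, add_right_comm i 1 k]
      push_cast
      linear_combination -((q (i + k + 1)).2 - (q (i + k)).2) * hε2
    rw [e, abs_mul]
    have : |(ε : ℝ)| = 1 := by rcases hε with h | h <;> simp [h]
    rw [this, one_mul]

/-- Every feasible configuration is isometric to the optimal one. -/
theorem Feasible.iso_optimal {p : Fin 6 → ℝ × ℝ} (hp : Feasible p) : Iso p base := by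
  obtain ⟨q, hqp, hm, h01⟩ := exists_iso_sorted p
  obtain ⟨x, y, hxy, x0, y0, hmono, hy, hy1, hgap⟩ := exists_normalized hm h01
  have hc := hp.of_iso (hxy.trans hqp)
  set u : Fin 6 → ℝ := fun i => 512 * y i with hu
  set z : Fin 6 → ℝ := fun i => 16384 * x i with hz
  have e : (fun i => (x i, y i)) = fun i => (z i / 16384, u i / 512) := by
    funext i; ext <;> simp only [hu, hz] <;> ring
  have hA : Admissible u z := by
    refine ⟨by simp only [hu, y0]; norm_num, by simp only [hz, x0]; norm_num, fun i j hij => ?_,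
      fun i j hij m n => ?_, fun i n => ?_⟩
    · have := hmono i j hij
      simp only [hz]
      constructor <;> linarith
    · have h := hc j i hij.ne' m n
      have hd : ((400405 : ℝ) / 10 ^ 6) ^ 2 ≤ d6 ^ 2 :=
        pow_le_pow_left₀ (by norm_num) (by linarith [d6_gt]) 2
      refine hd.trans (h.trans (le_of_eq ?_))
      simp only [hu, hz]
      ring
    · have h := hgap i n
      have e' : u (i + 1) - u i + 512 * n = 512 * (y (i + 1) - y i + n) := by
        simp only [hu]; ring
      rw [e', abs_mul, abs_of_pos (by norm_num : (0 : ℝ) < 512)]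
      simp only [hu]
      linarith
  refine (hxy.trans hqp).symm.trans ?_
  rw [e] at hc ⊢
  refine (hA.inCluster ?_ fun k => ?_).iso_base hA.u_zero hA.z_zero hc
  · simp only [hu]; constructor <;> linarith
  · have := hy k
    simp only [hu]; constructor <;> linarith

theorem feasible_of_e2norm {p : Fin 6 → ℝ × ℝ} (hp : ∀ i j : Fin 6, i ≠ j → ∀ m n : ℤ,
    e2norm (p i - p j + ((m : ℝ), (n : ℝ))) ≥ d6) : Feasible p := by
  intro i j hij m n
  have h := hp i j hij m n
  unfold e2norm at h
  have hd : 0 ≤ d6 := by linarith [d6_gt]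
  simpa using (Real.le_sqrt' (by linarith [d6_gt])).1 h

end SixPoints

/-- The optimal 6-point arrangement on the square flat torus is unique up to
isometry of the torus. -/
theorem six_points_optimal_unique (p q : Fin 6 → ℝ × ℝ)
    (hp : ∀ i j : Fin 6, i ≠ j → ∀ m n : ℤ,
      e2norm (p i - p j + ((m : ℝ), (n : ℝ))) ≥ d6)
    (hq : ∀ i j : Fin 6, i ≠ j → ∀ m n : ℤ,
      e2norm (q i - q j + ((m : ℝ), (n : ℝ))) ≥ d6) :
    ∃ Q : Matrix (Fin 2) (Fin 2) ℝ,
      Q * Q.transpose = 1 ∧ (∀ a b : Fin 2, ∃ z : ℤ, Q a b = (z : ℝ)) ∧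
      ∃ t : ℝ × ℝ, ∃ σ : Equiv.Perm (Fin 6),
        ∀ i : Fin 6, ∃ a b : ℤ,
          p i - (mulVec2 Q (q (σ i)) + t) = ((a : ℝ), (b : ℝ)) :=
  (SixPoints.feasible_of_e2norm hp).iso_optimal.trans
    (SixPoints.feasible_of_e2norm hq).iso_optimal.symm
end

section
/- For every configuration of 8 points on the square flat torus, the minimal toroidal distance is at most 1/(1 + √3). Precisely: for every map p : Fin 8 → ℝ × ℝ there exist indices i ≠ j and integers m, n such that ‖p i − p j + (m, n)‖ ≤ 1/(1 + √3). -/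
namespace TorusPacking

noncomputable section

/-- A rectangle with natural-number corners, in units of `1 / 2048` of the side of the torus. -/
structure Box where
  xl : ℕ
  xh : ℕ
  yl : ℕ
  yh : ℕ

/-- A branch-and-bound certificate: which box of the current list to bisect, and in which
direction, before continuing with the two halves. -/
inductive Plan where
  | leaf : Plan
  | splitX : ℕ → Plan → Plan → Plan
  | splitY : ℕ → Plan → Plan → Plan

/-- The numbers `⌊√(561930 - m ^ 2)⌋` for `m < 750`, packed as 11-bit digits. Here `561930` is the
integer part of `2048 ^ 2 * ((2 - √3) / 2)`. -/
def clearanceTable : ℕ :=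
  4608949687945605778146540133730451411530833166088377273489948688493579538576683673652569509082002699726045377995658961705081317126749045039527029681296325115897460705764177256448042703118100314020021239539724333838810518507502519715242515664281147137427812108647265555947751991739930114730042228070563374391155299178734986937518280638871333318386283295190306899960678252653082538895881952071654115500967076729590627372163849049277947990258825482321175599142301047770849024062400079159904290286632521080475324262112482569226279720042598889047064350274139363524998430336628382009419753077938421990570435706331551931412089408948087672981938578256777500075413169739343422853829337933115638667094318883049952890900347308147277115649471450854072744362378821492515155328972017152738089305129357253791395942857258583520913998717045895055820893985756461724702507569166735940245683053744418149527730571903207168821626137509163063954985321422430187245267998426803427868288117822502430797138676349696319473266373137091072271183216680319279453854397091450589772772157297508546621018777684643173407443737157389276424880546733469254208158417014287365572905714592681456115271539714273794654070950533484845862875730094674026561075206600972788601798056044621300969504439182494531465958513004505701525135750996504962656781301136459217926958053051156580245784222249786730062907464578855100445940443342686401005656740056245810121885758306942261404783849353680357028966121732493767275663663442536448310624803536464475989519946824686817918503301133863620305552702227566262966095539016431203713917400913415436848808108204260402501031602258335694392411087720109739027353261071710555373366105909129240806347745299123894490802341860916219852927735732350290196115121763333404227307291604718694037635338910823056994347405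584300956116728368224640457552886237829518179062051431424179811256892317490953093233336122422834795437011180695070686569402981132616469858981907838490316295501878929563654193519954089344881377089827322720073280517767479731922439143764753887764543990977511237250135443965318839652776157684278464476001535736936137206221939863192953064440117532398410000105895616886862457130429051477944192075367769593099651042201539497580798413114665384452065327708421761313229429918044087815440565180664711042945305832630367795598063427396599325863979209614743017415276193760689446171269358769528123011295456712787534985027567926295907214925393343304871522681037449018320380492459863522709132698424022887149

/-- A lower bound for the distance in one coordinate between two separated points whose distance
in the other coordinate is at most `m`. -/
def clearance (m : ℕ) : ℕ :=
  Nat.land (Nat.shiftRight clearanceTable (Nat.mul (nat_lit 11) m)) (nat_lit 2047)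

/-- An upper bound for the distance on the circle of length `2048` between a point of `[bl, bh]`
and a point of `[cl, ch]`. -/
def spread (bl bh cl ch : ℕ) : ℕ :=
  Nat.sub (Nat.add (Nat.sub bh cl) (Nat.sub (Nat.sub ch bl) (Nat.sub bh cl)))
    (Nat.sub (Nat.add (Nat.add (Nat.sub bh cl) (Nat.sub (Nat.sub ch bl) (Nat.sub bh cl)))
      (Nat.add (Nat.sub cl bh) (Nat.sub bl ch))) (nat_lit 2048))

/-- Improve the lower bound `l` of a coordinate at distance at most `2048 - w` from a coordinate
at least `bl`. -/
def raiseFar (w bl l : ℕ) : ℕ :=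
  Nat.add l (Nat.sub (Nat.sub (Nat.add bl w) (nat_lit 2048)) l)

/-- Improve the lower bound `l` of a coordinate at distance at least `w` from a coordinate in
`[bl, bh]`. -/
def raiseNear (w bl bh l : ℕ) : ℕ :=
  Nat.add l (Nat.mul (Nat.sub (Nat.add bl w) l)
    (Nat.sub (nat_lit 1) (Nat.sub (nat_lit 1) (Nat.sub (Nat.add l w) bh))))

/-- Improve the upper bound `h` of a coordinate at distance at most `2048 - w` from a coordinate
at most `bh`. -/
def lowerFar (w bh h : ℕ) : ℕ :=
  Nat.sub h (Nat.sub (Nat.add h w) (Nat.add bh (nat_lit 2048)))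

/-- Improve the upper bound `h` of a coordinate at distance at least `w` from a coordinate in
`[bl, bh]`. -/
def lowerNear (w bl bh h : ℕ) : ℕ :=
  Nat.sub h (Nat.mul (Nat.sub (Nat.add h w) bh)
    (Nat.sub (nat_lit 1) (Nat.sub (nat_lit 1) (Nat.sub (Nat.add bl w) h))))

/-- Shrink `[l, h]`, given a point of `[bl, bh]` at circular distance at least `w`, and continue
with `k`; the result is `true` if nothing is left. -/
def narrow (w bl bh l h : ℕ) (k : ℕ → ℕ → Bool) : Bool :=
  Nat.rec (k l h) (fun _ _ =>
    (fun l' h' => Nat.rec (k l' h') (fun _ _ => true) (Nat.sub l' h'))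
      (raiseNear w bl bh (raiseFar w bl l)) (lowerNear w bl bh (lowerFar w bh h))) w

/-- Shrink the box `c` using that its point is separated from a point of the box `b`. -/
def Box.tighten (b c : Box) (k : Box → Bool) : Bool :=
  Box.rec (fun bxl bxh byl byh => Box.rec (fun cxl cxh cyl cyh =>
    narrow (clearance (spread byl byh cyl cyh)) bxl bxh cxl cxh fun cxl cxh =>
      narrow (clearance (spread bxl bxh cxl cxh)) byl byh cyl cyh fun cyl cyh =>
        k ⟨cxl, cxh, cyl, cyh⟩) c) b

/-- Shrink all boxes of `cs` using the box `b`, and append `b` to the resulting list. -/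
def tightenAll (b : Box) (cs : List Box) : (List Box → Bool) → Bool :=
  List.rec (fun k => k [b])
    (fun c _ ih k => b.tighten c fun d => ih fun ds => k (d :: ds)) cs

/-- Use each of the first `n` boxes, cyclically, to shrink the others. -/
def relax (n : ℕ) : List Box → (List Box → Bool) → Bool :=
  Nat.rec (fun bs k => k bs) (fun _ ih bs k =>
    List.rec true (fun b bs _ => tightenAll b bs fun cs => ih cs k) bs) n

/-- Every point of `[l, h]` is within `16` of `a` on the circle of length `2048`. -/
def near (a l h : ℕ) : Bool :=
  (Nat.ble a (l + 16) && Nat.ble h (a + 16)) || Nat.ble (a + 2048) (l + 16)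

/-- Every target has a box close to it. -/
def nearTargets (ts : List (ℕ × ℕ)) (bs : List Box) : Bool :=
  ts.all fun t => bs.any fun b => near t.1 b.xl b.xh && near t.2 b.yl b.yh

/-- The optimal configuration, seen from one of its points. -/
def targetsA : List (ℕ × ℕ) :=
  [(0, 0), (1298, 0), (649, 375), (649, 1673), (1024, 1024), (274, 1024),
    (1673, 1399), (1673, 649)]

/-- The optimal configuration, seen from another one of its points. -/
def targetsB : List (ℕ × ℕ) :=
  [(1399, 375), (649, 375), (0, 750), (0, 0), (375, 1399), (1673, 1399),
    (1024, 1774), (1024, 1024)]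

def nearOptimal (bs : List Box) : Bool := nearTargets targetsA bs || nearTargets targetsB bs

def Box.leftHalf (b : Box) : Box := ⟨b.xl, (b.xl + b.xh) / 2, b.yl, b.yh⟩

def Box.rightHalf (b : Box) : Box := ⟨(b.xl + b.xh) / 2, b.xh, b.yl, b.yh⟩

def Box.lowerHalf (b : Box) : Box := ⟨b.xl, b.xh, b.yl, (b.yl + b.yh) / 2⟩

def Box.upperHalf (b : Box) : Box := ⟨b.xl, b.xh, (b.yl + b.yh) / 2, b.yh⟩

/-- Bring the `i`-th box to the front, replace it with each of its two halves `f` and `g`, and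
continue with `p` and `q` respectively. -/
def bisect (f g : Box → Box) (i : ℕ) (p q : List Box → Bool) (bs : List Box) : Bool :=
  match bs.drop i ++ bs.take i with
  | [] => false
  | b :: cs => p (f b :: cs) && q (g b :: cs)

/-- Run a branch-and-bound certificate: at the leaves the boxes must be contradictory or close to
the optimal configuration. -/
def Plan.check (p : Plan) : List Box → Bool :=
  Plan.rec (fun bs => relax 17 bs nearOptimal)
    (fun i _ _ p q bs => relax 17 bs (bisect .leftHalf .rightHalf i p q))
    (fun i _ _ p q bs => relax 17 bs (bisect .lowerHalf .upperHalf i p q)) p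

/-- The cells of the `4 × 4` grid other than the corners. -/
def cells : List ℕ := [1, 2, 4, 5, 6, 7, 8, 9, 10, 11, 13, 14]

def cellBox (k : ℕ) : Box :=
  ⟨512 * (k % 4), 512 * (k % 4) + 512, 512 * (k / 4), 512 * (k / 4) + 512⟩

/-- The boxes for a point at the origin and one point in each of the given cells. -/
def initial (l : List ℕ) : List Box := ⟨0, 0, 0, 0⟩ :: l.map cellBox

/-- Reflection of the grid of cells in a vertical line. -/
def reflectX (k : ℕ) : ℕ := 3 - k % 4 + 4 * (k / 4)

/-- Reflection of the grid of cells in a horizontal line. -/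
def reflectY (k : ℕ) : ℕ := k % 4 + 4 * (3 - k / 4)

/-- Reflection of the grid of cells in the diagonal. -/
def transpose (k : ℕ) : ℕ := 4 * (k % 4) + k / 4

/-- The nontrivial symmetries of the grid of cells. -/
def symmetries : List (ℕ → ℕ) :=
  [reflectX, reflectY, reflectX ∘ reflectY, transpose, transpose ∘ reflectX, transpose ∘ reflectY,
    transpose ∘ reflectX ∘ reflectY]

/-- A set of cells as a bit mask. -/
def code (l : List ℕ) : ℕ := (l.map fun k => 2 ^ k).sum

open Plan in
/-- The nontrivial certificates, by the code of the set of cells. -/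
def plans : List (ℕ × Plan) :=
  [(886, splitX 0 leaf leaf),
    (950, splitX 0 leaf leaf),
    (982, splitX 2 leaf (splitX 0 leaf leaf)),
    (998, splitX 0 leaf leaf),
    (1398, splitX 0 leaf leaf),
    (1462, splitY 1 (splitX 1 leaf leaf) (splitX 7 (splitX 3 leaf leaf) (splitX 2 leaf (splitX 1
      leaf leaf)))),
    (1494, splitX 2 (splitY 0 leaf leaf) (splitX 0 leaf leaf)),
    (1510, splitX 0 leaf leaf),
    (1654, splitX 0 leaf leaf),
    (1718, splitX 1 leaf (splitY 7 leaf (splitX 0 leaf leaf))),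
    (1878, splitY 2 (splitX 0 leaf leaf) (splitX 0 leaf leaf)),
    (1894, splitX 0 leaf leaf),
    (1942, splitX 2 leaf (splitY 7 (splitX 6 (splitX 1 leaf leaf) (splitY 7 (splitX 0 leaf leaf)
      (splitX 0 leaf leaf))) (splitX 0 leaf leaf))),
    (1958, splitX 1 (splitX 0 leaf leaf) (splitY 7 leaf (splitX 2 leaf (splitX 6 leaf leaf)))),
    (1970, splitX 0 leaf leaf),
    (1972, splitX 0 leaf leaf),
    (1990, splitX 5 (splitX 0 leaf leaf) (splitX 5 (splitX 0 leaf leaf) (splitX 1 leaf leaf))),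
    (2002, splitY 1 (splitX 7 leaf (splitX 4 (splitX 1 leaf leaf) (splitY 7 (splitX 1 leaf leaf)
      (splitX 5 (splitX 6 (splitX 0 leaf leaf) leaf) (splitY 0 leaf leaf))))) (splitX 0 leaf
      leaf)),
    (2004, splitX 4 (splitX 6 leaf leaf) leaf),
    (2018, splitX 3 (splitX 0 leaf leaf) (splitY 1 leaf leaf)),
    (2020, splitY 4 leaf leaf),
    (2422, splitX 0 leaf leaf),
    (2486, splitY 0 leaf leaf),
    (2870, splitX 0 leaf leaf),
    (2902, splitX 2 (splitX 0 leaf leaf) (splitX 0 leaf leaf)),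
    (2918, splitX 0 leaf leaf),
    (2930, splitX 0 leaf leaf),
    (2932, splitX 0 leaf leaf),
    (2966, splitY 0 (splitY 0 leaf leaf) (splitX 2 leaf leaf)),
    (2982, splitX 1 (splitX 0 leaf leaf) (splitY 7 leaf (splitX 1 leaf (splitX 1 leaf leaf)))),
    (2994, splitX 0 leaf leaf),
    (2996, splitX 0 leaf leaf),
    (3014, splitX 6 (splitY 1 (splitX 1 leaf leaf) (splitY 5 (splitX 1 leaf leaf) (splitX 1 (splitX
      1 (splitY 7 (splitX 0 leaf leaf) (splitX 2 (splitX 2 leaf leaf) (splitX 4 leaf (splitX 0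
      leaf leaf)))) (splitX 1 leaf leaf)) (splitX 1 (splitX 0 leaf leaf) (splitY 0 leaf
      leaf))))) leaf),
    (3026, splitX 3 leaf (splitX 0 leaf leaf)),
    (3028, splitX 2 (splitX 1 leaf leaf) leaf),
    (3042, splitX 3 (splitY 0 leaf leaf) (splitX 0 leaf (splitY 0 leaf leaf))),
    (3044, splitY 6 leaf (splitX 6 leaf (splitX 5 leaf (splitX 0 leaf leaf)))),
    (3878, splitX 0 leaf leaf),
    (8630, splitX 1 (splitX 0 leaf leaf) (splitX 0 leaf leaf)),
    (8662, splitX 2 (splitY 0 leaf leaf) (splitX 0 leaf leaf)),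
    (8678, splitX 0 leaf leaf),
    (8918, splitX 0 (splitX 0 leaf leaf) (splitX 1 leaf leaf)),
    (9158, splitX 2 (splitX 0 leaf leaf) (splitY 0 leaf leaf)),
    (9188, splitX 3 (splitX 0 leaf leaf) (splitX 0 leaf leaf)),
    (9398, splitY 1 (splitX 0 leaf leaf) (splitY 6 leaf leaf)),
    (9430, splitX 0 (splitY 0 (splitX 0 leaf leaf) leaf) leaf),
    (9622, splitX 2 (splitX 5 (splitY 0 leaf leaf) (splitY 2 leaf leaf)) (splitY 7 (splitX 0 leaf
      leaf) (splitX 1 (splitX 0 leaf leaf) leaf))),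
    (9638, splitY 1 (splitX 0 leaf leaf) (splitY 7 (splitX 2 leaf leaf) (splitY 6 (splitX 5 leaf
      (splitX 7 leaf leaf)) (splitX 3 leaf (splitY 7 leaf (splitY 0 leaf (splitX 0 leaf
      leaf))))))),
    (9670, splitX 0 (splitY 7 leaf (splitY 4 (splitX 0 leaf leaf) (splitX 7 (splitY 0 leaf leaf)
      (splitY 2 (splitY 4 (splitX 0 leaf leaf) (splitY 4 leaf (splitY 6 (splitX 2 (splitX 5
      leaf (splitX 0 leaf leaf)) (splitX 5 leaf (splitX 0 leaf leaf))) (splitY 2 (splitX 5 leaf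
      leaf) (splitX 5 leaf leaf))))) (splitX 4 (splitX 0 leaf leaf) (splitY 0 (splitX 5 (splitX
      0 leaf leaf) (splitX 7 (splitX 1 leaf leaf) (splitY 0 leaf leaf))) (splitY 5 (splitX 7
      leaf leaf) (splitX 0 leaf leaf)))))))) (splitX 2 leaf leaf)),
    (9682, splitX 1 (splitY 0 leaf leaf) (splitY 4 (splitY 2 (splitY 6 (splitX 7 (splitX 1 leaf
      leaf) (splitX 3 (splitX 6 (splitY 6 leaf (splitX 7 (splitX 1 leaf (splitX 0 leaf leaf))
      leaf)) leaf) (splitX 0 leaf leaf))) leaf) (splitX 0 leaf leaf)) (splitX 1 leaf leaf))),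
    (9684, splitX 1 (splitY 0 leaf leaf) (splitY 3 (splitX 3 leaf leaf) (splitX 6 (splitX 6 (splitY
      6 leaf (splitY 7 leaf (splitX 1 (splitX 1 leaf leaf) (splitX 4 (splitY 1 leaf leaf)
      (splitY 1 (splitY 2 (splitX 1 leaf leaf) (splitX 1 leaf leaf)) leaf))))) (splitX 1 leaf
      leaf)) (splitY 1 (splitX 7 (splitY 1 (splitX 1 leaf leaf) (splitX 1 (splitX 0 leaf leaf)
      leaf)) (splitX 2 (splitX 1 leaf leaf) leaf)) (splitY 1 leaf (splitY 1 (splitX 7 leaf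
      (splitX 0 leaf leaf)) (splitY 1 (splitX 4 leaf (splitX 1 leaf leaf)) leaf))))))),
    (9698, splitY 2 (splitY 5 (splitX 1 (splitX 0 leaf leaf) (splitY 1 (splitX 0 leaf leaf) (splitX
      6 leaf (splitX 1 leaf leaf)))) (splitX 3 leaf (splitX 0 leaf leaf))) (splitY 0 leaf
      (splitX 0 leaf leaf))),
    (9700, splitX 4 (splitX 0 leaf leaf) (splitY 1 (splitX 5 (splitY 5 leaf (splitX 0 leaf leaf))
      (splitX 0 leaf leaf)) leaf)),
    (9938, splitY 4 (splitX 7 (splitX 0 leaf leaf) (splitX 5 leaf (splitX 0 leaf leaf))) (splitY 1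
      (splitX 1 leaf leaf) (splitX 1 leaf leaf))),
    (9940, splitY 2 (splitX 0 leaf leaf) (splitY 1 (splitX 0 leaf leaf) (splitX 0 leaf leaf))),
    (10358, splitX 0 leaf leaf),
    (10422, splitY 1 (splitX 2 (splitX 0 (splitY 7 (splitX 6 (splitX 0 leaf leaf) leaf) leaf) leaf)
      leaf) (splitX 0 leaf leaf)),
    (10454, splitX 0 (splitY 0 (splitX 0 (splitX 7 (splitY 3 leaf (splitX 6 leaf (splitX 4 (splitY
      3 leaf (splitX 3 (splitX 3 leaf (splitX 1 leaf leaf)) leaf)) leaf))) leaf) leaf) (splitX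
      0 leaf leaf)) (splitX 1 leaf leaf)),
    (10582, splitY 0 leaf (splitX 1 (splitY 1 (splitY 1 (splitY 7 leaf (splitX 5 (splitX 0 leaf
      leaf) leaf)) (splitX 1 leaf leaf)) (splitX 1 leaf (splitY 7 (splitX 6 (splitX 2 leaf
      leaf) (splitY 2 (splitX 4 leaf (splitX 3 leaf leaf)) (splitY 0 leaf leaf))) (splitY 1
      (splitX 4 (splitX 6 (splitX 0 leaf leaf) (splitX 7 (splitY 5 leaf leaf) leaf)) (splitX 0
      leaf leaf)) (splitX 7 leaf (splitX 1 leaf leaf)))))) (splitX 0 leaf leaf))),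
    (10598, splitX 0 leaf leaf),
    (10612, splitX 4 leaf (splitY 7 (splitX 0 leaf leaf) (splitY 7 (splitX 5 (splitX 6 (splitX 3
      (splitX 0 leaf leaf) leaf) (splitY 0 leaf leaf)) (splitX 1 (splitX 0 leaf leaf) (splitX 0
      leaf leaf))) (splitX 0 leaf leaf)))),
    (10646, splitX 0 (splitX 0 leaf leaf) (splitY 1 leaf leaf)),
    (10662, splitY 1 (splitY 4 (splitX 4 leaf leaf) (splitX 6 (splitX 7 (splitX 0 leaf leaf)
      (splitY 0 leaf (splitX 5 (splitX 0 leaf leaf) leaf))) leaf)) (splitX 1 leaf (splitX 1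
      (splitY 3 (splitX 4 leaf (splitY 4 (splitY 1 (splitX 4 leaf (splitY 7 leaf (splitX 7 leaf
      (splitY 1 leaf leaf)))) (splitY 0 leaf (splitX 7 leaf (splitX 2 leaf leaf)))) leaf))
      (splitX 1 (splitX 0 leaf leaf) (splitY 0 (splitY 1 leaf leaf) (splitX 7 (splitX 0 leaf
      leaf) (splitY 1 (splitX 1 leaf leaf) (splitY 1 (splitX 0 leaf leaf) (splitX 3 (splitX 4
      (splitX 0 leaf leaf) leaf) (splitY 6 (splitX 1 leaf leaf) leaf)))))))) leaf))),
    (10674, splitY 6 (splitX 1 leaf leaf) leaf),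
    (10676, splitX 4 leaf (splitX 6 (splitY 4 leaf (splitX 0 leaf leaf)) (splitX 4 leaf leaf))),
    (10694, splitY 0 leaf (splitX 4 (splitY 7 (splitX 4 leaf leaf) (splitX 2 (splitY 1 (splitX 7
      (splitX 0 leaf leaf) (splitY 3 (splitX 1 leaf leaf) leaf)) (splitX 7 (splitY 5 (splitY 0
      (splitY 2 (splitY 0 (splitY 5 (splitX 7 (splitX 6 (splitY 7 (splitX 0 leaf leaf) (splitY
      1 (splitX 5 (splitY 3 (splitX 1 leaf leaf) (splitY 3 leaf (splitX 7 (splitY 5 leaf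
      (splitY 3 (splitX 0 (splitY 3 (splitY 0 leaf (splitX 1 leaf (splitX 1 leaf leaf)))
      (splitX 1 (splitX 0 leaf leaf) (splitX 0 leaf leaf))) (splitX 0 (splitX 3 (splitY 1
      (splitY 5 leaf (splitX 5 (splitX 0 leaf (splitX 4 leaf leaf)) leaf)) leaf) leaf) (splitX
      1 leaf leaf))) leaf)) leaf))) leaf) leaf)) (splitX 1 leaf leaf)) (splitX 0 leaf leaf))
      leaf) (splitX 4 leaf leaf)) leaf) (splitY 3 (splitY 6 (splitX 0 leaf leaf) (splitY 5 leaf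
      (splitY 2 (splitX 0 leaf leaf) (splitX 6 (splitX 5 (splitY 5 (splitY 3 leaf (splitX 1
      leaf leaf)) (splitX 4 (splitX 6 (splitX 1 leaf leaf) leaf) (splitY 6 (splitX 0 (splitX 0
      leaf leaf) leaf) leaf))) (splitX 1 leaf leaf)) leaf)))) (splitY 6 leaf (splitX 1 leaf
      leaf)))) (splitX 4 (splitX 4 (splitX 5 (splitY 4 (splitX 0 (splitX 2 leaf leaf) (splitX 2
      leaf leaf)) (splitX 5 (splitY 5 (splitY 4 (splitY 5 (splitX 6 (splitY 7 (splitY 0 (splitX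
      7 (splitY 1 (splitY 3 leaf (splitX 7 (splitX 0 leaf leaf) leaf)) (splitX 3 (splitX 0 leaf
      leaf) (splitX 3 leaf leaf))) (splitY 1 leaf (splitX 3 leaf leaf))) (splitY 5 leaf (splitY
      3 (splitX 1 leaf leaf) (splitX 1 leaf (splitX 0 leaf leaf))))) (splitY 2 (splitX 2 leaf
      leaf) (splitX 5 leaf leaf))) (splitY 0 (splitX 0 leaf (splitX 0 leaf leaf)) (splitY 5
      leaf (splitY 5 (splitX 0 leaf leaf) leaf)))) (splitY 5 leaf (splitX 0 leaf leaf)))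
      (splitY 5 (splitX 6 (splitY 7 (splitX 4 leaf leaf) (splitX 0 leaf leaf)) (splitY 4
      (splitY 0 leaf leaf) leaf)) (splitX 0 leaf leaf))) (splitY 7 (splitX 1 (splitY 2 (splitX
      7 leaf leaf) (splitY 5 (splitX 1 leaf leaf) (splitX 1 leaf leaf))) (splitX 0 (splitY 1
      (splitY 3 leaf (splitY 5 (splitY 0 leaf leaf) leaf)) (splitY 3 leaf (splitY 7 leaf
      leaf))) (splitX 1 (splitY 3 leaf (splitY 7 leaf leaf)) (splitX 7 (splitY 3 leaf (splitY 5
      (splitY 0 leaf leaf) leaf)) (splitX 3 leaf leaf))))) (splitX 2 (splitX 1 (splitX 1 leaf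
      leaf) (splitY 1 leaf leaf)) (splitX 1 (splitX 1 leaf leaf) (splitX 5 leaf leaf)))))
      (splitX 0 (splitX 1 (splitX 1 leaf leaf) (splitY 3 leaf (splitY 6 leaf (splitX 4 leaf
      leaf)))) (splitX 1 (splitX 5 (splitY 4 leaf (splitX 0 leaf leaf)) (splitX 4 leaf leaf))
      (splitX 2 (splitY 0 leaf leaf) (splitY 7 (splitX 4 leaf leaf) (splitY 7 (splitX 4 (splitY
      3 leaf (splitX 1 (splitX 3 leaf (splitY 0 leaf leaf)) leaf)) (splitX 3 leaf leaf))
      (splitX 7 (splitX 2 (splitX 1 leaf leaf) (splitX 1 leaf leaf)) (splitX 4 (splitX 5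
      (splitX 5 (splitX 0 leaf leaf) leaf) (splitX 5 leaf leaf)) (splitY 7 (splitX 5 (splitX 5
      (splitX 0 leaf leaf) leaf) (splitX 3 leaf leaf)) (splitX 5 (splitX 5 (splitX 0 leaf leaf)
      leaf) (splitX 5 (splitX 0 leaf leaf) leaf)))))))))))) (splitX 0 leaf leaf)) (splitX 1
      (splitY 1 (splitY 3 (splitX 0 leaf leaf) leaf) (splitY 3 leaf leaf)) (splitY 1 (splitX 7
      (splitX 1 leaf leaf) (splitX 2 (splitX 0 leaf leaf) (splitX 4 (splitY 3 (splitX 1 leaf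
      leaf) leaf) (splitY 2 (splitX 0 leaf leaf) (splitX 1 leaf leaf))))) (splitY 3 (splitX 0
      leaf leaf) leaf)))) (splitX 5 (splitX 4 (splitY 0 (splitX 2 leaf leaf) leaf) (splitX 3
      leaf leaf)) (splitX 2 leaf (splitX 2 leaf (splitY 7 (splitX 0 leaf leaf) (splitY 0
      (splitX 1 leaf leaf) (splitY 5 (splitX 5 leaf (splitX 1 (splitX 1 (splitX 1 (splitX 3
      leaf (splitX 1 leaf leaf)) (splitX 0 leaf leaf)) (splitY 3 leaf leaf)) leaf))
      leaf)))))))) (splitY 0 leaf leaf))) (splitX 1 (splitX 0 leaf leaf) (splitY 0 leaf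
      leaf)))) leaf)),
    (10706, splitY 0 (splitX 0 leaf (splitX 0 leaf leaf)) (splitX 0 leaf leaf)),
    (10708, splitX 5 (splitY 4 leaf (splitX 6 (splitY 4 (splitX 1 leaf leaf) (splitX 1 leaf leaf))
      (splitY 7 (splitX 3 (splitX 4 (splitY 7 leaf (splitY 3 (splitY 6 (splitX 0 leaf leaf)
      (splitX 6 (splitY 4 (splitY 4 (splitY 5 (splitX 7 (splitX 6 leaf leaf) leaf) leaf)
      (splitY 1 (splitX 1 (splitX 1 leaf leaf) leaf) (splitY 7 (splitX 1 (splitX 1 leaf (splitX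
      1 leaf leaf)) leaf) (splitX 0 (splitX 1 leaf leaf) leaf)))) (splitY 1 (splitX 2 leaf
      leaf) leaf)) (splitY 3 (splitX 0 leaf leaf) (splitX 1 (splitX 0 leaf leaf) leaf))))
      (splitY 6 (splitX 0 leaf leaf) (splitY 2 (splitX 4 (splitX 3 leaf leaf) leaf) (splitY 7
      (splitY 3 (splitY 1 (splitX 3 (splitY 7 leaf leaf) leaf) (splitX 3 leaf leaf)) leaf)
      (splitX 0 (splitX 2 leaf leaf) leaf)))))) (splitX 5 (splitX 3 leaf leaf) (splitX 3 leaf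
      leaf))) (splitY 4 leaf (splitX 3 (splitX 1 leaf leaf) (splitX 1 (splitX 0 leaf leaf)
      (splitX 0 leaf leaf))))) (splitY 0 leaf leaf)))) leaf),
    (10722, splitX 5 (splitY 7 (splitX 6 leaf leaf) (splitX 5 (splitY 5 (splitX 2 leaf leaf) leaf)
      (splitY 0 leaf (splitY 3 (splitX 3 leaf leaf) (splitY 0 leaf (splitX 0 leaf leaf))))))
      leaf),
    (10838, splitY 0 leaf (splitX 7 (splitX 1 (splitX 2 (splitY 2 (splitY 0 (splitX 0 leaf leaf)
      (splitX 0 leaf leaf)) (splitY 0 (splitX 4 (splitY 7 (splitX 1 leaf leaf) (splitX 1 leaf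
      leaf)) leaf) (splitY 1 (splitY 0 leaf leaf) (splitY 0 leaf leaf)))) leaf) (splitX 0 leaf
      leaf)) (splitX 1 leaf leaf))),
    (10868, splitY 2 (splitY 5 (splitY 5 (splitY 1 leaf leaf) leaf) (splitX 4 (splitX 4 leaf leaf)
      leaf)) (splitX 0 leaf leaf)),
    (10902, splitY 0 (splitY 0 leaf leaf) (splitX 2 (splitY 5 (splitY 7 (splitY 4 (splitY 3 leaf
      (splitX 2 (splitX 6 leaf (splitX 7 (splitX 0 leaf leaf) (splitY 6 (splitY 5 (splitX 1
      (splitX 4 (splitX 2 leaf leaf) leaf) (splitX 4 (splitY 5 (splitY 1 (splitX 3 leaf (splitY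
      4 (splitX 3 (splitY 6 (splitX 7 (splitX 0 leaf leaf) (splitY 6 leaf leaf)) leaf) leaf)
      (splitX 0 leaf leaf))) (splitX 1 leaf leaf)) leaf) leaf)) (splitX 0 leaf leaf)) (splitY 4
      (splitY 0 (splitX 2 (splitX 0 leaf leaf) (splitX 6 leaf (splitY 0 leaf leaf))) (splitX 0
      leaf leaf)) (splitX 0 leaf leaf))))) leaf)) (splitY 3 leaf leaf)) (splitY 6 leaf (splitX
      0 leaf leaf))) leaf) (splitX 0 leaf leaf))),
    (10932, splitX 3 (splitY 6 (splitY 5 (splitY 7 (splitX 0 leaf leaf) (splitX 0 leaf leaf))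
      (splitY 0 leaf leaf)) (splitY 1 (splitX 0 leaf leaf) leaf)) (splitX 0 leaf leaf)),
    (10962, splitX 2 (splitX 1 (splitX 1 leaf leaf) leaf) leaf),
    (10964, splitX 4 (splitY 3 leaf (splitY 3 (splitX 0 leaf leaf) (splitX 0 leaf leaf))) (splitX 0
      leaf leaf)),
    (11078, splitY 1 (splitY 4 (splitX 1 leaf leaf) (splitX 1 leaf leaf)) (splitX 0 leaf leaf)),
    (11142, splitX 5 (splitY 2 (splitY 0 leaf leaf) (splitX 3 (splitY 4 (splitX 0 leaf leaf) leaf)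
      (splitY 0 (splitX 0 leaf leaf) (splitY 6 (splitX 3 (splitX 4 (splitY 3 (splitX 4 (splitX
      2 (splitX 0 (splitX 0 leaf leaf) leaf) (splitY 2 (splitX 7 (splitY 0 leaf leaf) (splitX 3
      (splitY 4 (splitY 4 (splitX 0 (splitX 0 leaf leaf) leaf) (splitX 0 leaf leaf)) (splitX 4
      (splitY 7 (splitX 7 leaf (splitY 3 (splitY 4 (splitX 0 (splitX 0 leaf leaf) (splitY 1
      (splitX 2 (splitX 1 leaf leaf) (splitY 6 (splitY 0 (splitX 0 leaf leaf) (splitY 1 (splitX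
      0 leaf leaf) leaf)) leaf)) (splitX 1 leaf leaf))) leaf) leaf)) (splitY 5 (splitY 2
      (splitY 0 (splitX 7 leaf (splitY 4 (splitY 6 (splitY 2 (splitX 0 leaf (splitX 1 leaf
      leaf)) (splitX 0 leaf leaf)) (splitX 0 leaf leaf)) (splitX 0 (splitX 0 leaf leaf) (splitX
      0 leaf leaf)))) (splitX 4 leaf (splitY 0 (splitX 0 leaf leaf) leaf))) (splitX 2 (splitX 2
      leaf leaf) (splitX 5 leaf (splitY 0 leaf leaf)))) (splitY 1 (splitY 6 (splitY 4 (splitY 4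
      (splitY 0 leaf (splitY 0 leaf leaf)) (splitX 1 leaf leaf)) (splitY 4 (splitX 0 leaf leaf)
      leaf)) (splitY 7 (splitY 4 (splitY 4 (splitY 0 leaf (splitX 7 leaf leaf)) (splitY 0 leaf
      (splitY 0 leaf leaf))) (splitX 4 (splitX 1 leaf (splitX 0 leaf leaf)) (splitY 0 leaf
      (splitX 7 (splitX 0 leaf leaf) leaf)))) (splitX 1 (splitX 0 leaf leaf) (splitX 7 (splitY
      0 leaf (splitX 7 (splitX 1 leaf leaf) leaf)) (splitX 0 leaf leaf))))) (splitX 7 (splitY 0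
      (splitX 2 leaf leaf) (splitX 2 leaf leaf)) (splitX 0 (splitY 1 leaf leaf) (splitX 4
      (splitX 2 (splitX 0 (splitX 1 leaf leaf) leaf) (splitX 2 leaf leaf)) (splitX 0 leaf
      leaf))))))) (splitX 7 (splitY 0 (splitY 0 (splitY 1 leaf leaf) leaf) (splitY 2 (splitX 5
      (splitX 0 leaf leaf) leaf) (splitY 5 leaf (splitX 7 (splitX 0 leaf leaf) leaf)))) leaf)))
      (splitY 2 (splitX 6 (splitY 1 (splitX 7 leaf (splitX 5 leaf leaf)) (splitX 5 leaf leaf))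
      leaf) leaf))) (splitX 3 (splitX 1 (splitX 1 leaf (splitY 4 leaf leaf)) (splitX 2 (splitX
      0 leaf leaf) leaf)) leaf))) (splitX 3 (splitX 0 leaf leaf) (splitX 7 (splitY 5 (splitY 2
      leaf (splitX 2 leaf leaf)) (splitX 4 leaf (splitY 5 (splitY 0 leaf leaf) (splitX 0 leaf
      leaf)))) leaf))) (splitX 0 (splitX 0 leaf leaf) (splitY 0 (splitY 0 leaf leaf) (splitY 6
      (splitX 6 (splitY 6 (splitX 5 (splitY 2 leaf leaf) (splitY 5 (splitX 7 leaf (splitX 7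
      (splitX 1 leaf (splitY 2 leaf leaf)) (splitX 1 (splitX 7 leaf (splitY 3 (splitX 3 leaf
      (splitY 2 leaf leaf)) leaf)) (splitY 5 leaf leaf)))) (splitX 0 leaf leaf))) (splitX 3
      (splitY 7 (splitX 1 leaf leaf) leaf) (splitY 7 (splitY 0 (splitX 0 leaf leaf) (splitX 2
      (splitY 0 (splitY 4 (splitY 7 (splitX 3 leaf leaf) (splitX 6 (splitY 7 leaf (splitX 4
      (splitX 7 (splitX 3 leaf leaf) (splitY 0 leaf leaf)) (splitX 0 leaf leaf))) (splitY 5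
      (splitY 6 (splitX 7 (splitY 1 (splitX 1 leaf leaf) (splitX 1 leaf leaf)) (splitY 1 leaf
      leaf)) (splitX 3 leaf leaf)) (splitY 0 (splitX 1 leaf leaf) (splitX 1 leaf leaf)))))
      (splitY 5 (splitX 4 leaf leaf) (splitX 7 (splitY 0 leaf leaf) leaf))) (splitY 1 (splitX 2
      leaf leaf) (splitX 7 (splitX 2 leaf leaf) (splitX 2 (splitX 1 leaf leaf) (splitY 5
      (splitX 1 leaf leaf) (splitX 1 leaf leaf)))))) (splitX 2 (splitX 2 leaf leaf) (splitY 7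
      leaf (splitX 2 leaf leaf))))) leaf))) (splitY 7 (splitX 1 leaf (splitX 2 leaf (splitY 5
      (splitY 7 (splitX 6 (splitX 1 leaf leaf) (splitY 1 (splitX 0 leaf leaf) (splitY 2 leaf
      leaf))) leaf) leaf))) (splitX 4 leaf leaf))) (splitY 1 (splitX 1 leaf leaf) leaf)))))
      (splitY 5 (splitY 6 (splitX 0 leaf leaf) (splitY 6 (splitY 4 (splitY 5 (splitY 4 (splitX
      4 (splitY 7 (splitX 5 leaf (splitX 0 (splitX 3 (splitX 0 leaf leaf) (splitY 3 (splitX 6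
      leaf (splitY 7 (splitY 3 leaf leaf) leaf)) (splitX 2 (splitY 2 (splitY 0 (splitX 7 leaf
      (splitY 4 (splitY 4 (splitX 7 (splitY 1 (splitY 2 (splitX 0 (splitX 0 leaf leaf) (splitX
      4 leaf (splitY 6 (splitY 2 leaf (splitX 2 leaf leaf)) leaf))) (splitX 1 (splitX 4 leaf
      leaf) (splitY 3 leaf (splitX 1 leaf leaf)))) (splitX 7 (splitX 1 (splitX 1 leaf (splitX 1
      leaf leaf)) (splitY 1 leaf leaf)) leaf)) (splitX 5 leaf (splitY 4 leaf leaf))) (splitX 5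
      leaf leaf)) (splitX 2 leaf leaf))) (splitY 0 leaf leaf)) (splitY 0 (splitY 4 (splitX 1
      leaf leaf) (splitX 1 leaf (splitX 0 leaf leaf))) (splitX 3 leaf leaf))) (splitY 7 (splitX
      1 leaf leaf) leaf)))) (splitY 0 (splitY 7 (splitX 2 leaf (splitX 2 leaf (splitX 6 leaf
      (splitY 5 leaf (splitX 2 leaf leaf))))) (splitY 5 (splitX 5 leaf (splitY 0 leaf leaf))
      leaf)) leaf))) (splitX 3 leaf (splitX 0 leaf leaf))) (splitX 1 leaf leaf)) (splitY 2 leaf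
      leaf)) (splitX 0 leaf leaf)) leaf) leaf)) (splitX 2 leaf (splitY 2 leaf (splitY 2 (splitX
      4 (splitY 1 (splitX 2 leaf leaf) (splitX 2 (splitY 1 leaf leaf) (splitY 5 (splitX 7
      (splitY 0 leaf leaf) (splitY 5 (splitX 5 (splitY 4 (splitX 0 leaf leaf) (splitX 7 (splitY
      0 (splitY 4 leaf leaf) (splitX 1 leaf leaf)) (splitY 5 (splitX 2 leaf leaf) (splitX 2
      (splitY 5 leaf leaf) (splitY 5 (splitX 1 leaf leaf) leaf))))) (splitX 2 leaf (splitY 0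
      (splitX 7 (splitX 0 leaf leaf) (splitY 6 (splitX 2 leaf leaf) (splitY 4 (splitX 2 (splitX
      0 leaf leaf) (splitX 0 (splitX 0 leaf leaf) (splitY 1 (splitX 3 (splitY 0 leaf leaf)
      leaf) leaf))) (splitY 1 (splitX 2 (splitX 5 (splitX 2 leaf leaf) (splitX 4 leaf leaf))
      (splitY 5 (splitX 5 leaf leaf) (splitY 0 (splitX 0 leaf (splitX 0 leaf leaf)) leaf)))
      (splitX 3 leaf leaf))))) leaf))) (splitX 3 leaf leaf))) leaf))) (splitY 6 (splitX 2 leaf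
      (splitY 0 (splitX 6 leaf (splitY 0 leaf leaf)) leaf)) leaf)) leaf))))) (splitY 0 leaf
      leaf)) (splitX 7 (splitX 0 leaf leaf) leaf))))) leaf)]

/-- Either a symmetry decreases the code of `l`, or the certificate for `l` is valid. -/
def verify (l : List ℕ) : Bool :=
  (symmetries.any fun g => Nat.blt (code (l.map g)) (code l)) ||
    ((plans.lookup (code l)).getD Plan.leaf).check (initial l)

set_option maxRecDepth 100000 in
theorem verify_sublists : (List.sublistsLen 7 cells).all verify = true := by
  decide +kernel

/-- The points `u` and `v` of the torus are at distance greater than `1 / (1 + √3)`. -/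
def Sep (u v : ℝ × ℝ) : Prop :=
  ∀ m n : ℤ, (2 - √3) / 2 < (u.1 - v.1 + m) ^ 2 + (u.2 - v.2 + n) ^ 2

/-- The box `b` contains the point `p` of the unit square. -/
structure Box.Mem (b : Box) (p : ℝ × ℝ) : Prop where
  xl_le : (b.xl : ℝ) ≤ 2048 * p.1
  le_xh : 2048 * p.1 ≤ b.xh
  fst_le : p.1 ≤ 1
  yl_le : (b.yl : ℝ) ≤ 2048 * p.2
  le_yh : 2048 * p.2 ≤ b.yh
  snd_le : p.2 ≤ 1

theorem Sep.symm {u v : ℝ × ℝ} (h : Sep u v) : Sep v u := by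
  intro m n
  have := h (-m) (-n)
  push_cast at this
  linarith [this]

theorem clearance_sq (m : ℕ) : clearance m ^ 2 + m ^ 2 ≤ 561930 ∨ clearance m = 0 := by
  have small : ∀ m < 750, clearance m ^ 2 + m ^ 2 ≤ 561930 := by decide +kernel
  rcases lt_or_ge m 750 with h | h
  · exact .inl (small m h)
  · right
    have hz : Nat.shiftRight clearanceTable (11 * m) = 0 := by
      change clearanceTable >>> (11 * m) = 0
      rw [Nat.shiftRight_eq_div_pow]
      apply Nat.div_eq_of_lt
      calc clearanceTable < 2 ^ (11 * 750) := by decide +kernel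
        _ ≤ 2 ^ (11 * m) := Nat.pow_le_pow_right (by norm_num) (by omega)
    change Nat.land (Nat.shiftRight clearanceTable (11 * m)) 2047 = 0
    rw [hz]
    exact Nat.zero_and 2047

theorem spread_spec {bl bh cl ch : ℕ} (hb : bl ≤ bh) (hc : cl ≤ ch) :
    (bh ≤ cl + spread bl bh cl ch ∧ ch ≤ bl + spread bl bh cl ch) ∨
      2048 + bh ≤ spread bl bh cl ch + cl ∨ 2048 + ch ≤ spread bl bh cl ch + bl ∨
        2048 ≤ spread bl bh cl ch := by
  have : spread bl bh cl ch = (bh - cl + (ch - bl - (bh - cl))) -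
    ((bh - cl + (ch - bl - (bh - cl))) + ((cl - bh) + (bl - ch)) - 2048) := rfl
  omega

theorem exists_abs_le_spread {bl bh cl ch : ℕ} {u v : ℝ} (hbl : bl ≤ u) (hbh : u ≤ bh)
    (hcl : cl ≤ v) (hch : v ≤ ch) (hu : u ≤ 2048) (hv : v ≤ 2048) :
    ∃ m : ℤ, |u - v + 2048 * m| ≤ spread bl bh cl ch := by
  have hb : bl ≤ bh := by exact_mod_cast hbl.trans hbh
  have hc : cl ≤ ch := by exact_mod_cast hcl.trans hch
  have hbl0 : (0 : ℝ) ≤ bl := bl.cast_nonneg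
  have hcl0 : (0 : ℝ) ≤ cl := cl.cast_nonneg
  rcases spread_spec hb hc with ⟨h1, h2⟩ | h | h | h
  · refine ⟨0, ?_⟩
    have h1' : (bh : ℝ) ≤ cl + spread bl bh cl ch := by exact_mod_cast h1
    have h2' : (ch : ℝ) ≤ bl + spread bl bh cl ch := by exact_mod_cast h2
    rw [abs_le]
    constructor <;> push_cast <;> linarith
  · refine ⟨1, ?_⟩
    have h' : (2048 : ℝ) + bh ≤ spread bl bh cl ch + cl := by exact_mod_cast h
    rw [abs_le]
    constructor <;> push_cast <;> linarith
  · refine ⟨-1, ?_⟩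
    have h' : (2048 : ℝ) + ch ≤ spread bl bh cl ch + bl := by exact_mod_cast h
    rw [abs_le]
    constructor <;> push_cast <;> linarith
  · refine ⟨0, ?_⟩
    have h' : (2048 : ℝ) ≤ spread bl bh cl ch := by exact_mod_cast h
    rw [abs_le]
    constructor <;> push_cast <;> linarith

/-- Separation in terms of one coordinate, given a bound in the other one. -/
theorem clearance_le_abs {x y : ℝ} {w : ℕ} (hy : |y| ≤ w)
    (h : (2 - √3) / 2 < (x / 2048) ^ 2 + (y / 2048) ^ 2) : (clearance w : ℝ) ≤ |x| := by
  rcases clearance_sq w with hc | hc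
  · have hc' : (clearance w : ℝ) ^ 2 + (w : ℝ) ^ 2 ≤ 561930 := by exact_mod_cast hc
    have h3 : √3 < 1.73205081 := by
      rw [Real.sqrt_lt' (by norm_num)]; norm_num
    have hy2 : y ^ 2 ≤ (w : ℝ) ^ 2 := sq_le_sq' (abs_le.1 hy).1 (abs_le.1 hy).2
    refine le_of_sq_le_sq ?_ (abs_nonneg x)
    rw [sq_abs]
    nlinarith
  · rw [hc]
    simp

theorem clearance_le_abs_and_abs_le {x y : ℝ} {w : ℕ} (hx : |x| ≤ 2048)
    (hy : ∃ n : ℤ, |y + 2048 * n| ≤ w)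
    (h : ∀ m n : ℤ, (2 - √3) / 2 < (x / 2048 + m) ^ 2 + (y / 2048 + n) ^ 2) :
    (clearance w : ℝ) ≤ |x| ∧ |x| ≤ 2048 - clearance w := by
  obtain ⟨n, hn⟩ := hy
  have key (m : ℤ) : (clearance w : ℝ) ≤ |x + 2048 * m| :=
    clearance_le_abs hn (by convert h m n using 3 <;> ring)
  have h0 := key 0
  have h1 := key 1
  have h2 := key (-1)
  push_cast at h0 h1 h2
  rw [abs_le] at hx
  rw [abs_of_nonneg (by linarith)] at h1
  rw [abs_of_nonpos (by linarith)] at h2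
  refine ⟨by simpa using h0, abs_le.2 ⟨by linarith, by linarith⟩⟩

theorem raiseFar_spec (w bl l : ℕ) :
    raiseFar w bl l = l ∨ raiseFar w bl l + 2048 = bl + w := by
  have : raiseFar w bl l = l + (bl + w - 2048 - l) := rfl
  omega

theorem raiseNear_spec (w bl bh l : ℕ) :
    raiseNear w bl bh l = l ∨ (raiseNear w bl bh l = bl + w ∧ bh < l + w) := by
  have h : raiseNear w bl bh l = l + (bl + w - l) * (1 - (1 - (l + w - bh))) := rfl
  rcases Nat.eq_zero_or_pos (l + w - bh) with h0 | h0
  · left; simp [h, h0]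
  · have : 1 - (1 - (l + w - bh)) = 1 := by omega
    rw [this] at h
    omega

theorem lowerFar_spec (w bh h : ℕ) :
    lowerFar w bh h = h ∨ bh + 2048 ≤ lowerFar w bh h + w := by
  have : lowerFar w bh h = h - (h + w - (bh + 2048)) := rfl
  omega

theorem lowerNear_spec (w bl bh h : ℕ) :
    lowerNear w bl bh h = h ∨ (bh ≤ lowerNear w bl bh h + w ∧ h < bl + w) := by
  have hd : lowerNear w bl bh h = h - (h + w - bh) * (1 - (1 - (bl + w - h))) := rfl
  rcases Nat.eq_zero_or_pos (bl + w - h) with h0 | h0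
  · left; simp [hd, h0]
  · have : 1 - (1 - (bl + w - h)) = 1 := by omega
    rw [this] at hd
    omega

theorem narrow_sound {w bl bh l h : ℕ} {u v : ℝ} {k : ℕ → ℕ → Bool} (hbl : bl ≤ u)
    (hbh : u ≤ bh) (hl : l ≤ v) (hh : v ≤ h) (hw : w ≤ |u - v|) (hw' : |u - v| ≤ 2048 - w)
    (hk : narrow w bl bh l h k = true) :
    ∃ l' h' : ℕ, l' ≤ v ∧ v ≤ h' ∧ k l' h' = true := by
  cases w with
  | zero => exact ⟨l, h, hl, hh, hk⟩
  | succ w' =>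
    rw [narrow] at hk
    dsimp only at hk
    generalize w' + 1 = w at *
    set l₁ := raiseFar w bl l
    set h₁ := lowerFar w bh h
    rw [abs_le] at hw'
    have hl₁ : (l₁ : ℝ) ≤ v := by
      rcases raiseFar_spec w bl l with e | e
      · rwa [show l₁ = l from e]
      · have : (l₁ : ℝ) + 2048 = bl + w := by exact_mod_cast e
        linarith
    have hh₁ : v ≤ (h₁ : ℝ) := by
      rcases lowerFar_spec w bh h with e | e
      · rwa [show h₁ = h from e]
      · have : (bh : ℝ) + 2048 ≤ h₁ + w := by exact_mod_cast e
        linarith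
    have hl₂ : (raiseNear w bl bh l₁ : ℝ) ≤ v := by
      rcases raiseNear_spec w bl bh l₁ with e | ⟨e, e'⟩
      · rwa [e]
      · have e₁ : (raiseNear w bl bh l₁ : ℝ) = bl + w := by exact_mod_cast e
        have e₂ : (bh : ℝ) < l₁ + w := by exact_mod_cast e'
        rcases le_abs.1 hw with h' | h' <;> linarith
    have hh₂ : v ≤ (lowerNear w bl bh h₁ : ℝ) := by
      rcases lowerNear_spec w bl bh h₁ with e | ⟨e, e'⟩
      · rwa [e]
      · have e₁ : (bh : ℝ) ≤ lowerNear w bl bh h₁ + w := by exact_mod_cast e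
        have e₂ : (h₁ : ℝ) < bl + w := by exact_mod_cast e'
        rcases le_abs.1 hw with h' | h' <;> linarith
    refine ⟨_, _, hl₂, hh₂, ?_⟩
    have : raiseNear w bl bh l₁ ≤ lowerNear w bl bh h₁ := by exact_mod_cast hl₂.trans hh₂
    generalize raiseNear w bl bh l₁ = l₂ at *
    generalize lowerNear w bl bh h₁ = h₂ at *
    rwa [Nat.sub_eq, Nat.sub_eq_zero_of_le this] at hk

theorem Box.tighten_eq (b c : Box) (k : Box → Bool) : b.tighten c k =
    narrow (clearance (spread b.yl b.yh c.yl c.yh)) b.xl b.xh c.xl c.xh fun xl xh =>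
      narrow (clearance (spread b.xl b.xh xl xh)) b.yl b.yh c.yl c.yh fun yl yh =>
        k ⟨xl, xh, yl, yh⟩ :=
  rfl

theorem Box.tighten_sound {b c : Box} {p q : ℝ × ℝ} {k : Box → Bool} (hb : b.Mem p)
    (hc : c.Mem q) (hs : Sep p q) (hk : b.tighten c k = true) :
    ∃ c' : Box, c'.Mem q ∧ k c' = true := by
  obtain ⟨b1, b2, b3, b4, b5, b6⟩ := hb
  obtain ⟨c1, c2, c3, c4, c5, c6⟩ := hc
  rw [Box.tighten_eq] at hk
  have nonneg (n : ℕ) : (0 : ℝ) ≤ n := n.cast_nonneg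
  have hx : |2048 * p.1 - 2048 * q.1| ≤ 2048 := by
    rw [abs_le]; constructor <;> linarith [nonneg b.xl, nonneg c.xl]
  have hy : |2048 * p.2 - 2048 * q.2| ≤ 2048 := by
    rw [abs_le]; constructor <;> linarith [nonneg b.yl, nonneg c.yl]
  obtain ⟨w1, w2⟩ := clearance_le_abs_and_abs_le hx
    (exists_abs_le_spread b4 b5 c4 c5 (by linarith) (by linarith))
    (fun m n => by convert hs m n using 3 <;> ring)
  obtain ⟨cxl', cxh', c1', c2', hk⟩ := narrow_sound b1 b2 c1 c2 w1 w2 hk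
  obtain ⟨w3, w4⟩ := clearance_le_abs_and_abs_le hy
    (exists_abs_le_spread b1 b2 c1' c2' (by linarith) (by linarith))
    (fun m n => by rw [add_comm]; convert hs n m using 3 <;> ring)
  obtain ⟨cyl', cyh', c4', c5', hk⟩ := narrow_sound b4 b5 c4 c5 w3 w4 hk
  exact ⟨⟨cxl', cxh', cyl', cyh'⟩, ⟨c1', c2', c3, c4', c5', c6⟩, hk⟩

theorem tightenAll_cons (b c : Box) (cs : List Box) (k : List Box → Bool) :
    tightenAll b (c :: cs) k =
      b.tighten c fun c' => tightenAll b cs fun cs' => k (c' :: cs') :=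
  rfl

theorem tightenAll_sound {b : Box} {cs : List Box} {p : ℝ × ℝ} {qs : List (ℝ × ℝ)}
    (hb : b.Mem p) (hc : List.Forall₂ Box.Mem cs qs) (hs : ∀ q ∈ qs, Sep p q)
    {k : List Box → Bool} (hk : tightenAll b cs k = true) :
    ∃ cs', List.Forall₂ Box.Mem cs' (qs ++ [p]) ∧ k cs' = true := by
  induction hc generalizing k with
  | nil => exact ⟨[b], by simpa using hb, hk⟩
  | cons h _ ih =>
    rw [tightenAll_cons] at hk
    obtain ⟨c', hc', hk⟩ := Box.tighten_sound hb h (hs _ List.mem_cons_self) hk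
    obtain ⟨cs', hcs', hk⟩ := ih (fun q hq => hs q (List.mem_cons_of_mem _ hq)) hk
    exact ⟨c' :: cs', hcs'.cons hc', hk⟩

theorem relax_sound {n : ℕ} {bs : List Box} {ps : List (ℝ × ℝ)}
    (hb : List.Forall₂ Box.Mem bs ps) (hs : ps.Pairwise Sep) {k : List Box → Bool}
    (hk : relax n bs k = true) :
    ps = [] ∨ ∃ bs' ps', List.Forall₂ Box.Mem bs' ps' ∧ ps'.Perm ps ∧ k bs' = true := by
  induction n generalizing bs ps with
  | zero => exact .inr ⟨bs, ps, hb, .refl _, hk⟩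
  | succ n ih =>
    cases hb with
    | nil => exact .inl rfl
    | @cons b p bs ps hb hbs =>
      right
      obtain ⟨hp, hs⟩ := List.pairwise_cons.1 hs
      obtain ⟨bs', hbs', hk⟩ := tightenAll_sound hb hbs hp hk
      have hperm : (ps ++ [p]).Perm (p :: ps) := List.perm_append_comm
      have hs' : (ps ++ [p]).Pairwise Sep :=
        (hperm.pairwise_iff Sep.symm).2 (List.pairwise_cons.2 ⟨hp, hs⟩)
      rcases ih hbs' hs' hk with h | ⟨bs₂, ps₂, h1, h2, h3⟩
      · simp at h
      · exact ⟨bs₂, ps₂, h1, h2.trans hperm, h3⟩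

theorem nearTargets_sound {ts : List (ℕ × ℕ)} {bs : List Box} {ps : List (ℝ × ℝ)}
    (hb : List.Forall₂ Box.Mem bs ps) (h : nearTargets ts bs = true) {t : ℕ × ℕ} (ht : t ∈ ts) :
    ∃ p ∈ ps, ∃ m n : ℤ, |2048 * (p.1 + m) - t.1| ≤ 16 ∧ |2048 * (p.2 + n) - t.2| ≤ 16 := by
  have near_sound {a l h : ℕ} {x : ℝ} (h1 : l ≤ 2048 * x) (h2 : 2048 * x ≤ h) (h3 : x ≤ 1)
      (hn : near a l h = true) : ∃ m : ℤ, |2048 * (x + m) - a| ≤ 16 := by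
    simp only [near, Bool.or_eq_true, Bool.and_eq_true, Nat.ble_eq] at hn
    rcases hn with ⟨h4, h5⟩ | h4
    · have h4' : (a : ℝ) ≤ l + 16 := by exact_mod_cast h4
      have h5' : (h : ℝ) ≤ a + 16 := by exact_mod_cast h5
      exact ⟨0, abs_le.2 ⟨by push_cast; linarith, by push_cast; linarith⟩⟩
    · have h4' : (a : ℝ) + 2048 ≤ l + 16 := by exact_mod_cast h4
      have := a.cast_nonneg (α := ℝ)
      exact ⟨-1, abs_le.2 ⟨by push_cast; linarith, by push_cast; linarith⟩⟩
  rw [nearTargets, List.all_eq_true] at h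
  have h := h t ht
  rw [List.any_eq_true] at h
  obtain ⟨b, hbm, hbt⟩ := h
  obtain ⟨p, hp, hm⟩ : ∃ p ∈ ps, b.Mem p := by
    clear hbt h
    induction hb with
    | nil => simp at hbm
    | cons h _ ih =>
      rcases List.mem_cons.1 hbm with rfl | hbm
      · exact ⟨_, List.mem_cons_self, h⟩
      · obtain ⟨p, hp, hm⟩ := ih hbm
        exact ⟨p, List.mem_cons_of_mem _ hp, hm⟩
  rw [Bool.and_eq_true] at hbt
  obtain ⟨m, hm1⟩ := near_sound hm.xl_le hm.le_xh hm.fst_le hbt.1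
  obtain ⟨n, hn1⟩ := near_sound hm.yl_le hm.le_yh hm.snd_le hbt.2
  exact ⟨p, hp, m, n, hm1, hn1⟩

/-- Boxes containing pairwise separated points cannot be refuted by a sound check `k`. -/
def Refutes (k : List Box → Bool) : Prop :=
  ∀ bs ps, ps ≠ [] → List.Forall₂ Box.Mem bs ps → ps.Pairwise Sep → k bs = false

theorem Refutes.relax {k : List Box → Bool} (h : Refutes k) (n : ℕ) :
    Refutes fun bs => relax n bs k := by
  intro bs ps hne hb hs
  by_contra hk
  rw [Bool.not_eq_false] at hk
  rcases relax_sound hb hs hk with h0 | ⟨bs', ps', hb', hp, hk'⟩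
  · exact hne h0
  · have := h bs' ps' (fun e => hne (by simpa [e] using hp.symm)) hb'
      ((hp.pairwise_iff Sep.symm).2 hs)
    simp [this] at hk'

theorem forall₂_rotate {bs : List Box} {ps : List (ℝ × ℝ)} (hb : List.Forall₂ Box.Mem bs ps)
    (hs : ps.Pairwise Sep) (i : ℕ) :
    List.Forall₂ Box.Mem (bs.drop i ++ bs.take i) (ps.drop i ++ ps.take i) ∧
      (ps.drop i ++ ps.take i).Pairwise Sep := by
  refine ⟨List.rel_append (List.forall₂_drop i hb) (List.forall₂_take i hb), ?_⟩
  have hp : (ps.drop i ++ ps.take i).Perm ps := by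
    conv_rhs => rw [← List.take_append_drop i ps]
    exact List.perm_append_comm
  exact (hp.pairwise_iff Sep.symm).2 hs

theorem Refutes.bisect {k k' : List Box → Bool} (h : Refutes k) (h' : Refutes k')
    {f g : Box → Box} (hfg : ∀ {b p}, b.Mem p → (f b).Mem p ∨ (g b).Mem p) (i : ℕ) :
    Refutes (bisect f g i k k') := by
  intro bs ps hne hb hs
  obtain ⟨hb', hs'⟩ := forall₂_rotate hb hs i
  have hne' : ps.drop i ++ ps.take i ≠ [] := by
    intro e
    rw [List.append_eq_nil_iff] at e
    exact hne (by rw [← List.take_append_drop i ps, e.1, e.2]; rfl)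
  rw [TorusPacking.bisect]
  revert hb' hs' hne'
  generalize bs.drop i ++ bs.take i = cs
  generalize ps.drop i ++ ps.take i = qs
  rintro hb' hs' hne'
  cases hb' with
  | nil => exact absurd rfl hne'
  | cons hm hb =>
    rcases hfg hm with hm | hm
    · simp [h _ _ hne' (hb.cons hm) hs']
    · simp [h' _ _ hne' (hb.cons hm) hs']

theorem Box.Mem.leftHalf_or_rightHalf {b : Box} {p : ℝ × ℝ} (h : b.Mem p) :
    b.leftHalf.Mem p ∨ b.rightHalf.Mem p := by
  rcases le_total (2048 * p.1) ((b.xl + b.xh) / 2 : ℕ) with hc | hc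
  · exact .inl ⟨h.xl_le, hc, h.fst_le, h.yl_le, h.le_yh, h.snd_le⟩
  · exact .inr ⟨hc, h.le_xh, h.fst_le, h.yl_le, h.le_yh, h.snd_le⟩

theorem Box.Mem.lowerHalf_or_upperHalf {b : Box} {p : ℝ × ℝ} (h : b.Mem p) :
    b.lowerHalf.Mem p ∨ b.upperHalf.Mem p := by
  rcases le_total (2048 * p.2) ((b.yl + b.yh) / 2 : ℕ) with hc | hc
  · exact .inl ⟨h.xl_le, h.le_xh, h.fst_le, h.yl_le, hc, h.snd_le⟩
  · exact .inr ⟨h.xl_le, h.le_xh, h.fst_le, hc, h.le_yh, h.snd_le⟩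

theorem refutes_check (h : Refutes nearOptimal) (p : Plan) : Refutes p.check := by
  induction p with
  | leaf => exact h.relax 17
  | splitX i p q hp hq => exact (hp.bisect hq Box.Mem.leftHalf_or_rightHalf i).relax 17
  | splitY i p q hp hq => exact (hp.bisect hq Box.Mem.lowerHalf_or_upperHalf i).relax 17

/-- A point `(x, 1 / 2 + y)` at distance more than `1` from both end points of the segment centered
at the origin with direction `(s - α, -ε)`, where `s = √3`. -/
theorem lt_of_far_from_segment {s α ε x y : ℝ} (hs : s ^ 2 = 3) (hα : |α| ≤ 1 / 20)
    (hε : |ε| ≤ 1 / 20) (hx : |x| ≤ 1 / 20) (hy : |y| ≤ 1 / 20)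
    (h₁ : 1 < (x + (s - α) / 2) ^ 2 + (1 / 2 + y - ε / 2) ^ 2)
    (h₂ : 1 < (x - (s - α) / 2) ^ 2 + (1 / 2 + y + ε / 2) ^ 2) :
    s / 2 * α + |s * x - ε / 2| -
      (2 * |x| + 2 * |y| + |α| / 4 + |ε| / 4) / 20 < y := by
  have mul_bound {a b : ℝ} (ha : |a| ≤ 1 / 20) : |a * b| ≤ |b| / 20 := by
    rw [abs_mul]
    nlinarith [abs_nonneg b]
  have bx := le_of_abs_le (mul_bound (b := x) hx)
  have bY := le_of_abs_le (mul_bound (b := y) hy)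
  have bα := le_of_abs_le (mul_bound (b := α) hα)
  have bε := le_of_abs_le (mul_bound (b := ε) hε)
  have bαx := abs_le.1 (mul_bound (b := x) hα)
  have bεy := abs_le.1 (mul_bound (b := y) hε)
  rcases abs_cases (s * x - ε / 2) with ⟨e, _⟩ | ⟨e, _⟩ <;> rw [e] <;> nlinarith

theorem abs_add_abs_le {x y m : ℝ} (hx : -m ≤ x) (hy : -m ≤ y) (hm : 0 ≤ m) :
    |x| + |y| ≤ |x + y| + 2 * m := by
  have h₁ := le_abs_self (x + y)
  have h₂ := neg_le_abs (x + y)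
  rcases abs_cases x with ⟨e, _⟩ | ⟨e, _⟩ <;> rcases abs_cases y with ⟨e', _⟩ | ⟨e', _⟩ <;>
    rw [e, e'] <;> linarith

/-- Given the positions of two neighbouring vertical bars of length about `1`, a bar right in the
middle between them has to be longer. -/
theorem bar_step {s t₁ t₂ r₁ r₂ t₁' t₂' r₁' r₂' α ε α' ε' : ℝ} (hs : s ^ 2 = 3)
    (hs₁ : 1.732 < s) (hs₂ : s < 1.7321)
    (hα : t₁ - r₁ = 1 + α) (hε : t₂ - r₂ = ε) (hα' : t₂' - r₂' = 1 + α') (hε' : r₁' - t₁' = ε')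
    (bα : |α| ≤ 1 / 20) (bε : |ε| ≤ 1 / 20)
    (bx : |t₁' - (t₁ + r₁ + (1 + s)) / 2| ≤ 1 / 20)
    (bx' : |r₁' - (t₁ + r₁ + (1 + s)) / 2| ≤ 1 / 20)
    (bY : |t₂' - (t₂ + r₂) / 2 - 1 / 2| ≤ 1 / 20)
    (bY' : |(t₂ + r₂) / 2 - r₂' - 1 / 2| ≤ 1 / 20)
    (h₁ : 1 < (t₁' - t₁) ^ 2 + (t₂' - t₂) ^ 2)
    (h₂ : 1 < (t₁' - r₁ - (1 + s)) ^ 2 + (t₂' - r₂) ^ 2)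
    (h₃ : 1 < (r₁' - t₁) ^ 2 + (r₂' - t₂) ^ 2)
    (h₄ : 1 < (r₁' - r₁ - (1 + s)) ^ 2 + (r₂' - r₂) ^ 2) :
    s * α + 1.6 * |ε'| - 1.05 * |ε| - 0.15 * |α'| - 0.26 * |α| < α' := by
  obtain rfl : t₁ = r₁ + 1 + α := by linarith
  obtain rfl : t₂ = r₂ + ε := by linarith
  generalize hx : t₁' - (r₁ + 1 + α + r₁ + (1 + s)) / 2 = x at *
  generalize hx' : r₁' - (r₁ + 1 + α + r₁ + (1 + s)) / 2 = x' at *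
  generalize hy : t₂' - (r₂ + ε + r₂) / 2 - 1 / 2 = y at *
  generalize hy' : (r₂ + ε + r₂) / 2 - r₂' - 1 / 2 = y' at *
  obtain rfl : t₁' = x + (r₁ + 1 + α + r₁ + (1 + s)) / 2 := by linarith
  obtain rfl : r₁' = x' + (r₁ + 1 + α + r₁ + (1 + s)) / 2 := by linarith
  obtain rfl : t₂' = y + (r₂ + ε + r₂) / 2 + 1 / 2 := by linarith
  obtain rfl : r₂' = (r₂ + ε + r₂) / 2 - 1 / 2 - y' := by linarith
  obtain rfl : α' = y + y' := by linarith
  obtain rfl : ε' = x' - x := by linarith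
  have k := lt_of_far_from_segment hs bα bε bx bY (by convert h₁ using 1; ring)
    (by convert h₂ using 1; ring)
  have k' := lt_of_far_from_segment hs bα (ε := -ε) (by rwa [abs_neg]) bx' bY'
    (by convert h₃ using 1; ring) (by convert h₄ using 1; ring)
  rw [abs_neg] at k'
  have sα : |s / 2 * α| ≤ 0.867 * |α| := by
    rw [abs_mul, abs_of_pos (by linarith only [hs₁])]
    exact mul_le_mul_of_nonneg_right (by linarith only [hs₂]) (abs_nonneg α)
  have sx : 1.732 * |x| ≤ |s * x - ε / 2| + |ε| / 2 := by
    have : |s * x| ≤ |s * x - ε / 2| + |ε / 2| := by simpa using abs_add_le (s * x - ε / 2) (ε / 2)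
    rw [abs_mul, abs_of_pos (show 0 < s by linarith only [hs₁]), abs_div, abs_two] at this
    linarith only [this, mul_le_mul_of_nonneg_right hs₁.le (abs_nonneg x)]
  have sx' : 1.732 * |x'| ≤ |s * x' - -ε / 2| + |ε| / 2 := by
    have : |s * x'| ≤ |s * x' - -ε / 2| + |-ε / 2| := by
      simpa using abs_add_le (s * x' - -ε / 2) (-ε / 2)
    rw [abs_mul, abs_of_pos (show 0 < s by linarith only [hs₁]), abs_div, abs_neg, abs_two] at this
    linarith only [this, mul_le_mul_of_nonneg_right hs₁.le (abs_nonneg x')]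
  have sε : 1.732 * |x' - x| ≤ |s * x' - -ε / 2| + |s * x - ε / 2| + |ε| := by
    have : |s * (x' - x)| ≤ |s * x' - -ε / 2| + |s * x - ε / 2| + |ε| := by
      calc |s * (x' - x)| = |(s * x' - -ε / 2) - (s * x - ε / 2) - ε| := by congr 1; ring
        _ ≤ |(s * x' - -ε / 2) - (s * x - ε / 2)| + |ε| := abs_sub _ _
        _ ≤ _ := by gcongr; exact abs_sub _ _
    rw [abs_mul, abs_of_pos (show 0 < s by linarith only [hs₁])] at this
    linarith only [this, mul_le_mul_of_nonneg_right hs₁.le (abs_nonneg (x' - x))]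
  have sα' := abs_le.1 sα
  have u0 := abs_nonneg (s * x - ε / 2)
  have u0' := abs_nonneg (s * x' - -ε / 2)
  have a0 := abs_nonneg α
  have e0 := abs_nonneg ε
  have x0 := abs_nonneg x
  have x0' := abs_nonneg x'
  have y0 := abs_nonneg y
  have y0' := abs_nonneg y'
  have bound : |y| + |y'| ≤ |y + y'| + 2 * (0.867 * |α| +
      (2 * |x| + 2 * |y| + |α| / 4 + |ε| / 4) / 20 +
      (2 * |x'| + 2 * |y'| + |α| / 4 + |ε| / 4) / 20) :=
    abs_add_abs_le (by linarith only [k, sα', u0, x0', y0', a0, e0])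
      (by linarith only [k', sα', u0', x0, y0, a0, e0])
      (by linarith only [x0, x0', y0, y0', a0, e0])
  linarith only [k, k', sx, sx', sε, bound, x0, x0', y0, y0', a0, e0, u0, u0',
    abs_nonneg (x' - x), abs_nonneg (y + y')]

theorem le_of_one_lt_sq_add_sq {α ε : ℝ} (hα : |α| ≤ 1 / 20) (hε : |ε| ≤ 1 / 20)
    (h : 1 < (1 + α) ^ 2 + ε ^ 2) : |α| ≤ α + (|α| + |ε|) / 20 := by
  have h1 : α ^ 2 ≤ |α| / 20 := by rw [← sq_abs]; nlinarith [abs_nonneg α]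
  have h2 : ε ^ 2 ≤ |ε| / 20 := by rw [← sq_abs]; nlinarith [abs_nonneg ε]
  have h3 : 0 < 2 * α + (|α| + |ε|) / 20 := by nlinarith
  rcases abs_cases α with ⟨e, _⟩ | ⟨e, _⟩ <;> linarith [abs_nonneg α, abs_nonneg ε]

theorem le_mul_of_abs_le_add {s α ε : ℝ} (hs₁ : 1.732 < s) (hs₂ : s < 1.7321)
    (h : |α| ≤ α + (|α| + |ε|) / 20) : 1.732 * α - (|α| + |ε|) / 1000 ≤ s * α := by
  have h₁ : 0 ≤ (s - 1.732) * (α + (|α| + |ε|) / 20) :=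
    mul_nonneg (by linarith) ((abs_nonneg α).trans h)
  have h₂ : 0 ≤ (1.7321 - s) * (|α| + |ε|) :=
    mul_nonneg (by linarith) (add_nonneg (abs_nonneg α) (abs_nonneg ε))
  linarith [abs_nonneg α, abs_nonneg ε]

/-- The optimal configuration, in the torus of side length `1 + √3`. -/
noncomputable def optimum : List (ℝ × ℝ) :=
  [(1 / 2, 0), (-1 / 2, 0), ((1 + √3) / 2, 1 / 2), ((1 + √3) / 2, -1 / 2),
    ((1 + √3) / 2 + 1 / 2, (1 + √3) / 2), ((1 + √3) / 2 - 1 / 2, (1 + √3) / 2),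
    (0, (1 + √3) / 2 + 1 / 2), (0, (1 + √3) / 2 - 1 / 2)]

theorem sub_mem_Ioo_of_near {x y p q s : ℝ} (hx : |x - p| ≤ 0.0221) (hy : |y - q| ≤ 0.0221)
    (h₁ : 0.0442 < p - q) (h₂ : p - q < s - 0.0442) : 0 < x - y ∧ x - y < s := by
  rw [abs_le] at hx hy
  constructor <;> linarith

set_option maxHeartbeats 2000000 in
/-- The optimal configuration is isolated: nearby points have smaller distances. -/
theorem not_near_optimum {S : Set (ℝ × ℝ)}
    (hS : ∀ u ∈ S, ∀ v ∈ S, (0 < u.1 - v.1 ∧ u.1 - v.1 < 1 + √3) ∨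
        (0 < u.2 - v.2 ∧ u.2 - v.2 < 1 + √3) →
      ∀ m n : ℤ, 1 < (u.1 - v.1 + (1 + √3) * m) ^ 2 + (u.2 - v.2 + (1 + √3) * n) ^ 2)
    (hopt : ∀ t ∈ optimum, ∃ u ∈ S, |u.1 - t.1| ≤ 0.0221 ∧ |u.2 - t.2| ≤ 0.0221) : False := by
  have hs : √3 ^ 2 = 3 := Real.sq_sqrt (by norm_num)
  have hs₁ : 1.732 < √3 := Real.lt_sqrt_of_sq_lt (by norm_num)
  have hs₂ : √3 < 1.7321 := by rw [Real.sqrt_lt' (by norm_num)]; norm_num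
  simp only [optimum, List.forall_mem_cons, List.not_mem_nil, false_imp_iff, implies_true,
    and_true] at hopt
  generalize √3 = s at *
  obtain ⟨⟨a, ha, ha₁, ha₂⟩, ⟨a', ha', ha₁', ha₂'⟩, ⟨b, hb, hb₁, hb₂⟩, ⟨b', hb', hb₁', hb₂'⟩,
    ⟨c, hc, hc₁, hc₂⟩, ⟨c', hc', hc₁', hc₂'⟩, ⟨d, hd, hd₁, hd₂⟩, ⟨d', hd', hd₁', hd₂'⟩⟩ := hopt
  have farX {u v p q} (m n : ℤ) (hu : u ∈ S) (hv : v ∈ S) (h : |u.1 - p| ≤ 0.0221)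
      (h' : |v.1 - q| ≤ 0.0221) (h₁ : 0.0442 < p - q) (h₂ : p - q < 1 + s - 0.0442) :=
    hS u hu v hv (.inl (sub_mem_Ioo_of_near h h' h₁ h₂)) m n
  have farY {u v p q} (m n : ℤ) (hu : u ∈ S) (hv : v ∈ S) (h : |u.2 - p| ≤ 0.0221)
      (h' : |v.2 - q| ≤ 0.0221) (h₁ : 0.0442 < p - q) (h₂ : p - q < 1 + s - 0.0442) :=
    hS u hu v hv (.inr (sub_mem_Ioo_of_near h h' h₁ h₂)) m n
  have aa := farX 0 0 ha ha' ha₁ ha₁' (by linarith only [hs₁]) (by linarith only [hs₁])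
  have bb := farY 0 0 hb hb' hb₂ hb₂' (by linarith only [hs₁]) (by linarith only [hs₁])
  have cc := farX 0 0 hc hc' hc₁ hc₁' (by linarith only [hs₁]) (by linarith only [hs₁])
  have dd := farY 0 0 hd hd' hd₂ hd₂' (by linarith only [hs₁]) (by linarith only [hs₁])
  have ab := farX 0 0 hb ha hb₁ ha₁ (by linarith only [hs₁]) (by linarith only [hs₁])
  have ab' := farX 0 0 hb' ha hb₁' ha₁ (by linarith only [hs₁]) (by linarith only [hs₁])
  have a₁b₀ := farX (-1) 0 hb ha' hb₁ ha₁' (by linarith only [hs₁]) (by linarith only [hs₁])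
  have a₁b₁ := farX (-1) 0 hb' ha' hb₁' ha₁' (by linarith only [hs₁]) (by linarith only [hs₁])
  have bc := farY 0 0 hc hb hc₂ hb₂ (by linarith only [hs₁]) (by linarith only [hs₁])
  have bc' := farY 0 0 hc' hb hc₂' hb₂ (by linarith only [hs₁]) (by linarith only [hs₁])
  have b₁c₀ := farY 0 (-1) hc hb' hc₂ hb₂' (by linarith only [hs₁]) (by linarith only [hs₁])
  have b₁c₁ := farY 0 (-1) hc' hb' hc₂' hb₂' (by linarith only [hs₁]) (by linarith only [hs₁])
  have cd := farX (-1) 0 hc hd hc₁ hd₁ (by linarith only [hs₁]) (by linarith only [hs₁])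
  have cd' := farX (-1) 0 hc hd' hc₁ hd₁' (by linarith only [hs₁]) (by linarith only [hs₁])
  have c₁d₀ := farX 0 0 hc' hd hc₁' hd₁ (by linarith only [hs₁]) (by linarith only [hs₁])
  have c₁d₁ := farX 0 0 hc' hd' hc₁' hd₁' (by linarith only [hs₁]) (by linarith only [hs₁])
  have da := farY 0 (-1) hd ha hd₂ ha₂ (by linarith only [hs₁]) (by linarith only [hs₁])
  have da' := farY 0 (-1) hd ha' hd₂ ha₂' (by linarith only [hs₁]) (by linarith only [hs₁])
  have d₁a₀ := farY 0 0 hd' ha hd₂' ha₂ (by linarith only [hs₁]) (by linarith only [hs₁])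
  have d₁a₁ := farY 0 0 hd' ha' hd₂' ha₂' (by linarith only [hs₁]) (by linarith only [hs₁])
  clear farX farY hS
  rw [abs_le] at ha₁ ha₂ ha₁' ha₂' hb₁ hb₂ hb₁' hb₂' hc₁ hc₂ hc₁' hc₂' hd₁ hd₂ hd₁' hd₂'
  push_cast at aa bb cc dd ab ab' a₁b₀ a₁b₁ bc bc' b₁c₀ b₁c₁ cd cd' c₁d₀ c₁d₁ da da' d₁a₀ d₁a₁
  have ba : |a.1 - a'.1 - 1| ≤ 1 / 20 := by rw [abs_le]; constructor <;> linarith only [ha₁, ha₁']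
  have bε : |a.2 - a'.2| ≤ 1 / 20 := by rw [abs_le]; constructor <;> linarith only [ha₂, ha₂']
  have bb₁ : |b.2 - b'.2 - 1| ≤ 1 / 20 := by rw [abs_le]; constructor <;> linarith only [hb₂, hb₂']
  have bb₂ : |b'.1 - b.1| ≤ 1 / 20 := by rw [abs_le]; constructor <;> linarith only [hb₁', hb₁]
  have bc₁ : |c.1 - c'.1 - 1| ≤ 1 / 20 := by rw [abs_le]; constructor <;> linarith only [hc₁, hc₁']
  have bc₂ : |c.2 - c'.2| ≤ 1 / 20 := by rw [abs_le]; constructor <;> linarith only [hc₂, hc₂']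
  have bd₁ : |d.2 - d'.2 - 1| ≤ 1 / 20 := by rw [abs_le]; constructor <;> linarith only [hd₂, hd₂']
  have bd₂ : |d'.1 - d.1| ≤ 1 / 20 := by rw [abs_le]; constructor <;> linarith only [hd₁', hd₁]
  have eab := bar_step (t₁ := a.1) (t₂ := a.2) (r₁ := a'.1) (r₂ := a'.2) (t₁' := b.1) (t₂' := b.2)
    (r₁' := b'.1) (r₂' := b'.2) (α := a.1 - a'.1 - 1) (α' := b.2 - b'.2 - 1) hs hs₁ hs₂ (by ring)
    rfl (by ring) rfl ba bε (abs_le.2 (by constructor <;> linarith only [hb₁, ha₁, ha₁', hs₁, hs₂]))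
    (abs_le.2 (by constructor <;> linarith only [hb₁', ha₁, ha₁', hs₁, hs₂]))
    (abs_le.2 (by constructor <;> linarith only [hb₂, ha₂, ha₂', hs₁, hs₂]))
    (abs_le.2 (by constructor <;> linarith only [hb₂', ha₂, ha₂', hs₁, hs₂]))
    (by linarith only [ab]) (by linarith only [a₁b₀])
    (by linarith only [ab']) (by linarith only [a₁b₁])
  have ebc := bar_step (t₁ := b.2) (t₂ := -b.1) (r₁ := b'.2) (r₂ := -b'.1) (t₁' := c'.2)
    (t₂' := -c'.1) (r₁' := c.2) (r₂' := -c.1) (α := b.2 - b'.2 - 1) (ε := b'.1 - b.1)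
    (α' := c.1 - c'.1 - 1) hs hs₁ hs₂ (by ring)
    (by ring) (by ring) rfl bb₁ bb₂
    (abs_le.2 (by constructor <;> linarith only [hc₂', hb₂, hb₂', hs₁, hs₂]))
    (abs_le.2 (by constructor <;> linarith only [hc₂, hb₂, hb₂', hs₁, hs₂]))
    (abs_le.2 (by constructor <;> linarith only [hc₁', hb₁, hb₁', hs₁, hs₂]))
    (abs_le.2 (by constructor <;> linarith only [hc₁, hb₁, hb₁', hs₁, hs₂]))
    (by linarith only [bc']) (by linarith only [b₁c₁])
    (by linarith only [bc]) (by linarith only [b₁c₀])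
  have ecd := bar_step (t₁ := -c'.1) (t₂ := -c'.2) (r₁ := -c.1) (r₂ := -c.2) (t₁' := -d'.1)
    (t₂' := -d'.2) (r₁' := -d.1) (r₂' := -d.2) (α := c.1 - c'.1 - 1) (ε := c.2 - c'.2)
    (α' := d.2 - d'.2 - 1) (ε' := d'.1 - d.1) hs hs₁ hs₂ (by ring)
    (by ring) (by ring) (by ring) bc₁ bc₂
    (abs_le.2 (by constructor <;> linarith only [hd₁', hc₁', hc₁, hs₁, hs₂]))
    (abs_le.2 (by constructor <;> linarith only [hd₁, hc₁', hc₁, hs₁, hs₂]))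
    (abs_le.2 (by constructor <;> linarith only [hd₂', hc₂', hc₂, hs₁, hs₂]))
    (abs_le.2 (by constructor <;> linarith only [hd₂, hc₂', hc₂, hs₁, hs₂]))
    (by linarith only [c₁d₁]) (by linarith only [cd'])
    (by linarith only [c₁d₀]) (by linarith only [cd])
  have eda := bar_step (t₁ := -d'.2) (t₂ := d'.1) (r₁ := -d.2) (r₂ := d.1) (t₁' := -a.2)
    (t₂' := a.1) (r₁' := -a'.2) (r₂' := a'.1) (α := d.2 - d'.2 - 1) (ε := d'.1 - d.1)
    (α' := a.1 - a'.1 - 1) (ε' := a.2 - a'.2) hs hs₁ hs₂ (by ring)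
    rfl (by ring) (by ring) bd₁ bd₂
    (abs_le.2 (by constructor <;> linarith only [ha₂, hd₂', hd₂, hs₁, hs₂]))
    (abs_le.2 (by constructor <;> linarith only [ha₂', hd₂', hd₂, hs₁, hs₂]))
    (abs_le.2 (by constructor <;> linarith only [ha₁, hd₁', hd₁, hs₁, hs₂]))
    (abs_le.2 (by constructor <;> linarith only [ha₁', hd₁', hd₁, hs₁, hs₂]))
    (by linarith only [d₁a₀]) (by linarith only [da])
    (by linarith only [d₁a₁]) (by linarith only [da'])
  have la := le_of_one_lt_sq_add_sq ba bε (by linarith only [aa])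
  have lb := le_of_one_lt_sq_add_sq bb₁ bb₂ (by linarith only [bb])
  have lc := le_of_one_lt_sq_add_sq bc₁ bc₂ (by linarith only [cc])
  have ld := le_of_one_lt_sq_add_sq bd₁ bd₂ (by linarith only [dd])
  have sa := le_mul_of_abs_le_add hs₁ hs₂ la
  have sb := le_mul_of_abs_le_add hs₁ hs₂ lb
  have sc := le_mul_of_abs_le_add hs₁ hs₂ lc
  have sd := le_mul_of_abs_le_add hs₁ hs₂ ld
  linarith only [eab, ebc, ecd, eda, la, lb, lc, ld, sa, sb, sc, sd, abs_nonneg (a.1 - a'.1 - 1),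
    abs_nonneg (b.2 - b'.2 - 1), abs_nonneg (c.1 - c'.1 - 1), abs_nonneg (d.2 - d'.2 - 1),
    abs_nonneg (a.2 - a'.2), abs_nonneg (b'.1 - b.1), abs_nonneg (c.2 - c'.2),
    abs_nonneg (d'.1 - d.1)]

theorem near_of_near_target {x τ c t s : ℝ} {m k : ℤ} (hs₁ : 1.732 < s) (hs₂ : s < 1.7321)
    (h : |2048 * (x + m) - τ| ≤ 16) (ht : |(1 + s) * (τ / 2048 + k) + c - t| ≤ 0.0007) :
    |(1 + s) * (x + (m + k : ℤ)) + c - t| ≤ 0.0221 := by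
  have e : (1 + s) * (x + (m + k : ℤ)) + c - t =
      (1 + s) / 2048 * (2048 * (x + m) - τ) + ((1 + s) * (τ / 2048 + k) + c - t) := by
    push_cast; ring
  have h' : |(1 + s) / 2048 * (2048 * (x + m) - τ)| ≤ 2.7321 / 2048 * 16 := by
    rw [abs_mul, abs_of_pos (by linarith)]
    exact mul_le_mul (by linarith) h (abs_nonneg _) (by norm_num)
  rw [e]
  exact (abs_add_le _ _).trans (by linarith)

theorem not_near_lifted_optimum {ps : List (ℝ × ℝ)} (hs : ps.Pairwise Sep) (c : ℝ × ℝ)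
    (h : ∀ t ∈ optimum, ∃ p ∈ ps, ∃ m n : ℤ, |(1 + √3) * (p.1 + m) + c.1 - t.1| ≤ 0.0221 ∧
      |(1 + √3) * (p.2 + n) + c.2 - t.2| ≤ 0.0221) : False := by
  refine not_near_optimum (S := {u | ∃ p ∈ ps, ∃ m n : ℤ,
    u = ((1 + √3) * (p.1 + m) + c.1, (1 + √3) * (p.2 + n) + c.2)}) ?_ ?_
  · rintro _ ⟨p, hp, m, n, rfl⟩ _ ⟨q, hq, m', n', rfl⟩ hpq a b
    have hL : 0 < 1 + √3 := by positivity
    have between {i j : ℤ} {x y : ℝ} (h₁ : 0 < (1 + √3) * (x + i) + y - ((1 + √3) * (x + j) + y))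
        (h₂ : (1 + √3) * (x + i) + y - ((1 + √3) * (x + j) + y) < 1 + √3) : False := by
      have e : (1 + √3) * (x + i) + y - ((1 + √3) * (x + j) + y) = (1 + √3) * (i - j : ℤ) := by
        push_cast; ring
      rw [e] at h₁ h₂
      have h₁ : (0 : ℝ) < (i - j : ℤ) := pos_of_mul_pos_right h₁ hL.le
      have h₂ : ((i - j : ℤ) : ℝ) < 1 := by nlinarith
      have h₁' : 0 < i - j := by exact_mod_cast h₁
      have h₂' : i - j < 1 := by exact_mod_cast h₂
      omega
    have hne : p ≠ q := by
      rintro rfl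
      rcases hpq with ⟨h₁, h₂⟩ | ⟨h₁, h₂⟩
      · exact between h₁ h₂
      · exact between h₁ h₂
    have : Std.Symm Sep := ⟨fun _ _ => Sep.symm⟩
    have hsep := hs.forall hp hq hne (m - m' + a) (n - n' + b)
    have h3 : √3 ^ 2 = 3 := Real.sq_sqrt (by norm_num)
    have hprod : (1 + √3) ^ 2 * ((2 - √3) / 2) = 1 := by linear_combination (-√3 / 2) * h3
    have := mul_lt_mul_of_pos_left hsep (pow_pos hL 2)
    rw [hprod] at this
    refine this.trans_eq ?_
    push_cast
    ring
  · intro t ht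
    obtain ⟨p, hp, m, n, h₁, h₂⟩ := h t ht
    exact ⟨_, ⟨p, hp, m, n, rfl⟩, h₁, h₂⟩

theorem refutes_nearOptimal : Refutes nearOptimal := by
  intro bs ps _ hb hs
  by_contra h
  rw [Bool.not_eq_false, nearOptimal, Bool.or_eq_true] at h
  have hs₁ : 1.73205 < √3 := Real.lt_sqrt_of_sq_lt (by norm_num)
  have hs₂ : √3 < 1.73206 := by rw [Real.sqrt_lt' (by norm_num)]; norm_num
  have lift {ts : List (ℕ × ℕ)} (h : nearTargets ts bs = true) (c : ℝ × ℝ) (τ : ℕ × ℕ) (k l : ℤ)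
      {t : ℝ × ℝ} (hτ : τ ∈ ts) (h₁ : |(1 + √3) * (τ.1 / 2048 + k) + c.1 - t.1| ≤ 0.0007)
      (h₂ : |(1 + √3) * (τ.2 / 2048 + l) + c.2 - t.2| ≤ 0.0007) :
      ∃ p ∈ ps, ∃ m n : ℤ, |(1 + √3) * (p.1 + m) + c.1 - t.1| ≤ 0.0221 ∧
        |(1 + √3) * (p.2 + n) + c.2 - t.2| ≤ 0.0221 := by
    obtain ⟨p, hp, m, n, hm, hn⟩ := nearTargets_sound hb h hτ
    exact ⟨p, hp, m + k, n + l, near_of_near_target (by linarith) (by linarith) hm h₁,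
      near_of_near_target (by linarith) (by linarith) hn h₂⟩
  rcases h with h | h
  · apply not_near_lifted_optimum hs (1 / 2, 0)
    unfold optimum
    repeat rw [List.forall_mem_cons]
    refine ⟨lift h (1 / 2, 0) (0, 0) 0 0 ?_ ?_ ?_,
      lift h (1 / 2, 0) (1298, 0) (-1) 0 ?_ ?_ ?_,
      lift h (1 / 2, 0) (649, 375) 0 0 ?_ ?_ ?_,
      lift h (1 / 2, 0) (649, 1673) 0 (-1) ?_ ?_ ?_,
      lift h (1 / 2, 0) (1024, 1024) 0 0 ?_ ?_ ?_,
      lift h (1 / 2, 0) (274, 1024) 0 0 ?_ ?_ ?_,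
      lift h (1 / 2, 0) (1673, 1399) (-1) 0 ?_ ?_ ?_,
      lift h (1 / 2, 0) (1673, 649) (-1) 0 ?_ ?_ ?_,
      by simp⟩ <;>
    first
    | simp [targetsA]; done
    | rw [abs_le]; constructor <;> push_cast <;> linarith
  · apply not_near_lifted_optimum hs ((1 + √3) / 2, -1 / 2)
    unfold optimum
    repeat rw [List.forall_mem_cons]
    refine ⟨lift h ((1 + √3) / 2, -1 / 2) (1399, 375) (-1) 0 ?_ ?_ ?_,
      lift h ((1 + √3) / 2, -1 / 2) (649, 375) (-1) 0 ?_ ?_ ?_,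
      lift h ((1 + √3) / 2, -1 / 2) (0, 750) 0 0 ?_ ?_ ?_,
      lift h ((1 + √3) / 2, -1 / 2) (0, 0) 0 0 ?_ ?_ ?_,
      lift h ((1 + √3) / 2, -1 / 2) (375, 1399) 0 0 ?_ ?_ ?_,
      lift h ((1 + √3) / 2, -1 / 2) (1673, 1399) (-1) 0 ?_ ?_ ?_,
      lift h ((1 + √3) / 2, -1 / 2) (1024, 1774) (-1) 0 ?_ ?_ ?_,
      lift h ((1 + √3) / 2, -1 / 2) (1024, 1024) (-1) 0 ?_ ?_ ?_,
      by simp⟩ <;>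
    first
    | simp [targetsB]; done
    | rw [abs_le]; constructor <;> push_cast <;> linarith

/-- The point `p` lies in the cell `k`. -/
structure InCell (k : ℕ) (p : ℝ × ℝ) : Prop where
  le_fst : ((k % 4 : ℕ) : ℝ) ≤ 4 * p.1
  fst_le : 4 * p.1 ≤ (k % 4 : ℕ) + 1
  le_snd : ((k / 4 : ℕ) : ℝ) ≤ 4 * p.2
  snd_le : 4 * p.2 ≤ (k / 4 : ℕ) + 1

/-- There are points in the given cells which, together with the origin, are separated. -/
def Realizable (l : List ℕ) : Prop :=
  ∃ f : ℕ → ℝ × ℝ, (∀ k ∈ l, InCell k (f k) ∧ Sep 0 (f k)) ∧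
    ∀ k ∈ l, ∀ k' ∈ l, k ≠ k' → Sep (f k) (f k')

theorem lt_of_mem_cells {k : ℕ} (h : k ∈ cells) : k < 16 := by
  revert k
  decide

theorem InCell.mem_cellBox {k : ℕ} {p : ℝ × ℝ} (hk : k < 16) (h : InCell k p) :
    (cellBox k).Mem p := by
  obtain ⟨h₁, h₂, h₃, h₄⟩ := h
  have hx : ((k % 4 : ℕ) : ℝ) ≤ 3 := by exact_mod_cast (by omega : k % 4 ≤ 3)
  have hy : ((k / 4 : ℕ) : ℝ) ≤ 3 := by exact_mod_cast (by omega : k / 4 ≤ 3)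
  constructor <;> (try simp only [cellBox]) <;> push_cast at * <;> linarith

theorem not_realizable_of_check {l : List ℕ} {P : Plan} (hl : l.Nodup) (hc : ∀ k ∈ l, k ∈ cells)
    (h : P.check (initial l) = true) : ¬ Realizable l := by
  rintro ⟨f, hf, hsep⟩
  have := refutes_check refutes_nearOptimal P (initial l) ((0 : ℝ × ℝ) :: l.map f) (by simp) ?_ ?_
  · simp [this] at h
  · refine List.Forall₂.cons ?_ ?_
    · constructor <;> simp
    · rw [List.forall₂_map_left_iff, List.forall₂_map_right_iff, List.forall₂_same]
      exact fun k hk => (hf k hk).1.mem_cellBox (lt_of_mem_cells (hc k hk))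
  · rw [List.pairwise_cons]
    refine ⟨fun p hp => ?_, ?_⟩
    · obtain ⟨k, hk, rfl⟩ := List.mem_map.1 hp
      exact (hf k hk).2
    · rw [List.pairwise_map]
      exact List.Pairwise.imp_of_mem (fun hk hk' hne => hsep _ hk _ hk' hne) hl

theorem Realizable.map_of_involutive {l : List ℕ} {g : ℕ → ℕ} {σ : ℝ × ℝ → ℝ × ℝ}
    (hg : ∀ k < 16, g (g k) = k) (hcell : ∀ k < 16, ∀ p, InCell k p → InCell (g k) (σ p))
    (hsep : ∀ u v, Sep u v → Sep (σ u) (σ v)) (hzero : ∀ u, Sep 0 u → Sep 0 (σ u))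
    (hl : ∀ k ∈ l, k < 16) (h : Realizable l) : Realizable (l.map g) := by
  obtain ⟨f, hf, hf'⟩ := h
  refine ⟨fun k => σ (f (g k)), ?_, ?_⟩
  · simp only [List.forall_mem_map]
    intro k hk
    rw [hg k (hl k hk)]
    exact ⟨hcell k (hl k hk) _ (hf k hk).1, hzero _ (hf k hk).2⟩
  · simp only [List.forall_mem_map]
    intro k hk k' hk' hne
    rw [hg k (hl k hk), hg k' (hl k' hk')]
    exact hsep _ _ (hf' k hk k' hk' fun e => hne (by rw [e]))

theorem Realizable.map_reflectX {l : List ℕ} (hl : ∀ k ∈ l, k < 16) (h : Realizable l) :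
    Realizable (l.map reflectX) := by
  refine h.map_of_involutive (σ := fun p => (1 - p.1, p.2)) (by decide) ?_ ?_ ?_ hl
  · rintro k hk p ⟨h₁, h₂, h₃, h₄⟩
    have hx : ((reflectX k % 4 : ℕ) : ℝ) + (k % 4 : ℕ) = 3 := by
      exact_mod_cast (by rw [reflectX]; omega : reflectX k % 4 + k % 4 = 3)
    have hy : reflectX k / 4 = k / 4 := by rw [reflectX]; omega
    constructor <;> simp only [hy] <;> linarith
  · intro u v h m n
    have := h (-m) n
    push_cast at this
    linarith
  · intro u h m n
    have := h (1 - m) n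
    push_cast [Prod.fst_zero, Prod.snd_zero] at this ⊢
    linarith

theorem Realizable.map_reflectY {l : List ℕ} (hl : ∀ k ∈ l, k < 16) (h : Realizable l) :
    Realizable (l.map reflectY) := by
  refine h.map_of_involutive (σ := fun p => (p.1, 1 - p.2)) (by decide) ?_ ?_ ?_ hl
  · rintro k hk p ⟨h₁, h₂, h₃, h₄⟩
    have hy : ((reflectY k / 4 : ℕ) : ℝ) + (k / 4 : ℕ) = 3 := by
      exact_mod_cast (by rw [reflectY]; omega : reflectY k / 4 + k / 4 = 3)
    have hx : reflectY k % 4 = k % 4 := by rw [reflectY]; omega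
    constructor <;> simp only [hx] <;> linarith
  · intro u v h m n
    have := h m (-n)
    push_cast at this
    linarith
  · intro u h m n
    have := h m (1 - n)
    push_cast [Prod.fst_zero, Prod.snd_zero] at this ⊢
    linarith

theorem Realizable.map_transpose {l : List ℕ} (hl : ∀ k ∈ l, k < 16) (h : Realizable l) :
    Realizable (l.map transpose) := by
  refine h.map_of_involutive (σ := Prod.swap) (by decide) ?_ ?_ ?_ hl
  · rintro k hk p ⟨h₁, h₂, h₃, h₄⟩
    have hx : transpose k % 4 = k / 4 := by rw [transpose]; omega
    have hy : transpose k / 4 = k % 4 := by rw [transpose]; omega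
    constructor <;> simpa only [hx, hy]
  · intro u v h m n
    rw [add_comm]
    exact h n m
  · intro u h m n
    rw [add_comm]
    exact h n m

theorem Realizable.map_of_mem_symmetries {l : List ℕ} {g : ℕ → ℕ} (hg : g ∈ symmetries)
    (hl : ∀ k ∈ l, k < 16) (h : Realizable l) : Realizable (l.map g) := by
  have hX : ∀ k < 16, reflectX k < 16 := by decide
  have hY : ∀ k < 16, reflectY k < 16 := by decide
  have lt_map {l : List ℕ} {g : ℕ → ℕ} (hg : ∀ k < 16, g k < 16) (hl : ∀ k ∈ l, k < 16) :
      ∀ k ∈ l.map g, k < 16 := by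
    simp only [List.forall_mem_map]
    exact fun k hk => hg k (hl k hk)
  simp only [symmetries, List.mem_cons, List.not_mem_nil, or_false] at hg
  rcases hg with rfl | rfl | rfl | rfl | rfl | rfl | rfl
  · exact h.map_reflectX hl
  · exact h.map_reflectY hl
  · rw [← List.map_map]
    exact (h.map_reflectY hl).map_reflectX (lt_map hY hl)
  · exact h.map_transpose hl
  · rw [← List.map_map]
    exact (h.map_reflectX hl).map_transpose (lt_map hX hl)
  · rw [← List.map_map]
    exact (h.map_reflectY hl).map_transpose (lt_map hY hl)
  · rw [← List.map_map, ← List.map_map]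
    exact ((h.map_reflectY hl).map_reflectX (lt_map hY hl)).map_transpose
      (lt_map hX (lt_map hY hl))

theorem code_eq_of_perm {l l' : List ℕ} (h : l.Perm l') : code l = code l' :=
  (h.map _).sum_eq

theorem not_realizable {l : List ℕ} (hl : l.Nodup) (hc : ∀ k ∈ l, k ∈ cells)
    (hlen : l.length = 7) : ¬ Realizable l := by
  induction hn : code l using Nat.strong_induction_on generalizing l with
  | _ n ih =>
    subst hn
    have hperm : (cells.filter (· ∈ l)).Perm l := by
      rw [List.perm_ext_iff_of_nodup (List.Nodup.filter _ (by decide)) hl]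
      intro k
      simpa using hc k
    rintro ⟨f, hf, hf'⟩
    have hreal : Realizable (cells.filter (· ∈ l)) :=
      ⟨f, fun k hk => hf k (hperm.mem_iff.1 hk),
        fun k hk k' hk' => hf' k (hperm.mem_iff.1 hk) k' (hperm.mem_iff.1 hk')⟩
    have hverify := List.all_eq_true.1 verify_sublists (cells.filter (· ∈ l))
      (List.mem_sublistsLen.2 ⟨List.filter_sublist, by rw [hperm.length_eq, hlen]⟩)
    rw [verify, Bool.or_eq_true, List.any_eq_true] at hverify
    have hc' : ∀ k ∈ cells.filter (· ∈ l), k ∈ cells := fun k hk => List.mem_of_mem_filter hk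
    have hnodup : (cells.filter (· ∈ l)).Nodup := hperm.nodup_iff.2 hl
    rcases hverify with ⟨g, hg, hlt⟩ | hcheck
    · have hsym : ∀ g ∈ symmetries, (∀ k ∈ cells, g k ∈ cells) ∧
          ∀ k ∈ cells, ∀ k' ∈ cells, g k = g k' → k = k' := by decide
      refine ih _ (by rw [← code_eq_of_perm hperm]; simpa [Nat.blt_eq] using hlt)
        ((List.nodup_map_iff_inj_on hnodup).2 fun k hk k' hk' =>
          (hsym g hg).2 k (hc' k hk) k' (hc' k' hk')) ?_ ?_ rfl
        (hreal.map_of_mem_symmetries hg fun k hk => lt_of_mem_cells (hc' k hk))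
      · simp only [List.forall_mem_map]
        exact fun k hk => (hsym g hg).1 k (hc' k hk)
      · rw [List.length_map, hperm.length_eq, hlen]
    · exact not_realizable_of_check hnodup hc' hcheck hreal

theorem not_sep_of_abs_le {u v : ℝ × ℝ} {m n : ℤ} (h₁ : |u.1 - v.1 + m| ≤ 1 / 4)
    (h₂ : |u.2 - v.2 + n| ≤ 1 / 4) : ¬ Sep u v := by
  intro h
  have hs : √3 < 1.7321 := by rw [Real.sqrt_lt' (by norm_num)]; norm_num
  have := h m n
  have := sq_le_sq' (abs_le.1 h₁).1 (abs_le.1 h₁).2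
  have := sq_le_sq' (abs_le.1 h₂).1 (abs_le.1 h₂).2
  linarith

theorem not_sep_of_inCell {k : ℕ} {u v : ℝ × ℝ} (hu : InCell k u) (hv : InCell k v) :
    ¬ Sep u v := by
  obtain ⟨h₁, h₂, h₃, h₄⟩ := hu
  obtain ⟨h₁', h₂', h₃', h₄'⟩ := hv
  refine not_sep_of_abs_le (m := 0) (n := 0) ?_ ?_ <;> rw [abs_le] <;>
    constructor <;> push_cast <;> linarith

/-- The cell of a point of the unit square. -/
def cellOf (p : ℝ × ℝ) : ℕ := ⌊4 * p.1⌋₊ + 4 * ⌊4 * p.2⌋₊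

theorem inCell_cellOf {p : ℝ × ℝ} (h₁ : 0 ≤ p.1) (h₂ : p.1 < 1) (h₃ : 0 ≤ p.2) :
    InCell (cellOf p) p := by
  have hlt : ⌊4 * p.1⌋₊ < 4 := (Nat.floor_lt (by linarith)).2 (by push_cast; linarith)
  have hx : cellOf p % 4 = ⌊4 * p.1⌋₊ := by rw [cellOf]; omega
  have hy : cellOf p / 4 = ⌊4 * p.2⌋₊ := by rw [cellOf]; omega
  constructor
  · rw [hx]; exact Nat.floor_le (by linarith)
  · rw [hx]; exact (Nat.lt_floor_add_one _).le
  · rw [hy]; exact Nat.floor_le (by linarith)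
  · rw [hy]; exact (Nat.lt_floor_add_one _).le

theorem cellOf_mem_cells {p : ℝ × ℝ} (h₁ : 0 ≤ p.1) (h₂ : p.1 < 1) (h₃ : 0 ≤ p.2)
    (h₄ : p.2 < 1) (h : Sep 0 p) : cellOf p ∈ cells := by
  have hcell := inCell_cellOf h₁ h₂ h₃
  have hx : ⌊4 * p.1⌋₊ < 4 := (Nat.floor_lt (by linarith)).2 (by push_cast; linarith)
  have hy : ⌊4 * p.2⌋₊ < 4 := (Nat.floor_lt (by linarith)).2 (by push_cast; linarith)
  have hlt : cellOf p < 16 := by rw [cellOf]; omega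
  have corners : ∀ k < 16, k ∈ cells ∨ ∃ m < 2, ∃ n < 2, k = 3 * m + 4 * (3 * n) := by decide
  refine (corners _ hlt).resolve_right ?_
  rintro ⟨m, hm, n, hn, hk⟩
  rw [hk] at hcell
  obtain ⟨c₁, c₂, c₃, c₄⟩ := hcell
  rw [show (3 * m + 4 * (3 * n)) % 4 = 3 * m by omega] at c₁ c₂
  rw [show (3 * m + 4 * (3 * n)) / 4 = 3 * n by omega] at c₃ c₄
  push_cast at c₁ c₂ c₃ c₄
  have bound {x : ℝ} {m : ℕ} (hm : m < 2) (h₁ : 0 ≤ x) (h₂ : x < 1) (h₃ : 3 * m ≤ 4 * x)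
      (h₄ : 4 * x ≤ 3 * m + 1) : |0 - x + (m : ℤ)| ≤ 1 / 4 := by
    rw [abs_le]
    interval_cases m <;> constructor <;> push_cast at * <;> linarith
  exact not_sep_of_abs_le (bound hm h₁ h₂ c₁ c₂) (bound hn h₃ h₄ c₃ c₄) h

theorem not_pairwise_sep (p : Fin 8 → ℝ × ℝ) : ¬ Pairwise fun i j => Sep (p i) (p j) := by
  intro h
  let q : Fin 8 → ℝ × ℝ := fun i => (Int.fract ((p i).1 - (p 0).1), Int.fract ((p i).2 - (p 0).2))
  have hq : Pairwise fun i j => Sep (q i) (q j) := by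
    intro i j hij m n
    have := h hij (m - ⌊(p i).1 - (p 0).1⌋ + ⌊(p j).1 - (p 0).1⌋)
      (n - ⌊(p i).2 - (p 0).2⌋ + ⌊(p j).2 - (p 0).2⌋)
    convert this using 3 <;> simp only [q, Int.fract] <;> push_cast <;> ring
  have hq0 : q 0 = 0 := by simp [q]
  have b₁ (i) : 0 ≤ (q i).1 := Int.fract_nonneg _
  have b₂ (i) : (q i).1 < 1 := Int.fract_lt_one _
  have b₃ (i) : 0 ≤ (q i).2 := Int.fract_nonneg _
  have b₄ (i) : (q i).2 < 1 := Int.fract_lt_one _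
  have hcell (i) : InCell (cellOf (q i)) (q i) := inCell_cellOf (b₁ i) (b₂ i) (b₃ i)
  let c : Fin 7 → ℕ := fun i => cellOf (q i.succ)
  have hc : Function.Injective c := by
    intro i j hij
    by_contra hne
    have hj := hcell j.succ
    rw [← show c i = cellOf (q j.succ) from hij] at hj
    exact not_sep_of_inCell (hcell i.succ) hj (hq (by simpa using hne))
  have hzero (i : Fin 7) : Sep 0 (q i.succ) := hq0 ▸ hq (Fin.succ_ne_zero i).symm
  have hinv (i : Fin 7) : Function.invFun c (c i) = i := Function.leftInverse_invFun hc i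
  refine not_realizable (l := List.ofFn c) (List.nodup_ofFn.2 hc) ?_ (by simp)
    ⟨fun k => q (Function.invFun c k).succ, ?_, ?_⟩
  · simp only [List.forall_mem_ofFn_iff]
    exact fun i => cellOf_mem_cells (b₁ _) (b₂ _) (b₃ _) (b₄ _) (hzero i)
  · simp only [List.forall_mem_ofFn_iff, hinv]
    exact fun i => ⟨hcell i.succ, hzero i⟩
  · simp only [List.forall_mem_ofFn_iff, hinv]
    exact fun i j hij => hq (by simpa using fun e => hij (by rw [e]))

end

end TorusPacking

/-- For every configuration of 8 points on the square flat torus, the minimal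
toroidal distance is at most `1 / (1 + √3)`. -/
theorem eight_points_min_dist_le (p : Fin 8 → ℝ × ℝ) :
    ∃ i j : Fin 8, i ≠ j ∧ ∃ m n : ℤ,
      e2norm (p i - p j + ((m : ℝ), (n : ℝ))) ≤ 1 / (1 + Real.sqrt 3) := by
  by_contra! h
  refine TorusPacking.not_pairwise_sep p fun i j hij m n => ?_
  have := h i j hij m n
  rw [e2norm, Real.lt_sqrt (by positivity)] at this
  have h3 : √3 ^ 2 = 3 := Real.sq_sqrt (by norm_num)
  have e : (1 / (1 + √3)) ^ 2 = (2 - √3) / 2 := by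
    field_simp
    linear_combination (√3) * h3
  rw [e] at this
  simpa using this
end
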